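/- The space S_{18,2}(Γ₂,ε) has dimension 1 over ℂ. -/

import Mathlib

noncomputable section

open Matrix Complex Filter Topology

/-- The standard symplectic form matrix of size 4. -/
def J4 : Matrix (Fin 4) (Fin 4) ℤ := !![0,0,1,0; 0,0,0,1; -1,0,0,0; 0,-1,0,0]

/-- The Siegel modular group `Γ₂ = Sp(4,ℤ)`, as a set of 4×4 integer matrices. -/
def Sp4Z : Set (Matrix (Fin 4) (Fin 4) ℤ) := {γ | γᵀ * J4 * γ = J4}

/-- The principal congruence subgroup `Γ₂[2]` of level 2. -/
def Sp4Z2 : Set (Matrix (Fin 4) (Fin 4) ℤ) :=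
  {γ | γ ∈ Sp4Z ∧ ∀ i j, ((γ i j : ZMod 2) = if i = j then 1 else 0)}

/-- The Siegel upper half space of degree 2: symmetric 2×2 complex matrices with
positive definite imaginary part (encoded as functions `Fin 2 → Fin 2 → ℂ`). -/
def H2 : Set (Fin 2 → Fin 2 → ℂ) :=
  {τ | (Matrix.of τ).IsSymm ∧ (Matrix.of fun i j => (τ i j).im).PosDef}

/-- The four 2×2 blocks of a 4×4 integer matrix, as complex matrices. -/
def blk (γ : Matrix (Fin 4) (Fin 4) ℤ) (r s : Fin 2) : Matrix (Fin 2) (Fin 2) ℂ :=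
  Matrix.of fun i j =>
    ((γ ⟨2 * (r : ℕ) + (i : ℕ), by have h1 := r.isLt; have h2 := i.isLt; omega⟩
        ⟨2 * (s : ℕ) + (j : ℕ), by have h1 := s.isLt; have h2 := j.isLt; omega⟩ : ℤ) : ℂ)

/-- The factor `cτ + d`. -/
def den (γ : Matrix (Fin 4) (Fin 4) ℤ) (τ : Fin 2 → Fin 2 → ℂ) : Matrix (Fin 2) (Fin 2) ℂ :=
  blk γ 1 0 * Matrix.of τ + blk γ 1 1

/-- The action `γ·τ = (aτ+b)(cτ+d)⁻¹` of `Sp(4)` on the Siegel upper half space. -/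
def moeb (γ : Matrix (Fin 4) (Fin 4) ℤ) (τ : Fin 2 → Fin 2 → ℂ) : Fin 2 → Fin 2 → ℂ :=
  fun i j => ((blk γ 0 0 * Matrix.of τ + blk γ 0 1) * (den γ τ)⁻¹) i j

/-- Matrix coefficients of the `j`-th symmetric power of the standard representation of
`GL(2,ℂ)`, in the basis `x₁^(j-i) x₂^i`. -/
def symCoeff (j : ℕ) (m : Matrix (Fin 2) (Fin 2) ℂ) (l i : Fin (j + 1)) : ℂ :=
  (((Polynomial.C (m 0 0) + Polynomial.C (m 1 0) * Polynomial.X) ^ (j - (l : ℕ)) *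
    (Polynomial.C (m 0 1) + Polynomial.C (m 1 1) * Polynomial.X) ^ (l : ℕ)).coeff i)

/-- The `j`-th symmetric power `Sym^j(m)` acting on coordinate vectors. -/
def symAct (j : ℕ) (m : Matrix (Fin 2) (Fin 2) ℂ) (v : Fin (j + 1) → ℂ) : Fin (j + 1) → ℂ :=
  fun i => ∑ l, symCoeff j m l i * v l

lemma symAct_add (j : ℕ) (m : Matrix (Fin 2) (Fin 2) ℂ) (v w : Fin (j + 1) → ℂ) :
    symAct j m (v + w) = symAct j m v + symAct j m w := by
  funext i
  simp [symAct, mul_add, Finset.sum_add_distrib]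

lemma symAct_smul (j : ℕ) (m : Matrix (Fin 2) (Fin 2) ℂ) (a : ℂ) (v : Fin (j + 1) → ℂ) :
    symAct j m (a • v) = a • symAct j m v := by
  funext i
  simp only [symAct, Pi.smul_apply, smul_eq_mul, Finset.mul_sum]
  exact Finset.sum_congr rfl fun l _ => by ring

lemma symAct_zero (j : ℕ) (m : Matrix (Fin 2) (Fin 2) ℂ) : symAct j m 0 = 0 := by
  funext i; simp [symAct]

/-- The weight `(j,k)` automorphy action `Sym^j(m) ⊗ det(m)^k`. -/
def wt (j : ℕ) (k : ℤ) (m : Matrix (Fin 2) (Fin 2) ℂ) (v : Fin (j + 1) → ℂ) :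
    Fin (j + 1) → ℂ :=
  (m.det ^ k) • symAct j m v

lemma wt_add (j : ℕ) (k : ℤ) (m : Matrix (Fin 2) (Fin 2) ℂ) (v w : Fin (j + 1) → ℂ) :
    wt j k m (v + w) = wt j k m v + wt j k m w := by
  simp [wt, symAct_add, smul_add]

lemma wt_smul (j : ℕ) (k : ℤ) (m : Matrix (Fin 2) (Fin 2) ℂ) (a : ℂ) (v : Fin (j + 1) → ℂ) :
    wt j k m (a • v) = a • wt j k m v := by
  rw [wt, wt, symAct_smul, smul_comm]

lemma wt_zero (j : ℕ) (k : ℤ) (m : Matrix (Fin 2) (Fin 2) ℂ) : wt j k m 0 = 0 := by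
  simp [wt, symAct_zero]

/-- The slash operation `(F|γ)(τ) = Sym^j(cτ+d)⁻¹ det(cτ+d)⁻ᵏ F(γ·τ)`. -/
def slashS (j : ℕ) (k : ℤ) (γ : Matrix (Fin 4) (Fin 4) ℤ)
    (F : (Fin 2 → Fin 2 → ℂ) → (Fin (j + 1) → ℂ)) (τ : Fin 2 → Fin 2 → ℂ) :
    Fin (j + 1) → ℂ :=
  ((den γ τ).det ^ (-k)) • symAct j ((den γ τ)⁻¹) (F (moeb γ τ))

lemma slashS_add (j : ℕ) (k : ℤ) (γ : Matrix (Fin 4) (Fin 4) ℤ)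
    (F G : (Fin 2 → Fin 2 → ℂ) → (Fin (j + 1) → ℂ)) (τ : Fin 2 → Fin 2 → ℂ) :
    slashS j k γ (F + G) τ = slashS j k γ F τ + slashS j k γ G τ := by
  simp [slashS, symAct_add, smul_add]

lemma slashS_smul (j : ℕ) (k : ℤ) (γ : Matrix (Fin 4) (Fin 4) ℤ) (a : ℂ)
    (F : (Fin 2 → Fin 2 → ℂ) → (Fin (j + 1) → ℂ)) (τ : Fin 2 → Fin 2 → ℂ) :
    slashS j k γ (a • F) τ = a • slashS j k γ F τ := by
  simp only [slashS, Pi.smul_apply, symAct_smul]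
  rw [smul_comm]

lemma slashS_zero (j : ℕ) (k : ℤ) (γ : Matrix (Fin 4) (Fin 4) ℤ) (τ : Fin 2 → Fin 2 → ℂ) :
    slashS j k γ (0 : (Fin 2 → Fin 2 → ℂ) → (Fin (j + 1) → ℂ)) τ = 0 := by
  simp [slashS, symAct_zero]

/-- The diagonal point `diag(τ₁,τ₂)` of the Siegel upper half space. -/
def diagH (τ₁ τ₂ : ℂ) : Fin 2 → Fin 2 → ℂ :=
  fun i j => if i = j then (if i = 0 then τ₁ else τ₂) else 0

/-- `F` is a Siegel cusp form of degree 2 and weight `(j,k)` on `Γ`, with character `χ`: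
holomorphic on `ℍ₂`, transforming by `F(γ·τ) = χ(γ) Sym^j(cτ+d) det(cτ+d)^k F(τ)` for `γ ∈ Γ`,
with `(F|γ)(diag(τ₁,it)) → 0` as `t → ∞` for every `γ ∈ Γ₂`, and (normalization) vanishing
off `ℍ₂`. -/
def IsSiegelCuspForm (j : ℕ) (k : ℤ) (Γ : Set (Matrix (Fin 4) (Fin 4) ℤ))
    (χ : Matrix (Fin 4) (Fin 4) ℤ → ℂ)
    (F : (Fin 2 → Fin 2 → ℂ) → (Fin (j + 1) → ℂ)) : Prop :=
  DifferentiableOn ℂ F H2 ∧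
  (∀ γ ∈ Γ, ∀ τ ∈ H2, F (moeb γ τ) = χ γ • wt j k (den γ τ) (F τ)) ∧
  (∀ γ ∈ Sp4Z, ∀ τ₁ : ℂ, 0 < τ₁.im →
    Tendsto (fun t : ℝ => slashS j k γ F (diagH τ₁ (t * Complex.I))) atTop (𝓝 0)) ∧
  (∀ τ, τ ∉ H2 → F τ = 0)

/-- The space `S_{j,k}(Γ, χ)` of Siegel cusp forms of degree 2 and weight `(j,k)` on `Γ`
with character `χ`, as a complex vector space. -/
def SiegelCusp (j : ℕ) (k : ℤ) (Γ : Set (Matrix (Fin 4) (Fin 4) ℤ))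
    (χ : Matrix (Fin 4) (Fin 4) ℤ → ℂ) :
    Submodule ℂ ((Fin 2 → Fin 2 → ℂ) → (Fin (j + 1) → ℂ)) where
  carrier := {F | IsSiegelCuspForm j k Γ χ F}
  add_mem' := by
    rintro F G hF hG
    refine ⟨hF.1.add hG.1, ?_, ?_, ?_⟩
    · intro γ hγ τ hτ
      show F (moeb γ τ) + G (moeb γ τ) = χ γ • wt j k (den γ τ) (F τ + G τ)
      rw [wt_add, smul_add, hF.2.1 γ hγ τ hτ, hG.2.1 γ hγ τ hτ]
    · intro γ hγ τ₁ hτ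
      have h := (hF.2.2.1 γ hγ τ₁ hτ).add (hG.2.2.1 γ hγ τ₁ hτ)
      rw [add_zero] at h
      exact h.congr fun t => (slashS_add j k γ F G _).symm
    · intro τ hτ
      show F τ + G τ = 0
      rw [hF.2.2.2 τ hτ, hG.2.2.2 τ hτ, add_zero]
  zero_mem' := by
    refine ⟨?_, ?_, ?_, ?_⟩
    · exact differentiableOn_const 0
    · intro γ hγ τ hτ
      show (0 : Fin (j + 1) → ℂ) = χ γ • wt j k (den γ τ) 0
      rw [wt_zero, smul_zero]
    · intro γ hγ τ₁ hτ
      have : (fun t : ℝ => slashS j k γ (0 : (Fin 2 → Fin 2 → ℂ) → (Fin (j + 1) → ℂ))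
          (diagH τ₁ (t * Complex.I))) = fun _ => 0 := by
        funext t; exact slashS_zero j k γ _
      rw [this]
      exact tendsto_const_nhds
    · intro τ _; rfl
  smul_mem' := by
    rintro a F hF
    refine ⟨hF.1.const_smul a, ?_, ?_, ?_⟩
    · intro γ hγ τ hτ
      show a • F (moeb γ τ) = χ γ • wt j k (den γ τ) (a • F τ)
      rw [hF.2.1 γ hγ τ hτ, wt_smul, smul_comm]
    · intro γ hγ τ₁ hτ
      have h := (hF.2.2.1 γ hγ τ₁ hτ).const_smul a
      rw [smul_zero] at h
      exact h.congr fun t => (slashS_smul j k γ a F _).symm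
    · intro τ hτ
      show a • F τ = 0
      rw [hF.2.2.2 τ hτ, smul_zero]

/-- `ε` is (on `Γ₂`) the unique nontrivial homomorphism `Γ₂ → {±1}`. -/
def IsEps (ε : Matrix (Fin 4) (Fin 4) ℤ → ℂ) : Prop :=
  (∀ γ ∈ Sp4Z, ε γ = 1 ∨ ε γ = -1) ∧
  (∀ γ ∈ Sp4Z, ∀ δ ∈ Sp4Z, ε (γ * δ) = ε γ * ε δ) ∧
  (∃ γ ∈ Sp4Z, ε γ ≠ 1)

abbrev M4 := Matrix (Fin 4) (Fin 4) ℤ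

def io1 (a b c d : ℤ) : M4 := !![a,0,b,0;0,1,0,0;c,0,d,0;0,0,0,1]
def io2 (a b c d : ℤ) : M4 := !![1,0,0,0;0,a,0,b;0,0,1,0;0,c,0,d]
def io3 (a b c d : ℤ) : M4 := !![a,b,0,0;c,d,0,0;0,0,d,-c;0,0,-b,a]
def sw : M4 := !![0,1,0,0;1,0,0,0;0,0,0,1;0,0,1,0]
def toff (n : ℤ) : M4 := !![1,0,0,n;0,1,n,0;0,0,1,0;0,0,0,1]

lemma sp_mul {γ δ : M4} (h : γ ∈ Sp4Z) (h' : δ ∈ Sp4Z) : γ * δ ∈ Sp4Z := by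
  simp only [Sp4Z, Set.mem_ofPred_eq] at *
  rw [transpose_mul, show δᵀ * γᵀ * J4 * (γ * δ) = δᵀ * (γᵀ * J4 * γ) * δ by
    simp only [Matrix.mul_assoc], h, h']

lemma m4mul (a00 a01 a02 a03 a10 a11 a12 a13 a20 a21 a22 a23 a30 a31 a32 a33
  b00 b01 b02 b03 b10 b11 b12 b13 b20 b21 b22 b23 b30 b31 b32 b33 : ℤ) :
  (!![a00,a01,a02,a03;a10,a11,a12,a13;a20,a21,a22,a23;a30,a31,a32,a33] *
  !![b00,b01,b02,b03;b10,b11,b12,b13;b20,b21,b22,b23;b30,b31,b32,b33] : M4) =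
  !![a00*b00+a01*b10+a02*b20+a03*b30, a00*b01+a01*b11+a02*b21+a03*b31,
     a00*b02+a01*b12+a02*b22+a03*b32, a00*b03+a01*b13+a02*b23+a03*b33;
     a10*b00+a11*b10+a12*b20+a13*b30, a10*b01+a11*b11+a12*b21+a13*b31,
     a10*b02+a11*b12+a12*b22+a13*b32, a10*b03+a11*b13+a12*b23+a13*b33;
     a20*b00+a21*b10+a22*b20+a23*b30, a20*b01+a21*b11+a22*b21+a23*b31,
     a20*b02+a21*b12+a22*b22+a23*b32, a20*b03+a21*b13+a22*b23+a23*b33;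
     a30*b00+a31*b10+a32*b20+a33*b30, a30*b01+a31*b11+a32*b21+a33*b31,
     a30*b02+a31*b12+a32*b22+a33*b32, a30*b03+a31*b13+a32*b23+a33*b33] := by
  ext i j
  rw [Matrix.mul_apply, Fin.sum_univ_four]
  fin_cases i <;> fin_cases j <;> rfl
lemma m4eq (a00 a01 a02 a03 a10 a11 a12 a13 a20 a21 a22 a23 a30 a31 a32 a33
  b00 b01 b02 b03 b10 b11 b12 b13 b20 b21 b22 b23 b30 b31 b32 b33 : ℤ) :
  (!![a00,a01,a02,a03;a10,a11,a12,a13;a20,a21,a22,a23;a30,a31,a32,a33] : M4) =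
  !![b00,b01,b02,b03;b10,b11,b12,b13;b20,b21,b22,b23;b30,b31,b32,b33] ↔
  (a00 = b00 ∧ a01 = b01 ∧ a02 = b02 ∧ a03 = b03) ∧ (a10 = b10 ∧ a11 = b11 ∧ a12 = b12 ∧ a13 = b13) ∧
  (a20 = b20 ∧ a21 = b21 ∧ a22 = b22 ∧ a23 = b23) ∧ (a30 = b30 ∧ a31 = b31 ∧ a32 = b32 ∧ a33 = b33) := by
  constructor
  · intro h
    have g : ∀ i j, _ := fun i j => congrFun (congrFun h i) j
    exact ⟨⟨g 0 0, g 0 1, g 0 2, g 0 3⟩, ⟨g 1 0, g 1 1, g 1 2, g 1 3⟩, ⟨g 2 0, g 2 1, g 2 2, g 2 3⟩, ⟨g 3 0, g 3 1, g 3 2, g 3 3⟩⟩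
  · rintro ⟨⟨rfl, rfl, rfl, rfl⟩, ⟨rfl, rfl, rfl, rfl⟩, ⟨rfl, rfl, rfl, rfl⟩, ⟨rfl, rfl, rfl, rfl⟩⟩
    rfl
lemma m4eta (γ : M4) : γ = !![γ 0 0,γ 0 1,γ 0 2,γ 0 3;γ 1 0,γ 1 1,γ 1 2,γ 1 3;
    γ 2 0,γ 2 1,γ 2 2,γ 2 3;γ 3 0,γ 3 1,γ 3 2,γ 3 3] := by
  ext i j; fin_cases i <;> fin_cases j <;> rfl
lemma sp_iff (a00 a01 a02 a03 a10 a11 a12 a13 a20 a21 a22 a23 a30 a31 a32 a33 : ℤ) :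
  (!![a00,a01,a02,a03;a10,a11,a12,a13;a20,a21,a22,a23;a30,a31,a32,a33] : M4) ∈ Sp4Z ↔
  (a00*a21+a10*a31-a20*a01-a30*a11 = 0 ∧ a00*a22+a10*a32-a20*a02-a30*a12 = 1 ∧
   a00*a23+a10*a33-a20*a03-a30*a13 = 0 ∧ a01*a22+a11*a32-a21*a02-a31*a12 = 0 ∧
   a01*a23+a11*a33-a21*a03-a31*a13 = 1 ∧ a02*a23+a12*a33-a22*a03-a32*a13 = 0) := by
  have ht : (!![a00,a01,a02,a03;a10,a11,a12,a13;a20,a21,a22,a23;a30,a31,a32,a33] : M4)ᵀ =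
    !![a00,a10,a20,a30;a01,a11,a21,a31;a02,a12,a22,a32;a03,a13,a23,a33] := m4eta _
  rw [Sp4Z, Set.mem_ofPred_eq, ht, J4, m4mul, m4mul, m4eq]
  constructor
  · rintro ⟨⟨_, h01, h02, h03⟩, ⟨_, _, h12, h13⟩, ⟨_, _, _, h23⟩, _⟩
    refine ⟨?_, ?_, ?_, ?_, ?_, ?_⟩ <;> linarith
  · rintro ⟨h1, h2, h3, h4, h5, h6⟩
    refine ⟨⟨?_, ?_, ?_, ?_⟩, ⟨?_, ?_, ?_, ?_⟩, ⟨?_, ?_, ?_, ?_⟩, ⟨?_, ?_, ?_, ?_⟩⟩ <;> linarith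

lemma io1_mem {a b c d : ℤ} (h : a * d - b * c = 1) : io1 a b c d ∈ Sp4Z := by
  rw [io1, sp_iff]; refine ⟨?_, ?_, ?_, ?_, ?_, ?_⟩ <;> linarith
lemma io2_mem {a b c d : ℤ} (h : a * d - b * c = 1) : io2 a b c d ∈ Sp4Z := by
  rw [io2, sp_iff]; refine ⟨?_, ?_, ?_, ?_, ?_, ?_⟩ <;> linarith
lemma io3_mem {a b c d : ℤ} (h : a * d - b * c = 1) : io3 a b c d ∈ Sp4Z := by
  rw [io3, sp_iff]; refine ⟨?_, ?_, ?_, ?_, ?_, ?_⟩ <;> linarith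
lemma sw_mem : sw ∈ Sp4Z := by
  rw [sw, sp_iff]; norm_num
lemma toff_mem (n : ℤ) : toff n ∈ Sp4Z := by
  rw [toff, sp_iff]; refine ⟨?_, ?_, ?_, ?_, ?_, ?_⟩ <;> ring

lemma io1_mul (a b c d a' b' c' d' : ℤ) : io1 a b c d * io1 a' b' c' d' =
    io1 (a*a'+b*c') (a*b'+b*d') (c*a'+d*c') (c*b'+d*d') := by simp [io1]
lemma io2_mul (a b c d a' b' c' d' : ℤ) : io2 a b c d * io2 a' b' c' d' =
    io2 (a*a'+b*c') (a*b'+b*d') (c*a'+d*c') (c*b'+d*d') := by simp [io2]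
lemma io3_mul (a b c d a' b' c' d' : ℤ) : io3 a b c d * io3 a' b' c' d' =
    io3 (a*a'+b*c') (a*b'+b*d') (c*a'+d*c') (c*b'+d*d') := by
  simp [io3]; constructor <;> ring
lemma io1_one : io1 1 0 0 1 = 1 := by simp only [io1]; decide
lemma io2_one : io2 1 0 0 1 = 1 := by simp only [io2]; decide
lemma io3_one : io3 1 0 0 1 = 1 := by simp only [io3]; decide
lemma sw_io1_sw (a b c d : ℤ) : sw * io1 a b c d * sw = io2 a b c d := by
  simp [io1, io2, sw]

/-- closure induction for SL2(Z) as a monoid -/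
lemma sl2_ind (P : ℤ → ℤ → ℤ → ℤ → Prop) (hS : P 0 (-1) 1 0) (hT : P 1 1 0 1)
    (hmul : ∀ a b c d a' b' c' d', a*d-b*c=1 → a'*d'-b'*c'=1 → P a b c d → P a' b' c' d' →
      P (a*a'+b*c') (a*b'+b*d') (c*a'+d*c') (c*b'+d*d')) {a b c d : ℤ} (h : a*d-b*c=1) :
    P a b c d := by
  have hm1 : P (-1) 0 0 (-1) := by
    have := hmul _ _ _ _ _ _ _ _ (by norm_num) (by norm_num) hS hS
    norm_num at this; exact this
  have hSi : P 0 1 (-1) 0 := by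
    have := hmul _ _ _ _ _ _ _ _ (by norm_num) (by norm_num) hm1 hS
    norm_num at this; exact this
  have h1 : P 1 0 0 1 := by
    have := hmul _ _ _ _ _ _ _ _ (by norm_num) (by norm_num) hSi hS
    norm_num at this; exact this
  have hTi : P 1 (-1) 0 1 := by
    have h1 := hmul _ _ _ _ _ _ _ _ (by norm_num) (by norm_num) hS hT
    have h2 := hmul _ _ _ _ _ _ _ _ (by norm_num) (by norm_num) h1 h1
    have h3 := hmul _ _ _ _ _ _ _ _ (by norm_num) (by norm_num) h2 hSi
    norm_num at h3; exact h3
  have key : ∀ g : SpecialLinearGroup (Fin 2) ℤ, P (g 0 0) (g 0 1) (g 1 0) (g 1 1) := by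
    intro g
    have hg : g ∈ Subgroup.closure {ModularGroup.S, ModularGroup.T} := by
      rw [SpecialLinearGroup.SL2Z_generators]; trivial
    have hdet : ∀ g : SpecialLinearGroup (Fin 2) ℤ, g 0 0 * g 1 1 - g 0 1 * g 1 0 = 1 := by
      intro g
      have := g.det_coe; rwa [Matrix.det_fin_two] at this
    have hmul' : ∀ g h : SpecialLinearGroup (Fin 2) ℤ, P (g 0 0) (g 0 1) (g 1 0) (g 1 1) →
      P (h 0 0) (h 0 1) (h 1 0) (h 1 1) →
      P ((g*h) 0 0) ((g*h) 0 1) ((g*h) 1 0) ((g*h) 1 1) := by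
      intro g h hg hh
      have := hmul _ _ _ _ _ _ _ _ (hdet g) (hdet h) hg hh
      simpa [Matrix.mul_apply, Fin.sum_univ_two] using this
    induction hg using Subgroup.closure_induction_left with
    | one => simpa using h1
    | mul_left x hx y hy ih =>
      apply hmul' _ _ _ ih
      rcases hx with rfl | rfl
      · simpa [ModularGroup.S] using hS
      · simpa [ModularGroup.T] using hT
    | inv_mul_cancel x hx y hy ih =>
      apply hmul' _ _ _ ih
      rcases hx with rfl | rfl
      · rw [SpecialLinearGroup.SL2_inv_expl]; simpa [ModularGroup.S] using hSi
      · rw [SpecialLinearGroup.SL2_inv_expl]; simpa [ModularGroup.T] using hTi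
  simpa using key ⟨!![a,b;c,d], by rw [Matrix.det_fin_two]; simpa using h⟩

lemma sl2_gcd (a c : ℤ) : ∃ p q r s : ℤ, p*s-q*r=1 ∧ ∃ g : ℤ, p*a+q*c = g ∧ r*a+s*c=0 := by
  by_cases h : (Int.gcd a c : ℤ) = 0
  · refine ⟨1,0,0,1, by norm_num, a, by ring, ?_⟩
    have : Int.gcd a c = 0 := by exact_mod_cast h
    rw [Int.gcd_eq_zero_iff] at this
    simp [this]
  · obtain ⟨u, hu⟩ := Int.gcd_dvd_left (a := a) (b := c)
    obtain ⟨v, hv⟩ := Int.gcd_dvd_right (a := a) (b := c)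
    have := Int.gcd_eq_gcd_ab a c
    set g : ℤ := (Int.gcd a c : ℤ)
    refine ⟨Int.gcdA a c, Int.gcdB a c, -v, u, ?_, g, ?_, ?_⟩
    · apply mul_left_cancel₀ h
      calc _ = (g * u) * Int.gcdA a c + (g * v) * Int.gcdB a c := by ring
        _ = _ := by rw [← hu, ← hv, mul_one, ← this]
    · rw [this]; ring
    · linear_combination -v * hu + u * hv

theorem sp4_ind (P : M4 → Prop) (hmul : ∀ γ ∈ Sp4Z, ∀ δ ∈ Sp4Z, P γ → P δ → P (γ * δ))
    (hT : P (io1 1 1 0 1)) (hJ : P (io1 0 (-1) 1 0)) (hW : P sw) (hU : P (io3 1 1 0 1)) :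
    ∀ γ ∈ Sp4Z, P γ := by
  have h1 : ∀ a b c d, a*d-b*c=1 → P (io1 a b c d) := by
    intro a b c d h
    refine sl2_ind (fun a b c d => P (io1 a b c d)) hJ hT ?_ h
    intro a b c d a' b' c' d' h h' p p'
    rw [← io1_mul]; exact hmul _ (io1_mem h) _ (io1_mem h') p p'
  have h2 : ∀ a b c d, a*d-b*c=1 → P (io2 a b c d) := by
    intro a b c d h
    rw [← sw_io1_sw]
    exact hmul _ (sp_mul sw_mem (io1_mem h)) _ sw_mem
      (hmul _ sw_mem _ (io1_mem h) hW (h1 _ _ _ _ h)) hW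
  have hw : P (io3 0 (-1) 1 0) := by
    have : io3 0 (-1) 1 0 = io1 (-1) 0 0 (-1) * sw := by
      simp only [io1, io3, sw]; decide
    rw [this]; exact hmul _ (io1_mem (by norm_num)) _ sw_mem (h1 _ _ _ _ (by norm_num)) hW
  have h3 : ∀ a b c d, a*d-b*c=1 → P (io3 a b c d) := by
    intro a b c d h
    refine sl2_ind (fun a b c d => P (io3 a b c d)) hw hU ?_ h
    intro a b c d a' b' c' d' h h' p p'
    rw [← io3_mul]; exact hmul _ (io3_mem h) _ (io3_mem h') p p'
  have hoff : ∀ n, P (toff n) := by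
    intro n
    have : toff n = io3 1 n 0 1 * io2 1 1 0 1 * io3 1 (-n) 0 1 * io1 1 (-n*n) 0 1 * io2 1 (-1) 0 1 := by
      simp [io1, io2, io3, toff]
    rw [this]
    have m3 : ∀ n, io3 1 n 0 1 ∈ Sp4Z := fun n => io3_mem (by ring)
    have m2 : ∀ n, io2 1 n 0 1 ∈ Sp4Z := fun n => io2_mem (by ring)
    have m1 : ∀ n, io1 1 n 0 1 ∈ Sp4Z := fun n => io1_mem (by ring)
    exact hmul _ (sp_mul (sp_mul (sp_mul (m3 _) (m2 _)) (m3 _)) (m1 _)) _ (m2 _)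
      (hmul _ (sp_mul (sp_mul (m3 _) (m2 _)) (m3 _)) _ (m1 _)
      (hmul _ (sp_mul (m3 _) (m2 _)) _ (m3 _) (hmul _ (m3 _) _ (m2 _) (h3 _ _ _ _ (by ring))
      (h2 _ _ _ _ (by ring))) (h3 _ _ _ _ (by ring))) (h1 _ _ _ _ (by ring)))
      (h2 _ _ _ _ (by ring))
  -- left reduction
  have r1 : ∀ γ ∈ Sp4Z, ∀ a b c d, a*d-b*c=1 → P (io1 a b c d * γ) → P γ := by
    intro γ hγ a b c d h hp
    have : γ = io1 d (-b) (-c) a * (io1 a b c d * γ) := by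
      rw [← Matrix.mul_assoc, io1_mul]
      rw [show d * a + -b * c = 1 by linarith, show d * b + -b * d = 0 by ring,
        show -c * a + a * c = 0 by ring, show -c * b + a * d = 1 by linarith, io1_one, one_mul]
    rw [this]
    exact hmul _ (io1_mem (by linarith)) _ (sp_mul (io1_mem h) hγ) (h1 _ _ _ _ (by linarith)) hp
  have r2 : ∀ γ ∈ Sp4Z, ∀ a b c d, a*d-b*c=1 → P (io2 a b c d * γ) → P γ := by
    intro γ hγ a b c d h hp
    have : γ = io2 d (-b) (-c) a * (io2 a b c d * γ) := by
      rw [← Matrix.mul_assoc, io2_mul]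
      rw [show d * a + -b * c = 1 by linarith, show d * b + -b * d = 0 by ring,
        show -c * a + a * c = 0 by ring, show -c * b + a * d = 1 by linarith, io2_one, one_mul]
    rw [this]
    exact hmul _ (io2_mem (by linarith)) _ (sp_mul (io2_mem h) hγ) (h2 _ _ _ _ (by linarith)) hp
  have r3 : ∀ γ ∈ Sp4Z, ∀ a b c d, a*d-b*c=1 → P (io3 a b c d * γ) → P γ := by
    intro γ hγ a b c d h hp
    have : γ = io3 d (-b) (-c) a * (io3 a b c d * γ) := by
      rw [← Matrix.mul_assoc, io3_mul]
      rw [show d * a + -b * c = 1 by linarith, show d * b + -b * d = 0 by ring,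
        show -c * a + a * c = 0 by ring, show -c * b + a * d = 1 by linarith, io3_one, one_mul]
    rw [this]
    exact hmul _ (io3_mem (by linarith)) _ (sp_mul (io3_mem h) hγ) (h3 _ _ _ _ (by linarith)) hp
  -- final stage: first column e0, and middle block identity
  have s1 : ∀ γ ∈ Sp4Z, γ 0 0 = 1 → γ 1 0 = 0 → γ 2 0 = 0 → γ 3 0 = 0 → P γ := by
    intro γ hγ a0 a1 a2 a3
    have E := hγ
    rw [m4eta γ, sp_iff, a0, a1, a2, a3] at E
    obtain ⟨e01, e02, e03, e12, e13, e23⟩ := E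
    have e01 : γ 2 1 = 0 := by linarith
    have e02 : γ 2 2 = 1 := by linarith
    have e03 : γ 2 3 = 0 := by linarith
    rw [e01, e02] at e12
    rw [e02, e03] at e23
    rw [e01, e03] at e13
    have hd : γ 1 1 * γ 3 3 - γ 1 3 * γ 3 1 = 1 := by linarith
    apply r2 γ hγ (γ 3 3) (-γ 1 3) (-γ 3 1) (γ 1 1) (by linarith)
    have key : io2 (γ 3 3) (-γ 1 3) (-γ 3 1) (γ 1 1) * γ =
      toff (γ 0 3) * io1 1 (γ 0 2 + γ 0 1 * γ 0 3) 0 1 * io3 1 (γ 0 1) 0 1 := by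
      conv_lhs => rw [m4eta γ, a0, a1, a2, a3, e01, e02, e03]
      simp [io1, io2, io3, toff]
      clear hmul hT hJ hW hU h1 h2 hw h3 hoff r1 r2 r3
      refine ⟨?_, ⟨?_, ?_, ?_⟩, ?_, ?_, ?_⟩ <;> linarith
    rw [key]
    exact hmul _ (sp_mul (toff_mem _) (io1_mem (by ring))) _ (io3_mem (by ring))
      (hmul _ (toff_mem _) _ (io1_mem (by ring)) (hoff _) (h1 _ _ _ _ (by ring))) (h3 _ _ _ _ (by ring))
  have s2 : ∀ γ ∈ Sp4Z, γ 1 0 = 0 → γ 2 0 = 0 → γ 3 0 = 0 → P γ := by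
    intro γ hγ a1 a2 a3
    have E := hγ
    rw [m4eta γ, sp_iff, a1, a2, a3] at E
    have e02 : γ 0 0 * γ 2 2 = 1 := by linarith [E.2.1]
    rcases Int.eq_one_or_neg_one_of_mul_eq_one e02 with h | h
    · exact s1 γ hγ h a1 a2 a3
    · apply r1 γ hγ (-1) 0 0 (-1) (by norm_num)
      apply s1 _ (sp_mul (io1_mem (by norm_num)) hγ) <;>
      simp [io1, Matrix.mul_apply, Fin.sum_univ_four, *]
  have s3 : ∀ γ ∈ Sp4Z, γ 2 0 = 0 → γ 3 0 = 0 → P γ := by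
    intro γ hγ a2 a3
    obtain ⟨p, q, r, s, hd, g, h1, h2⟩ := sl2_gcd (γ 0 0) (γ 1 0)
    apply r3 γ hγ p q r s hd
    apply s2 _ (sp_mul (io3_mem hd) hγ) <;>
      simp [io3, Matrix.mul_apply, Fin.sum_univ_four, *]
  have s4 : ∀ γ ∈ Sp4Z, γ 2 0 = 0 → P γ := by
    intro γ hγ a2
    obtain ⟨p, q, r, s, hd, g, h1, h2⟩ := sl2_gcd (γ 1 0) (γ 3 0)
    apply r2 γ hγ p q r s hd
    apply s3 _ (sp_mul (io2_mem hd) hγ) <;>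
      simp [io2, Matrix.mul_apply, Fin.sum_univ_four, *]
  intro γ hγ
  obtain ⟨p, q, r, s, hd, g, h1, h2⟩ := sl2_gcd (γ 0 0) (γ 2 0)
  apply r1 γ hγ p q r s hd
  apply s4 _ (sp_mul (io1_mem hd) hγ)
  simp [io1, Matrix.mul_apply, Fin.sum_univ_four, *]

lemma one_sp : (1 : M4) ∈ Sp4Z := by rw [← io1_one]; exact io1_mem (by norm_num)

/-- values of the character at generators -/
lemma eps_vals {ε : M4 → ℂ} (hε : IsEps ε) :
    ε (io1 1 1 0 1) = -1 ∧ ε (io1 0 (-1) 1 0) = -1 ∧ ε sw = -1 ∧ ε (io3 1 1 0 1) = -1 ∧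
    ε (io2 1 1 0 1) = -1 ∧ ε (toff 1) = -1 ∧ ε (io1 (-1) 0 0 (-1)) = 1 ∧ ε 1 = 1 := by
  obtain ⟨h1, h2, γ, hγ, hne⟩ := hε
  have sq : ∀ γ ∈ Sp4Z, ε γ * ε γ = 1 := by
    intro γ hγ; rcases h1 γ hγ with h | h <;> rw [h] <;> norm_num
  have mT : io1 1 1 0 1 ∈ Sp4Z := io1_mem (by norm_num)
  have mJ : io1 0 (-1) 1 0 ∈ Sp4Z := io1_mem (by norm_num)
  have mT2 : io2 1 1 0 1 ∈ Sp4Z := io2_mem (by norm_num)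
  have mU : io3 1 1 0 1 ∈ Sp4Z := io3_mem (by norm_num)
  have mw : io3 0 (-1) 1 0 ∈ Sp4Z := io3_mem (by norm_num)
  have mD : io1 (-1) 0 0 (-1) ∈ Sp4Z := io1_mem (by norm_num)
  have eD : ε (io1 (-1) 0 0 (-1)) = 1 := by
    rw [show io1 (-1) 0 0 (-1) = io1 0 (-1) 1 0 * io1 0 (-1) 1 0 by
      simp only [io1]; decide, h2 _ mJ _ mJ, sq _ mJ]
  have e1 : ε 1 = 1 := by
    have := sq 1 one_sp
    rw [← h2 _ one_sp _ one_sp, one_mul] at this; exact this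
  have eT2 : ε (io2 1 1 0 1) = ε (io1 1 1 0 1) := by
    rw [← sw_io1_sw, h2 _ (sp_mul sw_mem mT) _ sw_mem, h2 _ sw_mem _ mT]
    linear_combination ε (io1 1 1 0 1) * sq _ sw_mem
  have eJ : ε (io1 0 (-1) 1 0) = ε (io1 1 1 0 1) := by
    have h : io1 0 (-1) 1 0 * io1 1 1 0 1 * io1 0 (-1) 1 0 * io1 1 1 0 1 * io1 0 (-1) 1 0 *
       io1 1 1 0 1 = io1 0 (-1) 1 0 * io1 0 (-1) 1 0 := by simp only [io1]; decide
    have k := congrArg ε h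
    rw [h2 _ (sp_mul (sp_mul (sp_mul (sp_mul mJ mT) mJ) mT) mJ) _ mT,
      h2 _ (sp_mul (sp_mul (sp_mul mJ mT) mJ) mT) _ mJ, h2 _ (sp_mul (sp_mul mJ mT) mJ) _ mT,
      h2 _ (sp_mul mJ mT) _ mJ, h2 _ mJ _ mT, h2 _ mJ _ mJ] at k
    rcases h1 _ mT with a | a <;> rcases h1 _ mJ with b | b <;> rw [a, b] at k ⊢ <;>
      norm_num at k
  have ew : ε (io3 0 (-1) 1 0) = ε (io3 1 1 0 1) := by
    have h : io3 0 (-1) 1 0 * io3 1 1 0 1 * io3 0 (-1) 1 0 * io3 1 1 0 1 * io3 0 (-1) 1 0 *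
       io3 1 1 0 1 = io3 0 (-1) 1 0 * io3 0 (-1) 1 0 := by simp only [io3]; decide
    have k := congrArg ε h
    rw [h2 _ (sp_mul (sp_mul (sp_mul (sp_mul mw mU) mw) mU) mw) _ mU,
      h2 _ (sp_mul (sp_mul (sp_mul mw mU) mw) mU) _ mw, h2 _ (sp_mul (sp_mul mw mU) mw) _ mU,
      h2 _ (sp_mul mw mU) _ mw, h2 _ mw _ mU, h2 _ mw _ mw] at k
    rcases h1 _ mU with a | a <;> rcases h1 _ mw with b | b <;> rw [a, b] at k ⊢ <;>
      norm_num at k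
  have esw : ε sw = ε (io3 1 1 0 1) := by
    rw [← ew, show io3 0 (-1) 1 0 = io1 (-1) 0 0 (-1) * sw by simp only [io1, io3, sw]; decide,
      h2 _ mD _ sw_mem, eD, one_mul]
  have eoff : ε (toff 1) = ε (io1 1 1 0 1) := by
    have h : io3 1 1 0 1 * io2 1 1 0 1 = toff 1 * io1 1 1 0 1 * io2 1 1 0 1 * io3 1 1 0 1 := by
      simp only [io1, io2, io3, toff]; decide
    have k := congrArg ε h
    rw [h2 _ mU _ mT2, h2 _ (sp_mul (sp_mul (toff_mem 1) mT) mT2) _ mU,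
      h2 _ (sp_mul (toff_mem 1) mT) _ mT2, h2 _ (toff_mem 1) _ mT, eT2] at k
    rcases h1 _ mT with a | a <;> rcases h1 _ mU with b | b <;> rcases h1 _ (toff_mem 1) with c | c <;>
      rw [a, b, c] at k <;> rw [a, c] <;> norm_num at k
  have eU : ε (io3 1 1 0 1) = ε (toff 1) := by
    have h : io2 0 (-1) 1 0 * toff 1 =  io3 1 1 0 1 * io2 0 (-1) 1 0 ∨
       toff 1 * io2 0 (-1) 1 0 =  io2 0 (-1) 1 0 * io3 1 1 0 1 ∨ 
       io2 0 (-1) 1 0 * io3 1 1 0 1 = toff 1 * io2 0 (-1) 1 0 ∨ 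
       io3 1 1 0 1 * io2 0 (-1) 1 0 = io2 0 (-1) 1 0 * toff 1 ∨ 
       io2 0 (-1) 1 0 * toff 1 *  io3 1 1 0 1 = io2 0 (-1) 1 0 ∨
       toff 1 * io2 0 (-1) 1 0 *  io3 1 1 0 1 = io2 0 (-1) 1 0 := by
      simp only [io2, io3, toff]; decide
    have mJ2 : io2 0 (-1) 1 0 ∈ Sp4Z := io2_mem (by norm_num)
    have sJ := sq _ mJ2
    have sU := sq _ mU
    have so := sq _ (toff_mem 1)
    rcases h with h | h | h | h | h | h <;> have k := congrArg ε h <;>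
    simp only [h2 _ mJ2 _ (toff_mem 1), h2 _ mU _ mJ2, h2 _ (toff_mem 1) _ mJ2, h2 _ mJ2 _ mU,
      h2 _ (sp_mul mJ2 (toff_mem 1)) _ mU, h2 _ (sp_mul (toff_mem 1) mJ2) _ mU] at k <;>
    rcases h1 _ mJ2 with a | a <;> rcases h1 _ mU with b | b <;> rcases h1 _ (toff_mem 1) with c | c <;>
      rw [a, b, c] at k <;> rw [b, c] <;> norm_num at k
  have et : ε (io1 1 1 0 1) = -1 := by
    rcases h1 _ mT with h | h
    · exfalso
      apply hne
      refine sp4_ind (fun γ => ε γ = 1) ?_ h (by rw [eJ, h]) (by rw [esw, eU, eoff, h])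
        (by rw [eU, eoff, h]) γ hγ
      intro γ hγ δ hδ a b
      rw [h2 γ hγ δ hδ, a, b, one_mul]
    · exact h
  refine ⟨et, ?_, ?_, ?_, ?_, ?_, eD, e1⟩
  · rw [eJ, et]
  · rw [esw, eU, eoff, et]
  · rw [eU, eoff, et]
  · rw [eT2, et]
  · rw [eoff, et]

def tm (a b c : ℂ) : Fin 2 → Fin 2 → ℂ := ![![a,b],![b,c]]

lemma mem_H2 (τ : Fin 2 → Fin 2 → ℂ) : τ ∈ H2 ↔ τ 0 1 = τ 1 0 ∧ 0 < (τ 0 0).im ∧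
    (τ 0 1).im ^ 2 < (τ 0 0).im * (τ 1 1).im := by
  have hs : (Matrix.of τ).IsSymm ↔ τ 0 1 = τ 1 0 := by
    constructor
    · intro h; have := congrFun (congrFun h 1) 0; simpa using this
    · intro h; ext i j; fin_cases i <;> fin_cases j <;> simp [h]
  change _ ∧ _ ↔ _
  rw [hs, and_congr_right_iff]
  intro h
  rw [posDef_iff_dotProduct_mulVec]
  constructor
  · rintro ⟨-, h2⟩
    have e1 := @h2 ![1, 0] (by intro h; simpa using congrFun h 0)
    simp [dotProduct, mulVec, Fin.sum_univ_two] at e1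
    have e2 := @h2 ![-(τ 0 1).im, (τ 0 0).im] (by intro h; have := congrFun h 1; simp at this; linarith)
    simp [dotProduct, mulVec, Fin.sum_univ_two, ← h] at e2
    refine ⟨e1, ?_⟩
    have : 0 < (τ 0 0).im * ((τ 0 0).im * (τ 1 1).im - (τ 0 1).im ^ 2) := by linarith
    have := (pos_iff_pos_of_mul_pos this).1 e1
    linarith
  · rintro ⟨h1, h2⟩
    refine ⟨?_, ?_⟩
    · ext i j; fin_cases i <;> fin_cases j <;> simp [h]
    · intro x hx
      simp only [dotProduct, mulVec, Fin.sum_univ_two, star_trivial, Matrix.of_apply]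
      rw [← h]
      have hp : 0 < (τ 0 0).im * (x 0 * ((τ 0 0).im * x 0 + (τ 0 1).im * x 1) +
        x 1 * ((τ 0 1).im * x 0 + (τ 1 1).im * x 1)) := by
        have : (τ 0 0).im * (x 0 * ((τ 0 0).im * x 0 + (τ 0 1).im * x 1) +
          x 1 * ((τ 0 1).im * x 0 + (τ 1 1).im * x 1)) = ((τ 0 0).im * x 0 + (τ 0 1).im * x 1)^2 +
          ((τ 0 0).im * (τ 1 1).im - (τ 0 1).im ^ 2) * x 1 ^ 2 := by ring
        rw [this]
        by_cases hx1 : x 1 = 0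
        · have : x 0 ≠ 0 := by
            intro h0; apply hx; ext i; fin_cases i <;> simp [h0, hx1]
          rw [hx1]; simp; positivity
        · have : 0 < ((τ 0 0).im * (τ 1 1).im - (τ 0 1).im ^ 2) * x 1 ^ 2 := by
            apply mul_pos (by linarith); positivity
          linarith [sq_nonneg ((τ 0 0).im * x 0 + (τ 0 1).im * x 1)]
      exact (pos_iff_pos_of_mul_pos hp).1 h1

lemma tm_mem {a b c : ℂ} : tm a b c ∈ H2 ↔ 0 < a.im ∧ b.im ^ 2 < a.im * c.im := by
  rw [mem_H2]; simp [tm]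

lemma eq_tm {τ : Fin 2 → Fin 2 → ℂ} (h : τ ∈ H2) : τ = tm (τ 0 0) (τ 0 1) (τ 1 1) := by
  rw [mem_H2] at h
  ext i j; fin_cases i <;> fin_cases j <;> simp [tm, h.1]

lemma tm_mem_c {a b c : ℂ} (h : tm a b c ∈ H2) : 0 < c.im := by
  rw [tm_mem] at h
  have : 0 < a.im * c.im := lt_of_le_of_lt (sq_nonneg _) h.2
  exact (pos_iff_pos_of_mul_pos this).1 h.1

lemma tm_J {a b c : ℂ} (h : tm a b c ∈ H2) : tm (-1/a) (b/a) (c-b^2/a) ∈ H2 := by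
  rw [tm_mem] at *
  obtain ⟨h1, h2⟩ := h
  have ha : a ≠ 0 := by rintro rfl; simp at h1
  have hn : 0 < normSq a := normSq_pos.2 ha
  have hn2 : a.re * a.re + a.im * a.im = normSq a := (normSq_apply a).symm
  constructor
  · simp [neg_div]; positivity
  · have e1 : (-1/a).im = a.im / normSq a := by simp [neg_div]
    have e2 : (b/a).im = (b.im * a.re - b.re * a.im) / normSq a := by simp [div_im]; ring
    have e3 : (c-b^2/a).im = c.im - ((2*b.re*b.im) * a.re - (b.re^2-b.im^2)* a.im) / normSq a := by
      simp [div_im, pow_two]; ring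
    rw [e1, e2, e3]
    rw [div_pow, div_lt_iff₀ (by positivity)]
    have : a.im / normSq a * (c.im - ((2*b.re*b.im) * a.re - (b.re^2-b.im^2)* a.im) / normSq a) * normSq a ^ 2
      = a.im * (c.im * normSq a - ((2*b.re*b.im) * a.re - (b.re^2-b.im^2)* a.im)) := by
      field_simp
    rw [this, ← hn2]
    have h3 : 0 < (a.im * c.im - b.im ^ 2) * (a.re * a.re + a.im * a.im) := by
      apply mul_pos (by linarith); rw [hn2]; exact hn
    nlinarith [h3]

/-- homogeneous polynomial attached to a vector -/
def pv {j : ℕ} (v : Fin (j+1) → ℂ) (x y : ℂ) : ℂ := ∑ l : Fin (j+1), v l * (x ^ (j - (l:ℕ)) * y ^ (l:ℕ))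

lemma pv_inj {j : ℕ} {v w : Fin (j+1) → ℂ} (h : ∀ y, pv v 1 y = pv w 1 y) : v = w := by
  let P (v : Fin (j+1) → ℂ) : Polynomial ℂ := ∑ l : Fin (j+1), Polynomial.C (v l) * Polynomial.X ^ (l:ℕ)
  have hP : ∀ v y, (P v).eval y = pv v 1 y := by
    intro v y; simp [P, pv, Polynomial.eval_finset_sum]
  have hc : ∀ v (i : Fin (j+1)), (P v).coeff i = v i := by
    intro v i
    simp only [P, Polynomial.finset_sum_coeff, Polynomial.coeff_C_mul, Polynomial.coeff_X_pow]
    simp [Fin.val_inj]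
  have : P v = P w := Polynomial.funext fun y => by rw [hP, hP, h]
  ext i; rw [← hc v i, ← hc w i, this]

lemma pv_symAct {j : ℕ} (m : Matrix (Fin 2) (Fin 2) ℂ) (v : Fin (j+1) → ℂ) (x y : ℂ) :
    pv (symAct j m v) x y = pv v (m 0 0 * x + m 1 0 * y) (m 0 1 * x + m 1 1 * y) := by
  have key : ∀ x y : ℂ, x ≠ 0 →
      pv (symAct j m v) x y = pv v (m 0 0 * x + m 1 0 * y) (m 0 1 * x + m 1 1 * y) := by
    intro x y hx
    have hl : ∀ l : Fin (j+1), ∑ i : Fin (j+1), symCoeff j m l i * (x ^ (j - (i:ℕ)) * y ^ (i:ℕ)) =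
        (m 0 0 * x + m 1 0 * y) ^ (j-(l:ℕ)) * (m 0 1 * x + m 1 1 * y) ^ (l:ℕ) := by
      intro l
      set Q : Polynomial ℂ := (Polynomial.C (m 0 0) + Polynomial.C (m 1 0) * Polynomial.X) ^ (j - (l : ℕ)) *
        (Polynomial.C (m 0 1) + Polynomial.C (m 1 1) * Polynomial.X) ^ (l : ℕ) with hQ
      have hlin : ∀ a b : ℂ, (Polynomial.C a + Polynomial.C b * Polynomial.X).natDegree ≤ 1 := by
        intro a b; rw [add_comm]; exact Polynomial.natDegree_linear_le
      have hdeg : Q.natDegree < j + 1 := by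
        have h1 := Polynomial.natDegree_pow_le_of_le (j-(l:ℕ)) (hlin (m 0 0) (m 1 0))
        have h2 := Polynomial.natDegree_pow_le_of_le (l:ℕ) (hlin (m 0 1) (m 1 1))
        have := Polynomial.natDegree_mul_le_of_le h1 h2
        have hl := l.isLt
        rw [← hQ] at this
        omega
      have he := Polynomial.eval_eq_sum_range' hdeg (y/x)
      have e1 : ∑ i : Fin (j+1), symCoeff j m l i * (x ^ (j - (i:ℕ)) * y ^ (i:ℕ)) = x ^ j * Q.eval (y/x) := by
        rw [he, Finset.mul_sum, Finset.sum_range]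
        apply Finset.sum_congr rfl
        intro i _
        have hi : (i:ℕ) ≤ j := by have := i.isLt; omega
        have : x ^ j = x ^ (j - (i:ℕ)) * x ^ (i:ℕ) := by rw [← pow_add]; congr 1; omega
        rw [this, div_pow]
        change Q.coeff i * _ = _
        field_simp
      rw [e1, hQ]
      have hll : x ^ j = x ^ (j - (l:ℕ)) * x ^ (l:ℕ) := by
        rw [← pow_add]; congr 1; have := l.isLt; omega
      simp only [Polynomial.eval_mul, Polynomial.eval_pow, Polynomial.eval_add, Polynomial.eval_C, Polynomial.eval_X]
      rw [hll, show m 0 0 * x + m 1 0 * y = x * (m 0 0 + m 1 0 * (y/x)) by field_simp,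
        show m 0 1 * x + m 1 1 * y = x * (m 0 1 + m 1 1 * (y/x)) by field_simp, mul_pow, mul_pow]
      ring
    simp only [pv, symAct, Finset.sum_mul]
    rw [Finset.sum_comm]
    apply Finset.sum_congr rfl
    intro l _
    rw [← hl l, Finset.mul_sum]
    apply Finset.sum_congr rfl
    intro i _
    ring
  have h1 : Continuous fun x => pv (symAct j m v) x y := by unfold pv; fun_prop
  have h2 : Continuous fun x => pv v (m 0 0 * x + m 1 0 * y) (m 0 1 * x + m 1 1 * y) := by
    unfold pv; fun_prop
  exact congrFun (Continuous.ext_on (dense_compl_singleton (0:ℂ)) h1 h2 fun x hx => key x y hx) x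

lemma pv_smul {j : ℕ} (c : ℂ) (v : Fin (j+1) → ℂ) (x y : ℂ) : pv (c • v) x y = c * pv v x y := by
  simp [pv, Finset.mul_sum, mul_assoc]

lemma pv_wt {j : ℕ} (k : ℤ) (m : Matrix (Fin 2) (Fin 2) ℂ) (v : Fin (j+1) → ℂ) (x y : ℂ) :
    pv (wt j k m v) x y = m.det ^ k * pv v (m 0 0 * x + m 1 0 * y) (m 0 1 * x + m 1 1 * y) := by
  rw [wt, pv_smul, pv_symAct]

lemma symAct_mul {j : ℕ} (m n : Matrix (Fin 2) (Fin 2) ℂ) (v : Fin (j+1) → ℂ) :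
    symAct j (m * n) v = symAct j m (symAct j n v) := by
  apply pv_inj; intro y
  simp only [pv_symAct, Matrix.mul_apply, Fin.sum_univ_two]
  congr 1 <;> ring

lemma symAct_one {j : ℕ} (v : Fin (j+1) → ℂ) : symAct j 1 v = v := by
  apply pv_inj; intro y
  simp [pv_symAct]

lemma wt_mul {j : ℕ} (k : ℤ) (m n : Matrix (Fin 2) (Fin 2) ℂ) (v : Fin (j+1) → ℂ) :
    wt j k (m * n) v = wt j k m (wt j k n v) := by
  simp only [wt, symAct_mul, symAct_smul, det_mul, mul_zpow, smul_smul]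

lemma blk_mul (γ δ : M4) (r s : Fin 2) :
    blk (γ * δ) r s = blk γ r 0 * blk δ 0 s + blk γ r 1 * blk δ 1 s := by
  ext i j
  simp only [blk, Matrix.of_apply, Matrix.add_apply, Matrix.mul_apply, Fin.sum_univ_two, Fin.sum_univ_four]
  push_cast
  simp only [Fin.val_zero, Fin.val_one, Nat.mul_zero, Nat.mul_one, Nat.add_zero, Nat.zero_add]
  rw [← add_assoc]; rfl

lemma of_moeb (γ : M4) (τ : Fin 2 → Fin 2 → ℂ) :
    Matrix.of (moeb γ τ) = (blk γ 0 0 * Matrix.of τ + blk γ 0 1) * (den γ τ)⁻¹ := rfl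

lemma moeb_den_mul (γ δ : M4) (τ : Fin 2 → Fin 2 → ℂ) (h : (den δ τ).det ≠ 0)  :
    den (γ * δ) τ = den γ (moeb δ τ) * den δ τ := by
  have hu : IsUnit (den δ τ).det := isUnit_iff_ne_zero.2 h
  have h3 : Matrix.of (moeb δ τ) * den δ τ = blk δ 0 0 * Matrix.of τ + blk δ 0 1 := by
    rw [of_moeb, Matrix.mul_assoc, Matrix.nonsing_inv_mul _ hu, Matrix.mul_one]
  rw [den, den, add_mul, Matrix.mul_assoc, h3, den, blk_mul, blk_mul]
  noncomm_ring

lemma moeb_mul (γ δ : M4) (τ : Fin 2 → Fin 2 → ℂ) (h : (den δ τ).det ≠ 0) :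
    moeb (γ * δ) τ = moeb γ (moeb δ τ) := by
  have hu : IsUnit (den δ τ).det := isUnit_iff_ne_zero.2 h
  have h3 : Matrix.of (moeb δ τ) * den δ τ = blk δ 0 0 * Matrix.of τ + blk δ 0 1 := by
    rw [of_moeb, Matrix.mul_assoc, Matrix.nonsing_inv_mul _ hu, Matrix.mul_one]
  have h2 := moeb_den_mul γ δ τ h
  apply (Matrix.of).injective
  rw [of_moeb, of_moeb, h2, Matrix.mul_inv_rev, ← Matrix.mul_assoc]
  congr 1
  have : blk (γ * δ) 0 0 * Matrix.of τ + blk (γ * δ) 0 1 =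
    (blk γ 0 0 * Matrix.of (moeb δ τ) + blk γ 0 1) * den δ τ := by
    rw [add_mul, Matrix.mul_assoc, h3, den, blk_mul, blk_mul]
    noncomm_ring
  rw [this, Matrix.mul_assoc, Matrix.mul_nonsing_inv _ hu, Matrix.mul_one]

lemma blk_exp (a00 a01 a02 a03 a10 a11 a12 a13 a20 a21 a22 a23 a30 a31 a32 a33 : ℤ) :
    let γ : M4 := !![a00,a01,a02,a03;a10,a11,a12,a13;a20,a21,a22,a23;a30,a31,a32,a33]
    blk γ 0 0 = !![(a00:ℂ),a01;a10,a11] ∧ blk γ 0 1 = !![(a02:ℂ),a03;a12,a13] ∧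
    blk γ 1 0 = !![(a20:ℂ),a21;a30,a31] ∧ blk γ 1 1 = !![(a22:ℂ),a23;a32,a33] := by
  refine ⟨?_, ?_, ?_, ?_⟩ <;> (ext i j; fin_cases i <;> fin_cases j <;> rfl)

lemma of_tm (a b c : ℂ) : Matrix.of (tm a b c) = !![a,b;b,c] := rfl

lemma den_exp (a00 a01 a02 a03 a10 a11 a12 a13 a20 a21 a22 a23 a30 a31 a32 a33 : ℤ) (a b c : ℂ) :
    den !![a00,a01,a02,a03;a10,a11,a12,a13;a20,a21,a22,a23;a30,a31,a32,a33] (tm a b c) =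
    !![a20*a+a21*b+a22, a20*b+a21*c+a23; a30*a+a31*b+a32, a30*b+a31*c+a33] := by
  obtain ⟨-, -, h3, h4⟩ := blk_exp a00 a01 a02 a03 a10 a11 a12 a13 a20 a21 a22 a23 a30 a31 a32 a33
  rw [den, h3, h4, of_tm]; simp

lemma moeb_exp (a00 a01 a02 a03 a10 a11 a12 a13 a20 a21 a22 a23 a30 a31 a32 a33 : ℤ) (a b c x y z : ℂ)
    (hd : (den !![a00,a01,a02,a03;a10,a11,a12,a13;a20,a21,a22,a23;a30,a31,a32,a33] (tm a b c)).det ≠ 0)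
    (h : !![x,y;y,z] * !![a20*a+a21*b+a22, a20*b+a21*c+a23; a30*a+a31*b+a32, a30*b+a31*c+a33] = 
     !![a00*a+a01*b+a02, a00*b+a01*c+a03; a10*a+a11*b+a12, a10*b+a11*c+a13]) :
    moeb !![a00,a01,a02,a03;a10,a11,a12,a13;a20,a21,a22,a23;a30,a31,a32,a33] (tm a b c) = tm x y z := by
  obtain ⟨h1, h2, h3, h4⟩ := blk_exp a00 a01 a02 a03 a10 a11 a12 a13 a20 a21 a22 a23 a30 a31 a32 a33
  apply (Matrix.of).injective
  have hu := isUnit_iff_ne_zero.2 hd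
  rw [of_moeb, of_tm, of_tm, h1, h2]
  rw [show !![(a00:ℂ), a01; a10, a11] * !![a, b; b, c] + !![(a02:ℂ), a03; a12, a13] = 
    !![a00*a+a01*b+a02, a00*b+a01*c+a03; a10*a+a11*b+a12, a10*b+a11*c+a13] by simp, ← h,
    ← den_exp a00 a01 a02 a03 a10 a11 a12 a13 a20 a21 a22 a23 a30 a31 a32 a33, Matrix.mul_assoc,
    Matrix.mul_nonsing_inv _ hu, Matrix.mul_one]

/-- explicit generator laws -/
structure Laws (F : (Fin 2 → Fin 2 → ℂ) → (Fin 19 → ℂ)) : Prop where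
  t1 : ∀ a b c, tm a b c ∈ H2 → F (tm (a+1) b c) = - F (tm a b c)
  s : ∀ a b c, tm a b c ∈ H2 → ∀ x y, pv (j := 18) (F (tm c b a)) x y = - pv (j := 18) (F (tm a b c)) y x
  u : ∀ a b c, tm a b c ∈ H2 → ∀ x y, pv (j := 18) (F (tm (a+2*b+c) (b+c) c)) x y =
    - pv (j := 18) (F (tm a b c)) (x - y) y
  jj : ∀ a b c, tm a b c ∈ H2 → ∀ x y, pv (j := 18) (F (tm (-1/a) (b/a) (c-b^2/a))) x y =
    - a ^ 2 * pv (j := 18) (F (tm a b c)) (a * x) (b * x + y)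

lemma dm_T (a b c : ℂ) : den (io1 1 1 0 1) (tm a b c) = 1 ∧ moeb (io1 1 1 0 1) (tm a b c) = tm (a+1) b c := by
  have h : den (io1 1 1 0 1) (tm a b c) = 1 := by
    rw [io1, den_exp]; simp [Matrix.one_fin_two]
  refine ⟨h, ?_⟩
  rw [io1, moeb_exp _ _ _ _ _ _ _ _ _ _ _ _ _ _ _ _ a b c (a+1) b c]
  · rw [← io1, h]; simp
  · simp
lemma dm_s (a b c : ℂ) : den sw (tm a b c) = !![0,1;1,0] ∧ moeb sw (tm a b c) = tm c b a := by
  have h : den sw (tm a b c) = !![0,1;1,0] := by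
    rw [sw, den_exp]; simp
  refine ⟨h, ?_⟩
  rw [sw, moeb_exp _ _ _ _ _ _ _ _ _ _ _ _ _ _ _ _ a b c c b a]
  · rw [← sw, h]; simp
  · simp
lemma dm_u (a b c : ℂ) : den (io3 1 1 0 1) (tm a b c) = !![1,0;-1,1] ∧
    moeb (io3 1 1 0 1) (tm a b c) = tm (a+2*b+c) (b+c) c := by
  have h : den (io3 1 1 0 1) (tm a b c) = !![1,0;-1,1] := by
    rw [io3, den_exp]; simp
  refine ⟨h, ?_⟩
  rw [io3, moeb_exp _ _ _ _ _ _ _ _ _ _ _ _ _ _ _ _ a b c (a+2*b+c) (b+c) c]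
  · rw [← io3, h]; simp
  · simp; ring
lemma dm_J (a b c : ℂ) (ha : a ≠ 0) : den (io1 0 (-1) 1 0) (tm a b c) = !![a,b;0,1] ∧
    moeb (io1 0 (-1) 1 0) (tm a b c) = tm (-1/a) (b/a) (c-b^2/a) := by
  have h : den (io1 0 (-1) 1 0) (tm a b c) = !![a,b;0,1] := by
    rw [io1, den_exp]; simp
  refine ⟨h, ?_⟩
  rw [io1, moeb_exp _ _ _ _ _ _ _ _ _ _ _ _ _ _ _ _ a b c (-1/a) (b/a) (c-b^2/a)]
  · rw [← io1, h]; simpa using ha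
  · simp; refine ⟨⟨?_, ?_⟩, ?_, ?_⟩ <;> field_simp <;> ring

lemma laws_of {ε : M4 → ℂ} (hε : IsEps ε) {F} (hF : IsSiegelCuspForm 18 2 Sp4Z ε F) : Laws F := by
  obtain ⟨e1, e2, e3, e4, -⟩ := eps_vals hε
  have L := hF.2.1
  constructor
  · intro a b c h
    have := L (io1 1 1 0 1) (io1_mem (by norm_num)) _ h
    rw [(dm_T a b c).1, (dm_T a b c).2, e1] at this
    rw [this]; simp [wt, symAct_one]
  · intro a b c h x y
    have := L _ sw_mem _ h
    rw [(dm_s a b c).1, (dm_s a b c).2, e3] at this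
    rw [this, pv_smul, pv_wt]; simp
  · intro a b c h x y
    have := L (io3 1 1 0 1) (io3_mem (by norm_num)) _ h
    rw [(dm_u a b c).1, (dm_u a b c).2, e4] at this
    rw [this, pv_smul, pv_wt]; simp [sub_eq_add_neg]
  · intro a b c h x y
    have ha : a ≠ 0 := by rintro rfl; simp [tm_mem] at h
    have := L (io1 0 (-1) 1 0) (io1_mem (by norm_num)) _ h
    rw [(dm_J a b c ha).1, (dm_J a b c ha).2, e2] at this
    rw [this, pv_smul, pv_wt]; simp

lemma of_laws {ε : M4 → ℂ} (hε : IsEps ε) {F} (hF : Laws F) : ∀ γ ∈ Sp4Z, ∀ τ ∈ H2,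
    moeb γ τ ∈ H2 ∧ (den γ τ).det ≠ 0 ∧ F (moeb γ τ) = ε γ • wt 18 2 (den γ τ) (F τ) := by
  obtain ⟨e1, e2, e3, e4, -⟩ := eps_vals hε
  apply sp4_ind
  · intro γ hγ δ hδ h1 h2 τ hτ
    obtain ⟨a1, a2, a3⟩ := h2 τ hτ
    obtain ⟨b1, b2, b3⟩ := h1 _ a1
    rw [moeb_mul _ _ _ a2, moeb_den_mul _ _ _ a2, det_mul]
    refine ⟨b1, mul_ne_zero b2 a2, ?_⟩
    rw [b3, a3, wt_mul, wt_smul, hε.2.1 γ hγ δ hδ, smul_smul]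
  all_goals intro τ hτ; rw [eq_tm hτ] at *; generalize τ 0 0 = a at *; generalize τ 0 1 = b at *
  all_goals generalize τ 1 1 = c at *
  · rw [(dm_T a b c).1, (dm_T a b c).2, e1]
    refine ⟨?_, by simp, ?_⟩
    · rw [tm_mem] at *; simpa using hτ
    · rw [hF.t1 a b c hτ]; simp [wt, symAct_one]
  · have ha : a ≠ 0 := by rintro rfl; simp [tm_mem] at hτ
    rw [(dm_J a b c ha).1, (dm_J a b c ha).2, e2]
    refine ⟨tm_J hτ, by simpa using ha, ?_⟩
    apply pv_inj; intro y
    rw [hF.jj a b c hτ, pv_smul, pv_wt]; simp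
  · rw [(dm_s a b c).1, (dm_s a b c).2, e3]
    refine ⟨?_, by simp, ?_⟩
    · rw [tm_mem]; exact ⟨tm_mem_c hτ, by rw [tm_mem] at hτ; linarith [hτ.2]⟩
    · apply pv_inj; intro y
      rw [hF.s a b c hτ, pv_smul, pv_wt]; simp
  · rw [(dm_u a b c).1, (dm_u a b c).2, e4]
    refine ⟨?_, by simp, ?_⟩
    · have hc := tm_mem_c hτ
      rw [tm_mem] at *
      simp only [add_im, mul_im]; simp
      constructor
      · have : 0 < a.im * (a.im+2*b.im+c.im) := by nlinarith [hτ.2, sq_nonneg (a.im+b.im)]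
        exact (pos_iff_pos_of_mul_pos this).1 hτ.1
      · nlinarith [hτ.2]
    · apply pv_inj; intro y
      rw [hF.u a b c hτ, pv_smul, pv_wt]; simp [sub_eq_add_neg]

/-- a function satisfying the generator laws, holomorphic, with decay, is a cusp form -/
lemma cusp_of_laws {ε : M4 → ℂ} (hε : IsEps ε) {F} (hF : Laws F) (hd : DifferentiableOn ℂ F H2)
    (h0 : ∀ τ, τ ∉ H2 → F τ = 0)
    (hc : ∀ τ₁ : ℂ, 0 < τ₁.im → Tendsto (fun t : ℝ => F (tm τ₁ 0 (t * Complex.I))) atTop (𝓝 0)) :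
    IsSiegelCuspForm 18 2 Sp4Z ε F := by
  have L := of_laws hε hF
  refine ⟨hd, fun γ hγ τ hτ => (L γ hγ τ hτ).2.2, ?_, h0⟩
  intro γ hγ τ₁ hτ₁
  have h1 : ∀ t : ℝ, 0 < t → slashS 18 2 γ F (diagH τ₁ (t * I)) = ε γ • F (tm τ₁ 0 (t * I)) := by
    intro t ht
    have e : diagH τ₁ (t * I) = tm τ₁ 0 (t * I) := by
      ext i j; fin_cases i <;> fin_cases j <;> simp [diagH, tm]
    have hm : tm τ₁ 0 (t * I) ∈ H2 := by
      rw [tm_mem]; simp; exact ⟨hτ₁, by positivity⟩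
    rw [e, slashS]
    obtain ⟨a1, a2, a3⟩ := L γ hγ _ hm
    rw [a3, wt, symAct_smul, symAct_smul, ← symAct_mul, Matrix.nonsing_inv_mul _ (isUnit_iff_ne_zero.2 a2),
      symAct_one, smul_smul, smul_smul]
    congr 1
    rw [mul_right_comm, ← zpow_add₀ a2]; simp
  have := (hc τ₁ hτ₁).const_smul (ε γ)
  rw [smul_zero] at this
  refine this.congr' ?_
  filter_upwards [eventually_gt_atTop 0] with t ht using (h1 t ht).symm

structure Laws2 (F : (Fin 2 → Fin 2 → ℂ) → (Fin 19 → ℂ)) : Prop where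
  t2 : ∀ a b c, tm a b c ∈ H2 → F (tm a b (c+1)) = - F (tm a b c)
  off : ∀ a b c, tm a b c ∈ H2 → F (tm a (b+1) c) = - F (tm a b c)
  d : ∀ a b c, tm a b c ∈ H2 → ∀ x y, pv (j := 18) (F (tm a (-b) c)) x y =
    pv (j := 18) (F (tm a b c)) (-x) y

lemma laws2_of {ε : M4 → ℂ} (hε : IsEps ε) {F} (hF : IsSiegelCuspForm 18 2 Sp4Z ε F) : Laws2 F := by
  obtain ⟨-, -, -, -, e1, e2, e3, -⟩ := eps_vals hε
  have L := hF.2.1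
  constructor
  · intro a b c hh
    have h : den (io2 1 1 0 1) (tm a b c) = 1 := by
      rw [io2, den_exp]; simp [Matrix.one_fin_two]
    have h2 : moeb (io2 1 1 0 1) (tm a b c) = tm a b (c+1) := by
      rw [io2, moeb_exp _ _ _ _ _ _ _ _ _ _ _ _ _ _ _ _ a b c a b (c+1)]
      · rw [← io2, h]; simp
      · simp
    have := L (io2 1 1 0 1) (io2_mem (by norm_num)) _ hh
    rw [h, h2, e1] at this
    rw [this]; simp [wt, symAct_one]
  · intro a b c hh
    have h : den (toff 1) (tm a b c) = 1 := by
      rw [toff, den_exp]; simp [Matrix.one_fin_two]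
    have h2 : moeb (toff 1) (tm a b c) = tm a (b+1) c := by
      rw [toff, moeb_exp _ _ _ _ _ _ _ _ _ _ _ _ _ _ _ _ a b c a (b+1) c]
      · rw [← toff, h]; simp
      · simp
    have := L (toff 1) (toff_mem 1) _ hh
    rw [h, h2, e2] at this
    rw [this]; simp [wt, symAct_one]
  · intro a b c hh x y
    have h : den (io1 (-1) 0 0 (-1)) (tm a b c) = !![-1,0;0,1] := by
      rw [io1, den_exp]; simp
    have h2 : moeb (io1 (-1) 0 0 (-1)) (tm a b c) = tm a (-b) c := by
      rw [io1, moeb_exp _ _ _ _ _ _ _ _ _ _ _ _ _ _ _ _ a b c a (-b) c]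
      · rw [← io1, h]; simp
      · simp
    have := L (io1 (-1) 0 0 (-1)) (io1_mem (by norm_num)) _ hh
    rw [h, h2, e3] at this
    rw [this, pv_smul, pv_wt]; simp

def cub (a : Fin 3 → ℝ) : Set (Fin 3 → ℝ) := {x | ∀ i, x i ∈ Set.Ioc (a i) (a i + 1)}

/-- complex point of the tube -/
def zt (x y : Fin 3 → ℝ) : Fin 3 → ℂ := fun i => (x i : ℂ) + (y i : ℂ) * I

def tube (D : Set (Fin 3 → ℝ)) : Set (Fin 3 → ℂ) := {t | (fun i => (t i).im) ∈ D}

lemma zt_mem {D : Set (Fin 3 → ℝ)} {y : Fin 3 → ℝ} (x : Fin 3 → ℝ) : zt x y ∈ tube D ↔ y ∈ D := by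
  simp [tube, zt]

lemma zt_cont : Continuous (fun p : (Fin 3 → ℝ) × (Fin 3 → ℝ) => zt p.1 p.2) := by
  unfold zt; fun_prop

/-- lift of the function at height `y` to the torus -/
def lft (g : (Fin 3 → ℂ) → ℂ) (y : Fin 3 → ℝ) (x : UnitAddTorus (Fin 3)) : ℂ :=
  g (zt (fun i => (AddCircle.equivIoc 1 0 (x i)).1) y)

def Per (D : Set (Fin 3 → ℝ)) (g : (Fin 3 → ℂ) → ℂ) : Prop :=
  ∀ t ∈ tube D, ∀ i, g (t + Pi.single i 1) = g t

lemma per_int {D : Set (Fin 3 → ℝ)} {g : (Fin 3 → ℂ) → ℂ} (hg : Per D g) (y : Fin 3 → ℝ) (hy : y ∈ D)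
    (n : Fin 3 → ℤ) (x : Fin 3 → ℝ) : g (zt (fun i => x i + n i) y) = g (zt x y) := by
  have key : ∀ (i : Fin 3) (m : ℤ) (x : Fin 3 → ℝ),
      g (zt (x + Pi.single i (m:ℝ)) y) = g (zt x y) := by
    intro i m
    induction m using Int.induction_on with
    | zero => intro x; simp
    | succ k ih =>
      intro x
      rw [← ih x]
      refine (congrArg g ?_).trans (hg _ ((zt_mem _).2 hy) i)
      funext j
      by_cases h : j = i
      · subst h; simp [zt]; ring
      · simp [zt, Pi.single_eq_of_ne h]
    | pred k ih =>
      intro x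
      rw [← ih x]
      refine ((congrArg g ?_).trans (hg _ ((zt_mem _).2 hy) i)).symm
      funext j
      by_cases h : j = i
      · subst h; simp [zt]; ring
      · simp [zt, Pi.single_eq_of_ne h]
  refine (congrArg g ?_).trans ((key 2 (n 2) _).trans ((key 1 (n 1) _).trans (key 0 (n 0) x)))
  congr 1
  funext j
  fin_cases j <;> simp

lemma lft_coe {D : Set (Fin 3 → ℝ)} {g : (Fin 3 → ℂ) → ℂ} (hg : Per D g) (y : Fin 3 → ℝ) (hy : y ∈ D)
    (x : Fin 3 → ℝ) : lft g y (fun i => (x i : UnitAddCircle)) = g (zt x y) := by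
  unfold lft
  have h : ∀ i, ∃ n : ℤ, (AddCircle.equivIoc 1 0 (x i : UnitAddCircle)).1 = x i + n := by
    intro i
    refine ⟨-toIocDiv zero_lt_one 0 (x i), ?_⟩
    change toIocMod _ 0 (x i) = _
    rw [toIocMod]; simp; ring
  choose n hn using h
  rw [← per_int hg y hy n x]
  congr 2
  funext i; exact hn i

lemma K_cont {D : Set (Fin 3 → ℝ)} {g : (Fin 3 → ℂ) → ℂ} (hd : ContinuousOn g (tube D))
    (y : Fin 3 → ℝ) (hy : y ∈ D) : Continuous (fun x => g (zt x y)) := by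
  refine hd.comp_continuous ?_ ?_
  · exact zt_cont.comp (by fun_prop : Continuous fun x : Fin 3 → ℝ => (x, y))
  · intro x; exact (zt_mem x).2 hy

lemma lft_cont {D : Set (Fin 3 → ℝ)} {g : (Fin 3 → ℂ) → ℂ} (hg : Per D g) 
    (hd : ContinuousOn g (tube D)) (y : Fin 3 → ℝ) (hy : y ∈ D) : Continuous (lft g y) := by
  have hq : IsOpenQuotientMap (Pi.map (fun (_ : Fin 3) (x : ℝ) => (x : UnitAddCircle))) :=
    IsOpenQuotientMap.piMap (fun i => QuotientAddGroup.isOpenQuotientMap_mk)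
  rw [← hq.continuous_comp_iff]
  refine (K_cont hd y hy).congr ?_
  intro x
  exact (lft_coe hg y hy x).symm

lemma rect1 (f : ℂ → ℂ) (u v : ℝ) (h : DifferentiableOn ℂ f {z | z.im ∈ Set.uIcc u v})
    (hp : ∀ z : ℂ, z.im ∈ Set.uIcc u v → f (z + 1) = f z) :
    (∫ s in (0:ℝ)..1, f (s + u * I)) = ∫ s in (0:ℝ)..1, f (s + v * I) := by
  have := Complex.integral_boundary_rect_eq_zero_of_differentiableOn f (u * I) (1 + v * I) (by
    refine h.mono ?_
    intro z hz
    simpa using hz.2)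
  simp only [add_re, mul_re, I_re, mul_zero, ofReal_im, I_im, mul_one, sub_self, one_re,
    add_zero, add_im, mul_im, ofReal_re, zero_add, one_im, ofReal_one, ofReal_zero] at this
  have e : (∫ y in u..v, f (1 + y * I)) = ∫ y in u..v, f (0 + y * I) := by
    refine intervalIntegral.integral_congr ?_
    intro y hy
    have := hp (0 + y * I) (by simpa using hy)
    simp only [] 
    rw [← this]; congr 1; ring
  rw [e] at this
  simp only [zero_add, add_sub_cancel_right] at this
  exact sub_eq_zero.1 (by linear_combination this)

def e3 (T : Fin 3 → ℤ) (t : Fin 3 → ℂ) : ℂ := cexp (2 * Real.pi * I * ∑ i, T i * t i)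

lemma cub_shift (f : (Fin 3 → ℝ) → ℂ) (a : Fin 3 → ℝ) :
    ∫ x in cub a, f x = ∫ x in cub 0, f (x + a) := by
  have h := (MeasureTheory.measurePreserving_add_right (MeasureTheory.volume : MeasureTheory.Measure (Fin 3 → ℝ)) a).setIntegral_preimage_emb
    (measurableEmbedding_addRight a) f (cub a)
  rw [← h]
  congr 2
  ext x
  simp [cub, add_comm]

lemma mF_eq {D : Set (Fin 3 → ℝ)} {g : (Fin 3 → ℂ) → ℂ} (hg : Per D g) (y : Fin 3 → ℝ) (hy : y ∈ D)
    (T : Fin 3 → ℤ) (a : Fin 3 → ℝ) : UnitAddTorus.mFourierCoeff (lft g y) T =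
      e3 T (zt 0 y) * ∫ x in cub 0, e3 (-T) (zt (x + a) y) * g (zt (x + a) y) := by
  rw [UnitAddTorus.mFourierCoeff_eq_integral _ _ a]
  have := cub_shift (fun x : Fin 3 → ℝ => UnitAddTorus.mFourier (-T) (fun i => (x i : UnitAddCircle)) • lft g y (fun i => (x i : UnitAddCircle))) a
  refine this.trans ?_
  rw [← MeasureTheory.integral_const_mul]
  congr 1
  funext x
  rw [lft_coe hg y hy, smul_eq_mul, ← mul_assoc]
  congr 1
  simp only [UnitAddTorus.mFourier, ContinuousMap.coe_mk, e3, fourier_coe_apply, ← Complex.exp_sum, ← Complex.exp_add]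
  congr 1
  simp only [zt, Fin.sum_univ_three]
  simp
  ring

lemma cub_sub : cub 0 ⊆ Set.Icc 0 1 := by
  intro x hx
  refine ⟨fun i => (hx i).1.le, fun i => by simpa using (hx i).2⟩

lemma mF_shift {D : Set (Fin 3 → ℝ)} {g : (Fin 3 → ℂ) → ℂ} (hg : Per D g) (y : Fin 3 → ℝ) (hy : y ∈ D)
    (T : Fin 3 → ℤ) (a : Fin 3 → ℝ) : ∫ x in cub 0, e3 (-T) (zt x y) * g (zt x y) =
      ∫ x in cub 0, e3 (-T) (zt (x + a) y) * g (zt (x + a) y) := by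
  have a1 := (mF_eq hg y hy T 0).symm.trans (mF_eq hg y hy T a)
  have := mul_left_cancel₀ (Complex.exp_ne_zero _) a1
  simp only [add_zero] at this
  exact this

lemma K_indep0 {D : Set (Fin 3 → ℝ)} {K : (Fin 3 → ℂ) → ℂ} (i : Fin 3) (hKd : DifferentiableOn ℂ K (tube D))
    (hKp : ∀ t ∈ tube D, K (t + Pi.single i 1) = K t)
    (hsh : ∀ y ∈ D, ∀ a, ∫ x in cub 0, K (zt x y) = ∫ x in cub 0, K (zt (x + a) y)) (y : Fin 3 → ℝ) (v : ℝ)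
    (hy : ∀ s ∈ Set.uIcc 0 v, y + Pi.single i s ∈ D) :
    ∫ x in cub 0, K (zt x y) = ∫ x in cub 0, K (zt x (y + Pi.single i v)) := by
  -- averaging
  have avg : ∀ s0 ∈ Set.uIcc 0 v, ∫ x in cub 0, K (zt x (y + Pi.single i s0)) = 
      ∫ x in cub 0, ∫ s in (0:ℝ)..1, K (zt x y + Pi.single i (s + s0 * I)) := by
    intro s0 hs0
    have h1 : ∀ s : ℝ, ∫ x in cub 0, K (zt x (y + Pi.single i s0)) = 
        ∫ x in cub 0, K (zt (x + Pi.single i s) (y + Pi.single i s0)) := by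
      intro s
      exact hsh _ (hy s0 hs0) _
    have h2 : ∫ x in cub 0, K (zt x (y + Pi.single i s0)) = ∫ s in (0:ℝ)..1,
        ∫ x in cub 0, K (zt (x + Pi.single i s) (y + Pi.single i s0)) := by
      rw [← intervalIntegral.integral_congr (fun s _ => h1 s)]
      simp
    rw [h2, intervalIntegral.integral_of_le zero_le_one]
    have e : ∀ x : Fin 3 → ℝ, ∀ s : ℝ, K (zt (x + Pi.single i s) (y + Pi.single i s0)) = 
        K (zt x y + Pi.single i (s + s0 * I)) := by
      intro x s
      congr 1
      funext j
      by_cases h : j = i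
      · subst h; simp [zt]; ring
      · simp [zt, Pi.single_eq_of_ne h]
    rw [MeasureTheory.integral_integral_swap]
    · simp only [e]
      congr 1
      funext x
      rw [intervalIntegral.integral_of_le zero_le_one]
    · rw [MeasureTheory.Measure.prod_restrict]
      refine MeasureTheory.IntegrableOn.mono_set (t := Set.Icc (0:ℝ) 1 ×ˢ Set.Icc (0 : Fin 3 → ℝ) 1) ?_ ?_
      · refine ContinuousOn.integrableOn_compact (isCompact_Icc.prod isCompact_Icc) ?_
        refine Continuous.continuousOn ?_
        have hc : Continuous (fun p : ℝ × (Fin 3 → ℝ) => zt (p.2 + Pi.single i p.1) (y + Pi.single i s0)) := by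
          refine zt_cont.comp (Continuous.prodMk (continuous_snd.add ?_) continuous_const)
          exact (continuous_single i).comp continuous_fst
        exact hKd.continuousOn.comp_continuous hc (fun p => (zt_mem _).2 (hy s0 hs0))
      · exact Set.prod_mono Set.Ioc_subset_Icc_self cub_sub
  have a0 := avg 0 Set.left_mem_uIcc
  rw [avg v Set.right_mem_uIcc]
  simp only [Pi.single_zero, add_zero] at a0
  rw [a0]
  congr 1
  funext x
  have := rect1 (fun w => K (zt x y + Pi.single i w)) 0 v ?_ ?_
  · simpa using this
  · refine hKd.comp (f := fun w : ℂ => zt x y + Pi.single i w) ?_ ?_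
    · have h1 : Differentiable ℂ (fun w : ℂ => (Pi.single i w : Fin 3 → ℂ)) :=
        by
        rw [differentiable_pi]
        intro j
        by_cases h : j = i
        · subst h; simp
        · simp [Pi.single_eq_of_ne h]
      exact (h1.const_add (zt x y)).differentiableOn
    · intro z hz
      have := hy z.im hz
      unfold tube
      rw [Set.mem_ofPred_eq]
      convert this using 1
      funext j
      by_cases h : j = i
      · subst h; simp [zt]
      · simp [zt, Pi.single_eq_of_ne h]
  · intro z hz
    have := hy z.im hz
    refine (congrArg K ?_).trans (hKp (zt x y + Pi.single i z) ?_)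
    · rw [Pi.single_add, add_assoc]
    · unfold tube
      rw [Set.mem_ofPred_eq]
      convert this using 1
      funext j
      by_cases h : j = i
      · subst h; simp [zt]
      · simp [zt, Pi.single_eq_of_ne h]

lemma K_indep {D : Set (Fin 3 → ℝ)} {g : (Fin 3 → ℂ) → ℂ} (hg : Per D g) 
    (hd : DifferentiableOn ℂ g (tube D)) (T : Fin 3 → ℤ) (y : Fin 3 → ℝ) (i : Fin 3) (v : ℝ)
    (hy : ∀ s ∈ Set.uIcc 0 v, y + Pi.single i s ∈ D) :
    ∫ x in cub 0, e3 (-T) (zt x y) * g (zt x y) = 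
      ∫ x in cub 0, e3 (-T) (zt x (y + Pi.single i v)) * g (zt x (y + Pi.single i v)) := by
  let K : (Fin 3 → ℂ) → ℂ := fun t => e3 (-T) t * g t
  have hKd : DifferentiableOn ℂ K (tube D) := by
    refine DifferentiableOn.mul ?_ hd
    unfold e3
    fun_prop
  have hKp : ∀ t ∈ tube D, K (t + Pi.single i 1) = K t := by
    intro t ht
    simp only [K]
    rw [hg t ht]
    congr 1
    unfold e3
    rw [Complex.exp_eq_exp_iff_exists_int]
    refine ⟨-T i, ?_⟩
    simp only [Pi.add_apply, mul_add, Finset.sum_add_distrib, Pi.neg_apply]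
    rw [Finset.sum_eq_single i (f := fun j => (((-T j : ℤ):ℂ) * (Pi.single i 1 : Fin 3 → ℂ) j))]
    · simp; ring
    · intro j _ hj; simp [Pi.single_eq_of_ne hj]
    · simp
  refine K_indep0 i hKd hKp (fun y hy a => mF_shift hg y hy T a) y v hy

def D0 : Set (Fin 3 → ℝ) := {y | 0 < y 0 ∧ y 1 ^ 2 < y 0 * y 2}

lemma D0_open : IsOpen D0 := by
  have h1 : IsOpen {y : Fin 3 → ℝ | 0 < y 0} := isOpen_lt (by fun_prop) (by fun_prop)
  have h2 : IsOpen {y : Fin 3 → ℝ | y 1 ^ 2 < y 0 * y 2} := isOpen_lt (by fun_prop) (by fun_prop)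
  exact h1.inter h2

def Jc (g : (Fin 3 → ℂ) → ℂ) (T : Fin 3 → ℤ) (y : Fin 3 → ℝ) : ℂ :=
  ∫ x in cub 0, e3 (-T) (zt x y) * g (zt x y)

lemma uIcc_shift {u v s : ℝ} (hs : s ∈ Set.uIcc 0 (v - u)) : u + s ∈ Set.uIcc u v := by
  rw [Set.mem_uIcc] at *
  rcases hs with h | h
  · left; constructor <;> linarith [h.1, h.2]
  · right; constructor <;> linarith [h.1, h.2]

lemma Jc_const {g : (Fin 3 → ℂ) → ℂ} (hg : Per D0 g) 
    (hd : DifferentiableOn ℂ g (tube D0)) (T : Fin 3 → ℤ) (y : Fin 3 → ℝ) (hy : y ∈ D0) :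
    Jc g T y = Jc g T ![1, 0, 1] := by
  have m0 : ∀ a a' b c : ℝ, (∀ s ∈ Set.uIcc a a', ![s,b,c] ∈ D0) → Jc g T ![a,b,c] = Jc g T ![a',b,c] := by
    intro a a' b c h
    have e : ∀ s, ![a,b,c] + Pi.single 0 s = ![a+s,b,c] := by
      intro s; funext j; fin_cases j <;> simp
    have := K_indep hg hd T ![a,b,c] 0 (a' - a) (fun s hs => by rw [e]; exact h _ (uIcc_shift hs))
    rw [e, add_sub_cancel] at this
    exact this
  have m1 : ∀ a b b' c : ℝ, (∀ s ∈ Set.uIcc b b', ![a,s,c] ∈ D0) → Jc g T ![a,b,c] = Jc g T ![a,b',c] := by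
    intro a b b' c h
    have e : ∀ s, ![a,b,c] + Pi.single 1 s = ![a,b+s,c] := by
      intro s; funext j; fin_cases j <;> simp
    have := K_indep hg hd T ![a,b,c] 1 (b' - b) (fun s hs => by rw [e]; exact h _ (uIcc_shift hs))
    rw [e, add_sub_cancel] at this
    exact this
  have m2 : ∀ a b c c' : ℝ, (∀ s ∈ Set.uIcc c c', ![a,b,s] ∈ D0) → Jc g T ![a,b,c] = Jc g T ![a,b,c'] := by
    intro a b c c' h
    have e : ∀ s, ![a,b,c] + Pi.single 2 s = ![a,b,c+s] := by
      intro s; funext j; fin_cases j <;> simp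
    have := K_indep hg hd T ![a,b,c] 2 (c' - c) (fun s hs => by rw [e]; exact h _ (uIcc_shift hs))
    rw [e, add_sub_cancel] at this
    exact this
  have hD : ∀ a b c : ℝ, ![a,b,c] ∈ D0 ↔ 0 < a ∧ b^2 < a*c := fun a b c => by simp [D0]
  obtain ⟨a, b, c, rfl⟩ : ∃ a b c, y = ![a,b,c] := ⟨y 0, y 1, y 2, by funext j; fin_cases j <;> rfl⟩
  rw [hD] at hy
  have hc : 0 < c := by
    by_contra h
    push Not at h
    nlinarith [sq_nonneg b]
  set M := max a (max c 1) with hM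
  have hMa : a ≤ M := le_max_left _ _
  have hMc : c ≤ M := (le_max_left _ _).trans (le_max_right _ _)
  have hM1 : 1 ≤ M := (le_max_right _ _).trans (le_max_right _ _)
  rw [m0 a M b c, m2 M b c M, m1 M b 0 M, m0 M 1 0 M, m2 1 0 M 1]
  · intro s hs
    rw [Set.uIcc_of_ge hM1] at hs
    rw [hD]; constructor <;> nlinarith [hs.1]
  · intro s hs
    rw [Set.uIcc_of_ge hM1] at hs
    rw [hD]; constructor <;> nlinarith [hs.1]
  · intro s hs
    rw [hD]
    refine ⟨by linarith, ?_⟩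
    have : s ^ 2 ≤ b ^ 2 := by
      rw [Set.mem_uIcc] at hs
      rcases hs with h | h <;> nlinarith [h.1, h.2]
    nlinarith
  · intro s hs
    rw [Set.uIcc_of_le hMc] at hs
    rw [hD]; refine ⟨by linarith, ?_⟩
    have := mul_le_mul hMa hs.1 hc.le (by linarith)
    linarith [hy.2]
  · intro s hs
    rw [Set.uIcc_of_le hMa] at hs
    rw [hD]; refine ⟨by linarith [hs.1], ?_⟩
    nlinarith [hs.1, hy.2]

lemma Jc_bound {g : (Fin 3 → ℂ) → ℂ} (hd : DifferentiableOn ℂ g (tube D0)) (y : Fin 3 → ℝ) (hy : y ∈ D0) :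
    ∃ C : ℝ, 0 ≤ C ∧ ∀ T, ‖Jc g T y‖ ≤ C * Real.exp (2 * Real.pi * ∑ i, T i * y i) := by
  obtain ⟨C, hC⟩ := (isCompact_Icc (a := (0 : Fin 3 → ℝ)) (b := 1)).exists_bound_of_continuousOn
    (K_cont hd.continuousOn y hy).continuousOn
  have hC0 : 0 ≤ C := (norm_nonneg _).trans (hC 0 (by simp))
  refine ⟨C * MeasureTheory.volume.real (cub 0), mul_nonneg hC0 MeasureTheory.measureReal_nonneg, fun T => ?_⟩
  have := MeasureTheory.norm_setIntegral_le_of_norm_le_const (μ := MeasureTheory.volume) (s := cub 0)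
    (f := fun x => e3 (-T) (zt x y) * g (zt x y)) (C := Real.exp (2 * Real.pi * ∑ i, T i * y i) * C)
    ((MeasureTheory.measure_mono cub_sub).trans_lt isCompact_Icc.measure_lt_top) (by
      intro x hx
      rw [norm_mul]
      refine mul_le_mul (le_of_eq ?_) (hC x (cub_sub hx)) (norm_nonneg _) (Real.exp_nonneg _)
      rw [e3, Complex.norm_exp]
      congr 1
      simp [zt, Fin.sum_univ_three]
      ring)
  refine this.trans (le_of_eq (by ring))

def eq3 : ℤ × ℤ × ℤ ≃ (Fin 3 → ℤ) where
  toFun p := ![p.1, p.2.1, p.2.2]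
  invFun T := (T 0, T 1, T 2)
  left_inv p := rfl
  right_inv T := by funext j; fin_cases j <;> rfl

lemma summable_geom_abs {x : ℝ} (h0 : 0 ≤ x) (h1 : x < 1) : Summable (fun n : ℤ => x ^ n.natAbs) := by
  rw [summable_int_iff_summable_nat_and_neg]
  simp [summable_geometric_of_lt_one h0 h1]

lemma summable_geom3 {x : ℝ} (h0 : 0 ≤ x) (h1 : x < 1) :
    Summable (fun p : ℤ × ℤ × ℤ => x ^ p.1.natAbs * (x ^ p.2.1.natAbs * x ^ p.2.2.natAbs)) := by
  have s := summable_geom_abs h0 h1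
  have s2 := s.mul_of_nonneg s (fun n => pow_nonneg h0 _) (fun n => pow_nonneg h0 _)
  have s3 := s.mul_of_nonneg s2 (fun n => pow_nonneg h0 _) (fun n => mul_nonneg (pow_nonneg h0 _) (pow_nonneg h0 _))
  exact s3

theorem fourier3 {g : (Fin 3 → ℂ) → ℂ} (hg : Per D0 g) (hd : DifferentiableOn ℂ g (tube D0)) :
    ∃ a : ℤ → ℤ → ℤ → ℂ, ∀ t ∈ tube D0, HasSum (fun p : ℤ × ℤ × ℤ => a p.1 p.2.1 p.2.2 *
      cexp (2 * Real.pi * I * (p.1 * t 0 + p.2.1 * t 1 + p.2.2 * t 2))) (g t) := by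
  refine ⟨fun n r m => Jc g ![n,r,m] ![1,0,1], fun t ht => ?_⟩
  set y : Fin 3 → ℝ := fun i => (t i).im with hyd
  have hy : y ∈ D0 := ht
  obtain ⟨δ, hδ, hball⟩ : ∃ δ > 0, ∀ σ : Fin 3 → SignType, y - (fun i => δ * (σ i : ℝ)) ∈ D0 := by
    obtain ⟨ρ, hρ, h⟩ := Metric.isOpen_iff.1 D0_open y hy
    refine ⟨ρ / 2, by positivity, fun σ => h ?_⟩
    rw [Metric.mem_ball, dist_eq_norm, pi_norm_lt_iff hρ]
    intro i
    simp only [Pi.sub_apply, sub_sub_cancel_left, norm_neg, norm_mul]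
    have : ‖((σ i : SignType) : ℝ)‖ ≤ 1 := by
      generalize σ i = s
      cases s <;> simp
    rw [Real.norm_of_nonneg (by positivity)]
    nlinarith
  choose C hC0 hC using fun σ : Fin 3 → SignType => Jc_bound hd _ (hball σ)
  set M := ∑ σ, C σ with hM
  set x := Real.exp (-(2 * Real.pi * δ)) with hx
  have hx1 : x < 1 := by rw [hx, Real.exp_lt_one_iff]; have := Real.pi_pos; nlinarith [mul_pos this hδ]
  have hbd : ∀ T : Fin 3 → ℤ, ‖Jc g T ![1,0,1]‖ * Real.exp (-(2 * Real.pi * ∑ i, T i * y i)) ≤ 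
      M * (x ^ (T 0).natAbs * (x ^ (T 1).natAbs * x ^ (T 2).natAbs)) := by
    intro T
    have h1 := hC (fun i => SignType.sign (T i)) T
    rw [Jc_const hg hd T _ (hball _)] at h1
    have h2 : C (fun i => SignType.sign (T i)) ≤ M := Finset.single_le_sum (fun σ _ => hC0 σ) (Finset.mem_univ _)
    have h3 : x ^ (T 0).natAbs * (x ^ (T 1).natAbs * x ^ (T 2).natAbs) = 
      Real.exp (2 * Real.pi * ∑ i, T i * (y - (fun i => δ * ((SignType.sign (T i) : SignType) : ℝ))) i) *
      Real.exp (-(2 * Real.pi * ∑ i, T i * y i)) := by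
      rw [hx, ← Real.exp_nat_mul, ← Real.exp_nat_mul, ← Real.exp_nat_mul, ← Real.exp_add, ← Real.exp_add, ← Real.exp_add]
      congr 1
      have hs : ∀ n : ℤ, ((n.natAbs : ℕ) : ℝ) = n * ((SignType.sign n : SignType) : ℝ) := by
        intro n
        rw [Nat.cast_natAbs]
        rw [← self_mul_sign n]
        push_cast
        simp
      simp only [Fin.sum_univ_three, hs, Pi.sub_apply]
      ring
    rw [h3, ← mul_assoc]
    gcongr
    exact h1.trans (by gcongr)
  have hco : ∀ T, UnitAddTorus.mFourierCoeff (lft g y) T = e3 T (zt 0 y) * Jc g T ![1,0,1] := by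
    intro T
    have := mF_eq hg y hy T 0
    simp only [add_zero] at this
    rw [this, ← Jc_const hg hd T y hy, Jc]
  have hn : ∀ T, ‖e3 T (zt 0 y)‖ = Real.exp (-(2 * Real.pi * ∑ i, T i * y i)) := by
    intro T
    rw [e3, Complex.norm_exp]
    congr 1
    simp [zt, Fin.sum_univ_three]
  have hsum : Summable (fun T => UnitAddTorus.mFourierCoeff (lft g y) T) := by
    rw [← eq3.summable_iff]
    refine Summable.of_norm_bounded ((summable_geom3 (Real.exp_nonneg _) hx1).mul_left M) ?_
    intro p
    simp only [Function.comp]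
    rw [hco, norm_mul, hn, mul_comm]
    exact hbd _
  have hs := UnitAddTorus.hasSum_mFourier_series_apply_of_summable (f := ⟨lft g y, lft_cont hg hd.continuousOn y hy⟩) hsum
    (fun i => ((t i).re : UnitAddCircle))
  rw [← eq3.hasSum_iff] at hs
  simp only [ContinuousMap.coe_mk] at hs
  rw [lft_coe hg y hy] at hs
  have ht' : zt (fun i => (t i).re) y = t := by
    funext i; simp [zt, hyd]
  rw [ht'] at hs
  refine hs.congr_fun ?_
  intro p
  simp only [Function.comp]
  rw [hco]
  simp only [UnitAddTorus.mFourier, ContinuousMap.coe_mk, e3, fourier_coe_apply, ← Complex.exp_sum, smul_eq_mul]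
  symm
  rw [mul_right_comm, ← Complex.exp_add, mul_comm]
  congr 2
  have q0 : eq3 p 0 = p.1 := rfl
  have q1 : eq3 p 1 = p.2.1 := rfl
  have q2 : eq3 p 2 = p.2.2 := rfl
  simp [zt, Fin.sum_univ_three, hyd, q0, q1, q2]
  linear_combination 2 * Real.pi * I * (p.1 * Complex.re_add_im (t 0) + p.2.1 * Complex.re_add_im (t 1) + p.2.2 * Complex.re_add_im (t 2))

section
open MeasureTheory
local instance instMSU : MeasureSpace UnitAddCircle := ⟨AddCircle.haarAddCircle⟩
local instance instPMU : IsProbabilityMeasure (volume : Measure UnitAddCircle) :=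
  inferInstanceAs (IsProbabilityMeasure AddCircle.haarAddCircle)

lemma uniqT {d : Type} [Fintype d] (a : (d → ℤ) → ℂ) (hs : Summable (fun T => ‖a T‖))
    (h : ∀ x : d → ℝ, HasSum (fun T => a T * cexp (2 * Real.pi * I * ∑ i, T i * x i)) 0) : a = 0 := by
  have h1 : Summable (fun T => a T • UnitAddTorus.mFourier (d := d) T) := by
    refine Summable.of_norm ?_
    simpa [norm_smul, UnitAddTorus.mFourier_norm] using hs
  have h2 : HasSum (fun T => a T • UnitAddTorus.mFourier (d := d) T) 0 := by
    obtain ⟨f, hf⟩ := h1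
    have : f = 0 := by
      ext x
      obtain ⟨y, rfl⟩ : ∃ y : d → ℝ, x = fun i => (y i : UnitAddCircle) := by
        choose y hy using fun i => QuotientAddGroup.mk_surjective (x i)
        exact ⟨y, funext fun i => (hy i).symm⟩
      have e1 := hf.map (ContinuousMap.evalCLM ℂ (fun i => (y i : UnitAddCircle)) : C(UnitAddTorus d, ℂ) →L[ℂ] ℂ) (ContinuousLinearMap.continuous _)
      have e2 := h y
      refine e1.unique (e2.congr_fun ?_)
      intro T
      simp only [Function.comp, map_smul, ContinuousMap.evalCLM_apply, smul_eq_mul]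
      congr 1
      simp only [UnitAddTorus.mFourier, ContinuousMap.coe_mk, fourier_coe_apply, ← Complex.exp_sum]
      congr 1
      rw [Complex.ofReal_sum, Finset.mul_sum]
      refine Finset.sum_congr rfl fun i _ => ?_
      simp; ring
    rwa [this] at hf
  have ho := UnitAddTorus.orthonormal_mFourier (d := d)
  funext q
  have h3 := h2.map (ContinuousMap.toLp (E := ℂ) 2 volume ℂ : C(UnitAddTorus d, ℂ) →L[ℂ] _) (ContinuousLinearMap.continuous _)
  have h4 := h3.map (innerSL ℂ (UnitAddTorus.mFourierLp (d := d) 2 q)) (ContinuousLinearMap.continuous _)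
  simp only [map_zero] at h4
  have h5 := hasSum_single (f := (⇑(innerSL ℂ (UnitAddTorus.mFourierLp (d := d) 2 q)) ∘
      (⇑(ContinuousMap.toLp (E := ℂ) 2 volume ℂ : C(UnitAddTorus d, ℂ) →L[ℂ] _) ∘ fun T => a T • UnitAddTorus.mFourier (d := d) T))) q (by
    intro T hT
    simp only [Function.comp, map_smul, innerSL_apply_apply]
    rw [orthonormal_iff_ite.1 ho q T, if_neg hT.symm, smul_zero])
  have h6 := h5.unique h4
  simp only [Function.comp, map_smul, innerSL_apply_apply] at h6
  rw [orthonormal_iff_ite.1 ho q q, if_pos rfl] at h6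
  simpa using h6
end

lemma uniq1 (a : ℤ → ℂ) (y : ℝ) (h : ∀ x : ℝ, HasSum (fun m => a m * cexp (Real.pi * I * (m * (x + y * I)))) 0) :
    a = 0 := by
  have hk := uniqT (d := Unit) (fun T => a (T ()) * cexp (Real.pi * I * (T () * (y * I)))) ?_ ?_
  · funext m
    have := congrFun hk (fun _ => m)
    simpa [Complex.exp_ne_zero] using this
  · have := (h 0).summable.norm
    rw [← (Equiv.funUnique Unit ℤ).summable_iff] at this
    simpa [Function.comp_def] using this
  · intro x
    have := h (2 * x ())
    rw [← (Equiv.funUnique Unit ℤ).hasSum_iff] at this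
    refine this.congr_fun ?_
    intro T
    simp only [Function.comp, Equiv.funUnique_apply, Finset.univ_unique, Finset.sum_singleton]
    rw [mul_assoc, ← Complex.exp_add]
    congr 2
    push_cast
    simp [default]
    ring

/-- exponentials -/
def EE (p : ℤ × ℤ × ℤ) (a b c : ℂ) : ℂ := cexp (Real.pi * I * (p.1 * a + p.2.1 * b + p.2.2 * c))

lemma uniq3 (B : ℤ × ℤ × ℤ → ℂ) (h : ∀ a b c : ℂ, tm a b c ∈ H2 → HasSum (fun p => B p * EE p a b c) 0) :
    B = 0 := by
  have hm : ∀ x : Fin 3 → ℝ, tm (2 * x 0 + I) (2 * x 1) (2 * x 2 + I) ∈ H2 := by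
    intro x
    rw [tm_mem]; simp
  have hk := uniqT (d := Fin 3) (fun T => B (eq3.symm T) * EE (eq3.symm T) I 0 I) ?_ ?_
  · funext p
    have := congrFun hk (eq3 p)
    simpa [EE, Complex.exp_ne_zero] using this
  · have := (h _ _ _ (hm 0)).summable.norm
    rw [← eq3.symm.summable_iff] at this
    simpa [Function.comp_def] using this
  · intro x
    have := h _ _ _ (hm x)
    rw [← eq3.symm.hasSum_iff] at this
    refine this.congr_fun ?_
    intro T
    simp only [Function.comp]
    rw [mul_assoc, EE, EE, ← Complex.exp_add]
    congr 2
    have q0 : (eq3.symm T).1 = T 0 := rfl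
    have q1 : (eq3.symm T).2.1 = T 1 := rfl
    have q2 : (eq3.symm T).2.2 = T 2 := rfl
    simp [Fin.sum_univ_three, q0, q1, q2]
    ring

lemma uniq3' (B C : ℤ × ℤ × ℤ → ℂ) (f : ℂ → ℂ → ℂ → ℂ) 
    (h : ∀ a b c : ℂ, tm a b c ∈ H2 → HasSum (fun p => B p * EE p a b c) (f a b c))
    (h' : ∀ a b c : ℂ, tm a b c ∈ H2 → HasSum (fun p => C p * EE p a b c) (f a b c)) (p) : B p = C p := by
  have := uniq3 (B - C) (fun a b c hm => by
    have := (h a b c hm).sub (h' a b c hm)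
    rw [sub_self] at this
    refine this.congr_fun fun p => ?_
    simp [sub_mul])
  exact sub_eq_zero.1 (congrFun this p)

lemma uniq3r (B C : ℤ × ℤ × ℤ → ℂ) (f : ℂ → ℂ → ℂ → ℂ) (σ : ℤ × ℤ × ℤ ≃ ℤ × ℤ × ℤ)
    (h : ∀ a b c : ℂ, tm a b c ∈ H2 → HasSum (fun p => B p * EE (σ p) a b c) (f a b c))
    (h' : ∀ a b c : ℂ, tm a b c ∈ H2 → HasSum (fun p => C p * EE p a b c) (f a b c)) (p) : B p = C (σ p) := by
  have := uniq3' (B ∘ σ.symm) C f (fun a b c hm => by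
    have := h a b c hm
    rw [← σ.symm.hasSum_iff] at this
    simpa [Function.comp_def] using this) h' (σ p)
  simpa using this

structure Cof (F : (Fin 2 → Fin 2 → ℂ) → (Fin 19 → ℂ)) (A : ℤ → ℤ → ℤ → Fin 19 → ℂ) : Prop where
  sum : ∀ a b c : ℂ, tm a b c ∈ H2 → ∀ i, HasSum (fun p : ℤ × ℤ × ℤ => A p.1 p.2.1 p.2.2 i * EE p a b c) (F (tm a b c) i)
  odd : ∀ n r m, A n r m ≠ 0 → Odd n ∧ Odd r ∧ Odd m
  sw : ∀ n r m x y, pv (j := 18) (A n r m) x y = - pv (j := 18) (A m r n) y x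
  sh : ∀ n r m x y, pv (j := 18) (A n r m) x y = - pv (j := 18) (A (n+r+m) (r+2*m) m) x (y-x)
  neg : ∀ n r m x y, pv (j := 18) (A n r m) x y = pv (j := 18) (A n (-r) m) (-x) y

lemma exists_cof {F} (L : Laws F) (L2 : Laws2 F) (hd : DifferentiableOn ℂ F H2) : ∃ A, Cof F A := by
  have hmem : ∀ t : Fin 3 → ℂ, t ∈ tube D0 → tm (2 * t 0) (2 * t 1) (2 * t 2) ∈ H2 := by
    intro t ht
    rw [tm_mem]
    obtain ⟨h1, h2⟩ := ht
    simp
    constructor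
    · exact h1
    · simp only [] at h2
      nlinarith
  have t1' : ∀ a b c, tm a b c ∈ H2 → F (tm (a+2) b c) = F (tm a b c) := by
    intro a b c h
    have := L.t1 (a+1) b c (by rw [tm_mem] at *; simpa using h)
    rw [L.t1 a b c h, neg_neg] at this
    rw [← this]; congr 2; ring
  have t2' : ∀ a b c, tm a b c ∈ H2 → F (tm a b (c+2)) = F (tm a b c) := by
    intro a b c h
    have := L2.t2 a b (c+1) (by rw [tm_mem] at *; simpa using h)
    rw [L2.t2 a b c h, neg_neg] at this
    rw [← this]; congr 2; ring
  have off' : ∀ a b c, tm a b c ∈ H2 → F (tm a (b+2) c) = F (tm a b c) := by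
    intro a b c h
    have := L2.off a (b+1) c (by rw [tm_mem] at *; simpa using h)
    rw [L2.off a b c h, neg_neg] at this
    rw [← this]; congr 2; ring
  have hg : ∀ i : Fin 19, ∃ a : ℤ → ℤ → ℤ → ℂ, ∀ t ∈ tube D0, HasSum (fun p : ℤ × ℤ × ℤ => a p.1 p.2.1 p.2.2 *
      cexp (2 * Real.pi * I * (p.1 * t 0 + p.2.1 * t 1 + p.2.2 * t 2))) (F (tm (2 * t 0) (2 * t 1) (2 * t 2)) i) := by
    intro i
    refine fourier3 (g := fun t => F (tm (2 * t 0) (2 * t 1) (2 * t 2)) i) ?_ ?_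
    · intro t ht j
      have hm := hmem t ht
      fin_cases j
      · simpa [mul_add] using congrFun (t1' _ _ _ hm) i
      · simpa [mul_add] using congrFun (off' _ _ _ hm) i
      · simpa [mul_add] using congrFun (t2' _ _ _ hm) i
    · have h1 : DifferentiableOn ℂ (fun τ => F τ i) H2 := by
        rw [differentiableOn_pi] at hd; exact hd i
      refine h1.comp (f := fun t : Fin 3 → ℂ => tm (2 * t 0) (2 * t 1) (2 * t 2)) ?_ hmem
      refine Differentiable.differentiableOn ?_
      rw [differentiable_pi]
      intro k
      rw [differentiable_pi]
      intro l
      fin_cases k <;> fin_cases l <;> simp [tm] <;> fun_prop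
  choose A0 hA0 using hg
  set A : ℤ → ℤ → ℤ → Fin 19 → ℂ := fun n r m i => A0 i n r m with hA
  have hsum : ∀ a b c : ℂ, tm a b c ∈ H2 → ∀ i, HasSum (fun p : ℤ × ℤ × ℤ => A p.1 p.2.1 p.2.2 i * EE p a b c) (F (tm a b c) i) := by
    intro a b c h i
    have := hA0 i ![a/2, b/2, c/2] (by
      rw [tm_mem] at h
      simp only [tube, D0, Set.mem_ofPred_eq]
      simp
      constructor <;> nlinarith [h.1, h.2])
    simp only [Matrix.cons_val_zero, Matrix.cons_val_one, Matrix.cons_val] at this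
    rw [mul_div_cancel₀ _ two_ne_zero, mul_div_cancel₀ _ two_ne_zero, mul_div_cancel₀ _ two_ne_zero] at this
    refine this.congr_fun fun p => ?_
    simp only [hA, EE]
    congr 2
    ring
  have hpv : ∀ a b c : ℂ, tm a b c ∈ H2 → ∀ x y, HasSum (fun p : ℤ × ℤ × ℤ => pv (j := 18) (A p.1 p.2.1 p.2.2) x y * EE p a b c) (pv (j := 18) (F (tm a b c)) x y) := by
    intro a b c h x y
    simp only [pv, Finset.sum_mul]
    refine hasSum_sum fun i _ => ?_
    refine ((hsum a b c h i).mul_right _).congr_fun fun p => ?_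
    ring
  have hsw : ∀ n r m x y, pv (j := 18) (A n r m) x y = - pv (j := 18) (A m r n) y x := by
    intro n r m x y
    refine uniq3r (fun p => pv (j := 18) (A p.1 p.2.1 p.2.2) x y) (fun p => - pv (j := 18) (A p.1 p.2.1 p.2.2) y x)
      (fun a b c => - pv (j := 18) (F (tm a b c)) y x) ⟨fun p => (p.2.2, p.2.1, p.1), fun p => (p.2.2, p.2.1, p.1), fun p => rfl, fun p => rfl⟩ ?_ ?_ (n, r, m)
    · intro a b c h
      have := hpv c b a (by rw [tm_mem] at *; exact ⟨by nlinarith [sq_nonneg b.im], by linarith⟩) x y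
      rw [L.s a b c h] at this
      refine this.congr_fun fun p => ?_
      simp only [EE, Equiv.coe_fn_mk]
      congr 2
      ring
    · intro a b c h
      refine (hpv a b c h y x).neg.congr_fun fun p => ?_
      ring
  refine ⟨A, hsum, ?_, hsw, ?_, ?_⟩
  · intro n r m hne
    have hex : ∃ i, A n r m i ≠ 0 := by
      by_contra hcon
      push Not at hcon
      exact hne (funext hcon)
    obtain ⟨i, hi⟩ := hex
    have gen : ∀ (k : ℤ × ℤ × ℤ → ℤ) (g : ℂ → ℂ → ℂ → ℂ × ℂ × ℂ), (∀ a b c, tm a b c ∈ H2 → tm (g a b c).1 (g a b c).2.1 (g a b c).2.2 ∈ H2 ∧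
        F (tm (g a b c).1 (g a b c).2.1 (g a b c).2.2) = - F (tm a b c) ∧
        ∀ p, EE p (g a b c).1 (g a b c).2.1 (g a b c).2.2 = (cexp (Real.pi * I)) ^ (k p) * EE p a b c) → Odd (k (n, r, m)) := by
      intro k g hgk
      have := uniq3' (fun p => A p.1 p.2.1 p.2.2 i * (cexp (Real.pi * I)) ^ (k p)) (fun p => - A p.1 p.2.1 p.2.2 i)
        (fun a b c => - F (tm a b c) i) (fun a b c h => by
          obtain ⟨h1, h2, h3⟩ := hgk a b c h
          have := hsum _ _ _ h1 i
          rw [h2] at this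
          refine this.congr_fun fun p => ?_
          rw [h3]; ring) (fun a b c h => by
          refine (hsum a b c h i).neg.congr_fun fun p => ?_
          ring) (n, r, m)
      by_contra hodd
      rw [Int.not_odd_iff_even] at hodd
      simp only [exp_pi_mul_I, hodd.neg_one_zpow] at this
      apply hi
      linear_combination this / 2
    refine ⟨gen (fun p => p.1) (fun a b c => (a + 1, b, c)) ?_, gen (fun p => p.2.1) (fun a b c => (a, b + 1, c)) ?_, gen (fun p => p.2.2) (fun a b c => (a, b, c + 1)) ?_⟩
    · intro a b c h
      refine ⟨by rw [tm_mem] at *; simpa using h, L.t1 a b c h, fun p => ?_⟩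
      rw [EE, EE, ← Complex.exp_int_mul, ← Complex.exp_add]
      congr 1; ring
    · intro a b c h
      refine ⟨by rw [tm_mem] at *; simpa using h, L2.off a b c h, fun p => ?_⟩
      rw [EE, EE, ← Complex.exp_int_mul, ← Complex.exp_add]
      congr 1; ring
    · intro a b c h
      refine ⟨by rw [tm_mem] at *; simpa using h, L2.t2 a b c h, fun p => ?_⟩
      rw [EE, EE, ← Complex.exp_int_mul, ← Complex.exp_add]
      congr 1; ring
  · have h1 : ∀ n r m x y, pv (j := 18) (A n r m) x y = - pv (j := 18) (A n (r+2*n) (n+r+m)) (x-y) y := by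
      intro n r m x y
      refine uniq3r (fun p => pv (j := 18) (A p.1 p.2.1 p.2.2) x y) (fun p => - pv (j := 18) (A p.1 p.2.1 p.2.2) (x-y) y)
        (fun a b c => - pv (j := 18) (F (tm a b c)) (x-y) y) ⟨fun p => (p.1, p.2.1 + 2 * p.1, p.1 + p.2.1 + p.2.2), fun p => (p.1, p.2.1 - 2 * p.1, p.1 - p.2.1 + p.2.2),
          fun p => by ext <;> simp <;> ring, fun p => by ext <;> simp <;> ring⟩ ?_ ?_ (n, r, m)
      · intro a b c h
        have := hpv (a+2*b+c) (b+c) c (by 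
          rw [tm_mem] at *
          simp only [add_im, mul_im, re_ofNat, im_ofNat, zero_mul, add_zero]
          refine ⟨?_, by nlinarith⟩
          have hc : 0 < c.im := by nlinarith [sq_nonneg b.im]
          nlinarith [sq_nonneg (b.im + c.im), sq_nonneg b.im]) x y
        rw [L.u a b c h] at this
        refine this.congr_fun fun p => ?_
        simp only [EE, Equiv.coe_fn_mk]
        congr 2
        push_cast
        ring
      · intro a b c h
        refine (hpv a b c h (x-y) y).neg.congr_fun fun p => ?_
        ring
    intro n r m x y
    rw [hsw, h1, hsw m]
    have e : m + r + n = n + r + m := by ring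
    rw [e]
    ring
  · intro n r m x y
    refine uniq3r (fun p => pv (j := 18) (A p.1 p.2.1 p.2.2) x y) (fun p => pv (j := 18) (A p.1 p.2.1 p.2.2) (-x) y)
      (fun a b c => pv (j := 18) (F (tm a b c)) (-x) y) ⟨fun p => (p.1, -p.2.1, p.2.2), fun p => (p.1, -p.2.1, p.2.2), fun p => by simp, fun p => by simp⟩ ?_ ?_ (n, r, m)
    · intro a b c h
      have := hpv a (-b) c (by rw [tm_mem] at *; simpa using h) x y
      rw [L2.d a b c h] at this
      refine this.congr_fun fun p => ?_
      simp only [EE, Equiv.coe_fn_mk]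
      congr 2
      push_cast
      ring
    · intro a b c h
      exact hpv a b c h (-x) y

lemma pv_one (v : Fin 19 → ℂ) (y : ℂ) : pv (j := 18) v 1 y = ∑ l : Fin 19, v l * y ^ (l:ℕ) := by
  simp [pv]

/-- comparison of top coefficients -/
lemma top_coef (u w : Fin 19 → ℂ) (z : ℂ) (i0 : Fin 19) (hw : ∀ i, i0 < i → w i = 0)
    (h : ∀ y : ℂ, ∑ l : Fin 19, u l * y ^ (l:ℕ) = ∑ l : Fin 19, w l * (y + z) ^ (l:ℕ)) : u i0 = w i0 := by
  have hp : ∑ l : Fin 19, Polynomial.C (u l) * Polynomial.X ^ (l:ℕ) = ∑ l : Fin 19, Polynomial.C (w l) * (Polynomial.X + Polynomial.C z) ^ (l:ℕ) := by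
    refine Polynomial.funext fun y => ?_
    simpa [Polynomial.eval_finset_sum] using h y
  have hc := congrArg (fun q => Polynomial.coeff q (i0 : ℕ)) hp
  simp only [Polynomial.finset_sum_coeff, Polynomial.coeff_C_mul] at hc
  rw [Finset.sum_eq_single i0, Finset.sum_eq_single i0] at hc
  · have h1 : ((Polynomial.X + Polynomial.C z) ^ (i0:ℕ)).coeff (i0:ℕ) = 1 := by
      rw [Polynomial.coeff_X_add_C_pow]; simp
    rw [h1] at hc
    simpa using hc
  · intro l _ hl
    rcases lt_or_gt_of_ne hl with hl | hl
    · have : ((Polynomial.X + Polynomial.C z) ^ (l:ℕ)).coeff (i0:ℕ) = 0 := by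
        rw [Polynomial.coeff_X_add_C_pow, Nat.choose_eq_zero_of_lt hl]; simp
      rw [this, mul_zero]
    · rw [hw l hl, zero_mul]
  · simp
  · intro l _ hl
    rw [Polynomial.coeff_X_pow, if_neg, mul_zero]
    exact fun e => hl (Fin.ext e.symm)
  · simp

section
variable {F : (Fin 2 → Fin 2 → ℂ) → (Fin 19 → ℂ)} {A : ℤ → ℤ → ℤ → Fin 19 → ℂ}

lemma Cof.swc (C : Cof F A) (n r m : ℤ) (i : Fin 19) : A n r m i = - A m r n i.rev := by
  have : A n r m = fun i => - A m r n i.rev := by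
    refine pv_inj (j := 18) fun y => ?_
    rw [C.sw, pv_one]
    simp only [pv, ← Finset.sum_neg_distrib]
    rw [← Equiv.sum_comp Fin.revPerm]
    refine Finset.sum_congr rfl fun l _ => ?_
    simp only [Fin.revPerm_apply, Fin.val_rev, one_pow, mul_one]
    have : 18 - (18 + 1 - ((l:ℕ) + 1)) = (l:ℕ) := by omega
    rw [this]; ring
  rw [this]

lemma Cof.negc (C : Cof F A) (n r m : ℤ) (i : Fin 19) : A n r m i = (-1) ^ (i:ℕ) * A n (-r) m i := by
  have : A n r m = fun i : Fin 19 => (-1) ^ (i : ℕ) * A n (-r) m i := by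
    refine pv_inj (j := 18) fun y => ?_
    rw [C.neg, pv_one]
    simp only [pv]
    refine Finset.sum_congr rfl fun l _ => ?_
    have h1 : (-1:ℂ) ^ (18 - (l:ℕ)) = (-1) ^ (l:ℕ) := by
      have : (-1:ℂ) ^ (18 - (l:ℕ)) * (-1) ^ (l:ℕ) = 1 := by
        rw [← pow_add, Nat.sub_add_cancel (by omega)]; norm_num
      rcases neg_one_pow_eq_or ℂ (l:ℕ) with h | h <;> rw [h] at this ⊢
      · simpa using this
      · linear_combination -this
    rw [h1]; ring
  rw [this]

lemma Cof.shc (C : Cof F A) (n r m : ℤ) (i0 : Fin 19) (hw : ∀ i, i0 < i → ∀ n r, A n r m i = 0) :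
    A n r m i0 = - A (n + r + m) (r + 2 * m) m i0 := by
  refine top_coef (A n r m) (fun i => - A (n + r + m) (r + 2 * m) m i) (-1) i0 (fun i hi => by simp [hw i hi]) ?_
  intro y
  have := C.sh n r m 1 y
  rw [pv_one, pv_one] at this
  rw [this, ← Finset.sum_neg_distrib]
  refine Finset.sum_congr rfl fun l _ => ?_
  rw [← sub_eq_add_neg]; ring

lemma Cof.shk (C : Cof F A) (n r m : ℤ) (k : ℕ) (x y : ℂ) : pv (j := 18) (A n r m) x y = 
    (-1) ^ k * pv (j := 18) (A (n + r * k + m * k ^ 2) (r + 2 * m * k) m) x (y - k * x) := by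
  induction k with
  | zero => simp
  | succ k ih =>
    rw [ih, C.sh]
    have e1 : n + r * k + m * k ^ 2 + (r + 2 * m * k) + m = n + r * ((k+1 : ℕ) : ℤ) + m * ((k+1:ℕ):ℤ)^2 := by push_cast; ring
    have e2 : r + 2 * m * k + 2 * m = r + 2 * m * ((k+1:ℕ):ℤ) := by push_cast; ring
    have e3 : y - k * x - x = y - ((k+1:ℕ):ℂ) * x := by push_cast; ring
    rw [e1, e2, e3]; ring

lemma Cof.shz (C : Cof F A) {n r m k : ℤ} (h : A (n + r * k + m * k ^ 2) (r + 2 * m * k) m = 0) : A n r m = 0 := by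
  have z : ∀ x y, pv (j := 18) (0 : Fin 19 → ℂ) x y = 0 := by intro x y; simp [pv]
  obtain ⟨k, rfl | rfl⟩ := k.eq_nat_or_neg
  · refine pv_inj (j := 18) fun y => ?_
    rw [C.shk n r m k, h, z, z, mul_zero]
  · refine pv_inj (j := 18) fun y => ?_
    have := C.shk (n + r * (-k) + m * (-k) ^ 2) (r + 2 * m * (-k)) m k 1 (y + k)
    have e1 : n + r * (-k) + m * (-k) ^ 2 + (r + 2 * m * (-k)) * k + m * k ^ 2 = n := by ring
    have e2 : r + 2 * m * (-k) + 2 * m * k = r := by ring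
    rw [h, z, e1, e2] at this
    rw [z]
    have h2 : y + (k:ℂ) - k * 1 = y := by ring
    rw [h2] at this
    have := mul_eq_zero.1 this.symm
    exact this.resolve_left (pow_ne_zero _ (by norm_num))

lemma Cof.bnd (C : Cof F A) : ∃ K : ℝ, ∀ n r m i, ‖A n r m i‖ ≤ K * Real.exp (Real.pi * (n + m)) := by
  have hm : tm I 0 I ∈ H2 := by rw [tm_mem]; simp
  have : ∀ i, ∃ K : ℝ, 0 ≤ K ∧ ∀ n r m, ‖A n r m i‖ ≤ K * Real.exp (Real.pi * (n + m)) := by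
    intro i
    have hs := (C.sum _ _ _ hm i).summable.norm
    refine ⟨∑' p : ℤ × ℤ × ℤ, ‖A p.1 p.2.1 p.2.2 i * EE p I 0 I‖, tsum_nonneg fun _ => norm_nonneg _, fun n r m => ?_⟩
    have := hs.le_tsum (n, r, m) (fun _ _ => norm_nonneg _)
    rw [norm_mul, EE, Complex.norm_exp] at this
    simp only [mul_zero, add_zero] at this
    have e : (Real.pi * I * (n * I + m * I) : ℂ).re = - (Real.pi * (n + m)) := by simp
    rw [e, Real.exp_neg, ← div_eq_mul_inv, div_le_iff₀ (Real.exp_pos _)] at this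
    exact this
  choose K hK0 hK using this
  refine ⟨∑ i, K i, fun n r m i => (hK i n r m).trans ?_⟩
  gcongr
  exact Finset.single_le_sum (fun j _ => hK0 j) (Finset.mem_univ i)

lemma Cof.koe (C : Cof F A) (n r m : ℤ) (hm : m < 0) : A n r m = 0 := by
  obtain ⟨K, hK⟩ := C.bnd
  refine pv_inj (j := 18) fun y => ?_
  have z : pv (j := 18) (0 : Fin 19 → ℂ) 1 y = 0 := by simp [pv]
  rw [z]
  have hK0 : 0 ≤ K := by
    have := (norm_nonneg _).trans (hK 0 0 0 0)
    simpa using this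
  have hb : ∀ k : ℕ, |r| + 1 ≤ k → ‖pv (j := 18) (A n r m) 1 y‖ ≤ 
      (19 * K * Real.exp (Real.pi * (n + m) + (1 + ‖y‖))) * ((1 + ‖y‖ + k) ^ 18 * Real.exp (-(1 + ‖y‖ + k))) := by
    intro k hk
    rw [C.shk n r m k, norm_mul, norm_pow, norm_neg, norm_one, one_pow, one_mul, pv_one]
    refine (norm_sum_le _ _).trans ?_
    have : ∀ l ∈ (Finset.univ : Finset (Fin 19)), ‖A (n + r * k + m * k ^ 2) (r + 2 * m * k) m l * (y - k * 1) ^ (l:ℕ)‖ ≤ 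
        (K * Real.exp (Real.pi * (n + m) + (1 + ‖y‖))) * ((1 + ‖y‖ + k) ^ 18 * Real.exp (-(1 + ‖y‖ + k))) := by
      intro l _
      rw [norm_mul, norm_pow]
      have h1 : ‖y - k * 1‖ ≤ 1 + ‖y‖ + k := by
        refine (norm_sub_le _ _).trans ?_
        simp
      have h2 : ‖y - k * 1‖ ^ (l:ℕ) ≤ (1 + ‖y‖ + k) ^ 18 := by
        refine (pow_le_pow_left₀ (norm_nonneg _) h1 _).trans ?_
        refine pow_le_pow_right₀ ?_ (by omega)
        have := norm_nonneg y
        have : (0:ℝ) ≤ k := Nat.cast_nonneg k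
        linarith
      have h3 : ‖A (n + r * k + m * k ^ 2) (r + 2 * m * k) m l‖ ≤ K * (Real.exp (Real.pi * (n + m) + (1 + ‖y‖)) * Real.exp (-(1 + ‖y‖ + k))) := by
        refine (hK _ _ _ _).trans ?_
        rw [← Real.exp_add]
        gcongr
        have h4 : n + r * k + m * k ^ 2 ≤ n - k := by
          have := le_abs_self r
          have hk0 : (0:ℤ) ≤ k := Int.natCast_nonneg k
          have a1 : r * k ≤ (k - 1) * k := mul_le_mul_of_nonneg_right (by linarith) hk0
          have a2 : m * (k:ℤ) ^ 2 ≤ (-1) * (k:ℤ) ^ 2 := mul_le_mul_of_nonneg_right (by omega) (sq_nonneg _)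
          nlinarith
        have h5 : ((n + r * k + m * k ^ 2 : ℤ) : ℝ) ≤ n - k := by exact_mod_cast h4
        have hk1 : (0:ℝ) ≤ k := Nat.cast_nonneg k
        have h7 := mul_le_mul_of_nonneg_left h5 Real.pi_pos.le
        have h8 := mul_le_mul_of_nonneg_right (show (1:ℝ) ≤ Real.pi by linarith [Real.pi_gt_three]) hk1
        linarith
      calc _ ≤ (K * (Real.exp (Real.pi * (n + m) + (1 + ‖y‖)) * Real.exp (-(1 + ‖y‖ + k)))) * (1 + ‖y‖ + k) ^ 18 :=
            mul_le_mul h3 h2 (by positivity) (by positivity)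
        _ = _ := by ring
    refine (Finset.sum_le_sum this).trans (le_of_eq ?_)
    simp
    ring
  have ht : Tendsto (fun k : ℕ => (19 * K * Real.exp (Real.pi * (n + m) + (1 + ‖y‖))) * ((1 + ‖y‖ + k) ^ 18 * Real.exp (-(1 + ‖y‖ + k)))) atTop (𝓝 0) := by
    rw [← mul_zero (19 * K * Real.exp (Real.pi * (n + m) + (1 + ‖y‖)))]
    refine Tendsto.const_mul _ ?_
    exact (Real.tendsto_pow_mul_exp_neg_atTop_nhds_zero 18).comp (tendsto_atTop_add_const_left _ _ tendsto_natCast_atTop_atTop)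
  have := ge_of_tendsto ht (b := ‖pv (j := 18) (A n r m) 1 y‖) (by
    filter_upwards [eventually_ge_atTop (|r| + 1).toNat] with k hk
    exact hb k (Int.toNat_le.1 hk))
  exact norm_le_zero_iff.1 this

lemma Cof.pos (C : Cof F A) {n r m : ℤ} (h : A n r m ≠ 0) : 1 ≤ n ∧ 1 ≤ m := by
  have key : ∀ n r m, A n r m ≠ 0 → 1 ≤ m := by
    intro n r m h
    by_contra hm
    obtain ⟨-, -, k, hk⟩ := C.odd n r m h
    exact h (C.koe n r m (by omega))
  refine ⟨key m r n ?_, key n r m h⟩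
  intro h0
  apply h
  funext i
  rw [C.swc, h0]; simp
end

/-! ### Vanishing of theta functions with a high order zero -/

def UU (q ζ : ℂ) : ℂ := ∏' n : ℕ, (1 + -(q ^ n * ζ))

lemma UU_sum {q : ℂ} (hq : ‖q‖ < 1) (ζ : ℂ) : Summable fun n : ℕ => ‖-(q ^ n * ζ)‖ := by
  simp only [norm_neg, norm_mul, norm_pow]
  exact (summable_geometric_of_lt_one (norm_nonneg _) hq).mul_right _

lemma UU_eq {q : ℂ} (hq : ‖q‖ < 1) (ζ : ℂ) : UU q ζ = (1 - ζ) * UU q (q * ζ) := by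
  have h1 : ∀ n : ℕ, 1 + -(q ^ (n+1) * ζ) = 1 + -(q ^ n * (q * ζ)) := by intro n; ring
  rw [UU, tprod_eq_zero_mul']
  · simp only [h1, UU]; simp [sub_eq_add_neg]
  · simp only [h1]
    exact multipliable_one_add_of_summable (UU_sum hq _)

lemma UU_zero {q ζ : ℂ} (hq : ‖q‖ < 1) (h : UU q ζ = 0) : ∃ n : ℕ, q ^ n * ζ = 1 := by
  by_contra! hc
  refine tprod_one_add_ne_zero_of_summable (f := fun n : ℕ => -(q ^ n * ζ)) (fun n hn => hc n ?_) (UU_sum hq ζ) h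
  linear_combination -hn

lemma UU_diff {q : ℂ} (hq : ‖q‖ < 1) : Differentiable ℂ (UU q) := by
  intro z
  have hd : DifferentiableOn ℂ (UU q) (Metric.ball 0 (‖z‖ + 1)) := by
    have := Summable.hasProdLocallyUniformlyOn_nat_one_add (R := ℂ) (f := fun n ζ => -(q ^ n * ζ)) (K := Metric.ball (0:ℂ) (‖z‖ + 1))
      Metric.isOpen_ball (u := fun n => ‖q‖ ^ n * (‖z‖ + 1))
      ((summable_geometric_of_lt_one (norm_nonneg _) hq).mul_right _)
      (.of_forall fun n x hx => by
        rw [norm_neg, norm_mul, norm_pow]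
        have : ‖x‖ < ‖z‖ + 1 := by simpa using hx
        gcongr) (fun n => by fun_prop)
    refine this.differentiableOn (Eventually.of_forall fun t => ?_) Metric.isOpen_ball
    have h2 : DifferentiableOn ℂ (fun x => ∏ n ∈ t, (1 + -(q ^ n * x))) (Metric.ball (0:ℂ) (‖z‖ + 1)) :=
      DifferentiableOn.fun_finsetProd (fun _ _ => by fun_prop)
    exact h2
  exact (hd z (by simp)).differentiableAt (Metric.isOpen_ball.mem_nhds (by simp))

/-- the basic theta function with simple zeros at the lattice -/
lemma exists_theta (τ : ℂ) (hτ : 0 < τ.im) : ∃ P : ℂ → ℂ, Differentiable ℂ P ∧ (∀ z, P (z + 1) = - P z) ∧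
    (∀ z, P (z + τ) = - cexp (-(Real.pi * I * (τ + 2 * z))) * P z) ∧
    (∀ z, P z = 0 → ∃ a b : ℤ, z = a + b * τ) ∧ P 0 = 0 ∧ ∃ c, c ≠ 0 ∧ HasDerivAt P c 0 := by
  set q := cexp (2 * Real.pi * I * τ) with hqd
  have hq : ‖q‖ < 1 := by
    rw [hqd, Complex.norm_exp, Real.exp_lt_one_iff]
    have : (2 * Real.pi * I * τ : ℂ).re = -(2 * Real.pi * τ.im) := by simp
    rw [this]
    have := Real.pi_pos
    have : 0 < 2 * Real.pi * τ.im := by positivity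
    linarith
  have hq0 : q ≠ 0 := Complex.exp_ne_zero _
  have d := UU_diff hq
  have hperZ : ∀ z : ℂ, cexp (2 * Real.pi * I * (z + 1)) = cexp (2 * Real.pi * I * z) := by
    intro z; rw [mul_add, mul_one, Complex.exp_add, Complex.exp_two_pi_mul_I, mul_one]
  have hpi : cexp (-(Real.pi * I)) = -1 := by rw [Complex.exp_neg, Complex.exp_pi_mul_I]; norm_num
  have hz : ∀ z : ℂ, UU q (cexp (2 * Real.pi * I * z)) = 0 → ∃ a b : ℤ, z = a + b * τ := by
    intro z h
    obtain ⟨n, hn⟩ := UU_zero hq h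
    rw [hqd, ← Complex.exp_nat_mul, ← Complex.exp_add, Complex.exp_eq_one_iff] at hn
    obtain ⟨a, ha⟩ := hn
    refine ⟨a, -n, ?_⟩
    have := Complex.two_pi_I_ne_zero
    refine mul_left_cancel₀ this ?_
    push_cast
    linear_combination ha
  refine ⟨fun z => cexp (-(Real.pi * I * z)) * UU q (cexp (2 * Real.pi * I * z)) * UU q (cexp (2 * Real.pi * I * (τ - z))), ?_, ?_, ?_, ?_, ?_, ?_⟩
  · fun_prop
  · intro z
    beta_reduce
    have e1 : τ - z = τ - (z + 1) + 1 := by ring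
    rw [hperZ, e1, hperZ, mul_add, neg_add, Complex.exp_add, mul_one, hpi]
    ring
  · intro z
    beta_reduce
    have e1 : τ - (z + τ) = - z := by ring
    have e2 : cexp (2 * Real.pi * I * (z + τ)) = q * cexp (2 * Real.pi * I * z) := by
      rw [hqd, ← Complex.exp_add]; ring_nf
    have e3 : cexp (2 * Real.pi * I * (τ - z)) = q * cexp (2 * Real.pi * I * (-z)) := by
      rw [hqd, ← Complex.exp_add]; ring_nf
    have e4 : cexp (-(Real.pi * I * (z + τ))) * cexp (2 * Real.pi * I * (z)) = cexp (-(Real.pi * I * (τ + 2 * z))) * cexp (-(Real.pi * I * z)) * cexp (2 * Real.pi * I * z) ^ 2 := by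
      rw [← Complex.exp_nat_mul, ← Complex.exp_add, ← Complex.exp_add, ← Complex.exp_add]; push_cast; ring_nf
    have e5 : cexp (2 * Real.pi * I * z) * cexp (2 * Real.pi * I * (-z)) = 1 := by
      rw [← Complex.exp_add]; simp
    have e6 : cexp (-(Real.pi * I * (z + τ))) = cexp (-(Real.pi * I * (τ + 2 * z))) * cexp (-(Real.pi * I * z)) * cexp (2 * Real.pi * I * z) := by
      rw [← Complex.exp_add, ← Complex.exp_add]; ring_nf
    rw [e1, e2, e3, UU_eq hq (cexp (2 * Real.pi * I * (-z))), UU_eq hq (cexp (2 * Real.pi * I * z)), e6]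
    linear_combination (-cexp (-(Real.pi * I * (τ + 2 * z))) * cexp (-(Real.pi * I * z)) * UU q (q * cexp (2 * Real.pi * I * z)) * UU q (q * cexp (2 * Real.pi * I * (-z)))) * e5
  · intro z h
    rcases mul_eq_zero.1 h with h | h
    · rcases mul_eq_zero.1 h with h | h
      · exact absurd h (Complex.exp_ne_zero _)
      · exact hz z h
    · obtain ⟨a, b, e⟩ := hz _ h
      refine ⟨-a, 1 - b, ?_⟩
      push_cast
      linear_combination -e
  · simp [UU_eq hq 1]
  · have hne : UU q q ≠ 0 := by
      intro h
      obtain ⟨n, hn⟩ := UU_zero hq h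
      have : ‖q ^ n * q‖ < 1 := by
        rw [← pow_succ, norm_pow]
        exact pow_lt_one₀ (norm_nonneg _) hq (by simp)
      rw [hn] at this; simp at this
    have hR : Differentiable ℂ (fun z => cexp (-(Real.pi * I * z)) * UU q (q * cexp (2 * Real.pi * I * z)) * UU q (cexp (2 * Real.pi * I * (τ - z)))) := by fun_prop
    have h1 : HasDerivAt (fun z : ℂ => 1 - cexp (2 * Real.pi * I * z)) (-(2 * Real.pi * I)) 0 := by
      have : HasDerivAt (fun z : ℂ => 2 * Real.pi * I * z) (2 * Real.pi * I) 0 := by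
        simpa using (hasDerivAt_id (0:ℂ)).const_mul (2 * Real.pi * I)
      simpa using (this.cexp).const_sub 1
    have h2 := h1.mul (hR 0).hasDerivAt
    refine ⟨-(2 * Real.pi * I) * (UU q q * UU q q), mul_ne_zero (neg_ne_zero.2 Complex.two_pi_I_ne_zero) (mul_ne_zero hne hne), ?_⟩
    have h3 := h2.congr_deriv (g' := -(2 * Real.pi * I) * (UU q q * UU q q)) (by simp [← hqd])
    refine h3.congr_of_eventuallyEq (.of_forall fun z => ?_)
    beta_reduce
    rw [UU_eq hq (cexp (2 * Real.pi * I * z))]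
    simp only [Pi.mul_apply]
    ring

lemma lattice_ind (τ : ℂ) {Q : ℂ → Prop} (h1 : ∀ z, Q z ↔ Q (z + 1)) (h2 : ∀ z, Q z ↔ Q (z + τ)) (a b : ℤ) (z : ℂ) :
    Q z ↔ Q (z + (a + b * τ)) := by
  have A : ∀ a : ℤ, ∀ z, Q z ↔ Q (z + a) := by
    intro a
    induction a using Int.induction_on with
    | zero => simp
    | succ i ih => intro z; rw [ih, h1]; push_cast; rw [add_assoc]
    | pred i ih => intro z; rw [ih, h1 (z + ((-(i:ℤ) - 1 : ℤ):ℂ))]; push_cast; ring_nf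
  have B : ∀ b : ℤ, ∀ z, Q z ↔ Q (z + b * τ) := by
    intro b
    induction b using Int.induction_on with
    | zero => simp
    | succ i ih => intro z; rw [ih, h2]; push_cast; ring_nf
    | pred i ih => intro z; rw [ih, h2 (z + ((-(i:ℤ) - 1 : ℤ):ℂ) * τ)]; push_cast; ring_nf
  rw [A a, B b, add_assoc]

lemma theta_vanish (τ : ℂ) (hτ : 0 < τ.im) (m : ℕ) (hm : Odd m) (f : ℂ → ℂ) (hf : Differentiable ℂ f)
    (h1 : ∀ z, f (z + 1) = - f z) (h2 : ∀ z, f (z + τ) = - cexp (-(Real.pi * I * m * (τ + 2 * z))) * f z)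
    (h0 : Tendsto (fun z => f z / z ^ m) (𝓝[≠] 0) (𝓝 0)) (z : ℂ) : f z = 0 := by
  obtain ⟨P, dP, P1, P2, Pz, P0, c, hc, Pd⟩ := exists_theta τ hτ
  have hm0 : m ≠ 0 := by rintro rfl; simp at hm
  set k : ℂ → ℂ := fun z => f z / P z ^ m with hk
  have k1 : ∀ z, k (z + 1) = k z := by
    intro z; simp only [hk]; rw [h1, P1, hm.neg_pow, neg_div_neg_eq]
  have k2 : ∀ z, k (z + τ) = k z := by
    intro z; simp only [hk]
    have e : cexp (-(Real.pi * I * m * (τ + 2 * z))) = cexp (-(Real.pi * I * (τ + 2 * z))) ^ m := by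
      rw [← Complex.exp_nat_mul]; ring_nf
    rw [h2, P2, mul_pow, hm.neg_pow, e]
    exact mul_div_mul_left _ _ (neg_ne_zero.2 (pow_ne_zero _ (Complex.exp_ne_zero _)))
  have kd1 : ∀ z, P z ≠ 0 → DifferentiableAt ℂ k z := fun z hz => 
    (hf z).div ((dP z).pow m) (pow_ne_zero _ hz)
  have hs : Tendsto (fun z => P z / z) (𝓝[≠] 0) (𝓝 c) := by
    have := hasDerivAt_iff_tendsto_slope.1 Pd
    refine this.congr fun z => ?_
    simp [slope, P0, div_eq_inv_mul]
  have hk0 : ContinuousAt k 0 := by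
    rw [continuousAt_iff_punctured_nhds]
    have e0 : k 0 = 0 := by simp [hk, P0, hm0]
    rw [e0]
    have := h0.div (hs.pow m) (pow_ne_zero _ hc)
    rw [zero_div] at this
    refine this.congr' ?_
    filter_upwards [self_mem_nhdsWithin] with z hz
    have hz : z ≠ 0 := hz
    simp only [hk, Pi.div_apply]
    rw [div_pow, div_div_div_cancel_right₀ (pow_ne_zero _ hz)]
  have kd0 : DifferentiableAt ℂ k 0 := by
    have hev : ∀ᶠ z in 𝓝[≠] (0:ℂ), P z ≠ 0 := by
      filter_upwards [hs.eventually_ne hc] with z hz h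
      simp [h] at hz
    rw [eventually_nhdsWithin_iff] at hev
    obtain ⟨s, hs1, hs2, hs3⟩ := eventually_nhds_iff.1 hev
    have := (Complex.differentiableOn_compl_singleton_and_continuousAt_iff (f := k) (hs2.mem_nhds hs3)).1
      ⟨fun z hz => (kd1 z (hs1 z hz.1 hz.2)).differentiableWithinAt, hk0⟩
    exact this.differentiableAt (hs2.mem_nhds hs3)
  have tr : ∀ w : ℂ, (∀ z, k (z + w) = k z) → ∀ z, DifferentiableAt ℂ k z ↔ DifferentiableAt ℂ k (z + w) := by
    intro w hw z
    rw [← differentiableAt_comp_add_const (f := k)]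
    simp only [hw]
  have kd : Differentiable ℂ k := by
    intro z
    by_cases hz : P z = 0
    · obtain ⟨a, b, rfl⟩ := Pz z hz
      have := (lattice_ind τ (Q := fun z => DifferentiableAt ℂ k z) (tr 1 k1) (tr τ k2) a b 0).1 kd0
      simpa using this
    · exact kd1 z hz
  have kb : Bornology.IsBounded (Set.range k) := by
    have hK : IsCompact ((fun p : ℝ × ℝ => k (p.1 + p.2 * τ)) '' (Set.Icc 0 1 ×ˢ Set.Icc 0 1)) := by
      refine (isCompact_Icc.prod isCompact_Icc).image ?_
      exact kd.continuous.comp (by fun_prop)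
    refine hK.isBounded.subset ?_
    rintro _ ⟨z, rfl⟩
    set t := z.im / τ.im
    set s := z.re - t * τ.re
    have hz : z = s + t * τ := by
      apply Complex.ext
      · simp [s]
      · simp [t, hτ.ne']
    refine ⟨(Int.fract s, Int.fract t), ⟨⟨Int.fract_nonneg _, (Int.fract_lt_one _).le⟩, Int.fract_nonneg _, (Int.fract_lt_one _).le⟩, ?_⟩
    have := (lattice_ind τ (Q := fun w => k w = k z) (fun w => by rw [k1]) (fun w => by rw [k2]) ⌊s⌋ ⌊t⌋ (Int.fract s + Int.fract t * τ)).2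
    refine this ?_
    congr 1
    have e1 : (⌊s⌋ : ℂ) + ((Int.fract s : ℝ) : ℂ) = s := by rw [← Complex.ofReal_intCast, ← Complex.ofReal_add, Int.floor_add_fract]
    have e2 : (⌊t⌋ : ℂ) + ((Int.fract t : ℝ) : ℂ) = t := by rw [← Complex.ofReal_intCast, ← Complex.ofReal_add, Int.floor_add_fract]
    linear_combination e1 + τ * e2 - hz
  have hconst : k z = k 0 := kd.apply_eq_apply_of_bounded kb z 0
  have e0 : k 0 = 0 := by simp [hk, P0, hm0]
  rw [e0] at hconst
  rcases div_eq_zero_iff.1 hconst with h | h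
  · exact h
  · obtain ⟨a, b, rfl⟩ := Pz z (pow_eq_zero_iff hm0 |>.1 h)
    have f0 : f 0 = 0 := by
      have l1 : Tendsto f (𝓝[≠] 0) (𝓝 (f 0)) := hf.continuous.continuousAt.tendsto.mono_left nhdsWithin_le_nhds
      have l2 : Tendsto (fun z : ℂ => f z / z ^ m * z ^ m) (𝓝[≠] 0) (𝓝 (0 * 0 ^ m)) :=
        h0.mul ((continuous_pow m).continuousAt.tendsto.mono_left nhdsWithin_le_nhds)
      rw [zero_mul] at l2
      refine tendsto_nhds_unique (l1.congr' ?_) l2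
      filter_upwards [self_mem_nhdsWithin] with z hz
      have hz : z ≠ 0 := hz
      field_simp
    have := (lattice_ind τ (Q := fun w => f w = 0) (fun w => by rw [h1, neg_eq_zero]) (fun w => by rw [h2]; simp [Complex.exp_ne_zero]) a b 0).1 f0
    simpa using this

/-! ### Level one modular forms with character -/

open scoped MatrixGroups ModularForm UpperHalfPlane in
/-- building a modular form of level one -/
lemma exists_mf (w M : ℕ) (G : ℍ → ℂ) (Φ : ℂ → ℂ) (hΦ : DifferentiableOn ℂ Φ (Metric.ball 0 1))
    (hG : ∀ z : ℍ, G z = Function.Periodic.qParam 1 z ^ M * Φ (Function.Periodic.qParam 1 z))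
    (hS : ∀ z : ℍ, G (UpperHalfPlane.mk _ z.im_inv_neg_coe_pos) = (z:ℂ) ^ w * G z) (hne : ∃ z, G z ≠ 0) :
    12 * M ≤ w ∧ (0 < M → w ≠ 14) := by
  set c : ℕ → ℂ := fun n => (n.factorial : ℂ)⁻¹ * iteratedDeriv n Φ 0 with hc
  set C : ℕ → ℂ := fun m => if m < M then 0 else c (m - M) with hC
  have hq1 : ∀ z : ℍ, Function.Periodic.qParam 1 (z:ℂ) ∈ Metric.ball (0:ℂ) 1 := fun z => by
    simpa using Function.Periodic.norm_qParam_lt_one one_pos z.im_pos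
  have hsum : ∀ z : ℍ, HasSum (fun m => C m • Function.Periodic.qParam 1 z ^ m) (G z) := by
    intro z
    have h1 := Complex.hasSum_taylorSeries_on_ball hΦ (hq1 z)
    have h2 := h1.mul_left (Function.Periodic.qParam 1 (z:ℂ) ^ M)
    rw [← hG] at h2
    have h3 := hasSum_nat_add_iff (f := fun m => C m • Function.Periodic.qParam 1 (z:ℂ) ^ m) (g := G z) M
    rw [Finset.sum_eq_zero, add_zero] at h3
    · refine h3.1 (h2.congr_fun fun n => ?_)
      simp only [hC, hc, smul_eq_mul, sub_zero]
      rw [if_neg (by omega), Nat.add_sub_cancel, pow_add]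
      ring
    · intro i hi
      simp only [hC]
      rw [if_pos (by simpa using hi), zero_smul]
  have hT : G ∣[(w:ℤ)] ModularGroup.T = G := by
    ext z
    rw [ModularForm.SL_slash_apply, UpperHalfPlane.modular_T_smul]
    have : UpperHalfPlane.denom (ModularGroup.T : GL (Fin 2) ℝ) z = 1 := by
      rw [ModularGroup.denom_apply]; simp [ModularGroup.T]
    rw [this, _root_.one_zpow, mul_one, hG, hG]
    have : Function.Periodic.qParam 1 (((1:ℝ) +ᵥ z : ℍ) : ℂ) = Function.Periodic.qParam 1 (z : ℂ) := by
      simp only [Function.Periodic.qParam, UpperHalfPlane.coe_vadd, ofReal_one, div_one]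
      rw [mul_add, Complex.exp_add, mul_one, Complex.exp_two_pi_mul_I, one_mul]
    rw [this]
  have hS' : G ∣[(w:ℤ)] ModularGroup.S = G := by
    ext z
    rw [ModularForm.SL_slash_apply, UpperHalfPlane.modular_S_smul, hS, ModularGroup.denom_S, _root_.zpow_neg, zpow_natCast]
    have := z.ne_zero
    field_simp
  have hinv := fun γ => SlashInvariantForm.slash_action_generators_SL2Z hS' hT γ
  have hbd : UpperHalfPlane.IsBoundedAtImInfty G := UpperHalfPlane.isBoundedAtImInfty_of_hasSum_qExpansion one_pos hsum
  let f : ModularForm 𝒮ℒ (w:ℤ) :=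
    { toFun := G
      slash_action_eq' := fun A hA => by
        obtain ⟨A, rfl⟩ := hA
        exact hinv A
      holo' := by
        rw [UpperHalfPlane.mdifferentiable_iff]
        have hd : DifferentiableOn ℂ (fun z : ℂ => Function.Periodic.qParam 1 z ^ M * Φ (Function.Periodic.qParam 1 z)) UpperHalfPlane.upperHalfPlaneSet := by
          have h0 : Differentiable ℂ (Function.Periodic.qParam 1) := Function.Periodic.differentiable_qParam
          refine (h0.pow M).differentiableOn.mul (hΦ.comp h0.differentiableOn fun z hz => ?_)
          exact hq1 ⟨z, hz⟩
        refine hd.congr fun z hz => ?_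
        simp only [Function.comp]
        rw [UpperHalfPlane.ofComplex_apply_of_im_pos hz]
        exact hG ⟨z, hz⟩
      bdd_at_cusps' := fun {c} hc => by
        rw [Subgroup.IsArithmetic.isCusp_iff_isCusp_SL2Z] at hc
        rw [OnePoint.isBoundedAt_iff_forall_SL2Z hc]
        intro γ _
        rw [hinv γ]
        exact hbd }
  have hf0 : f ≠ 0 := by
    intro h
    obtain ⟨z, hz⟩ := hne
    exact hz (DFunLike.congr_fun h z)
  have hco : ∀ m, C m = (UpperHalfPlane.qExpansion 1 f).coeff m :=
    ModularFormClass.qExpansion_coeff_unique one_pos one_mem_strictPeriods_SL (f := f) hsum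
  constructor
  · by_contra hlt
    refine hf0 (ModularForm.sturm_bound_levelOne_nat (lt_of_lt_of_le (b := (M:ℕ∞)) ?_ ?_))
    · exact_mod_cast (by omega : w / 12 < M)
    · refine PowerSeries.nat_le_order _ _ fun i hi => ?_
      rw [← hco]; simp [hC, hi]
  · rintro hM rfl
    have h0 : (UpperHalfPlane.qExpansion 1 f).coeff 0 = 0 := by rw [← hco]; simp [hC, hM]
    have h2 := rank_zero_iff_forall_zero.1 ModularForm.levelOne_weight_two_rank_zero (CuspForm.discriminantEquiv (ModularForm.toCuspForm f h0))
    refine hf0 (DFunLike.ext _ _ fun z => ?_)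
    have h3 := ModularForm.discriminant_mul_discriminantEquiv_apply (ModularForm.toCuspForm f h0) z
    rw [h2] at h3
    have h4 : (0:ℂ) = f z := by simpa using h3
    exact h4.symm

lemma eta12 {z : ℂ} (hz : 0 < z.im) : ModularForm.eta (-1 / z) ^ 12 = - (z ^ 6 * ModularForm.eta z ^ 12) := by
  have h := ModularForm.eta_comp_eq_csqrt_I_inv (show z ∈ UpperHalfPlane.upperHalfPlaneSet from hz)
  simp only [Function.comp, Pi.smul_apply, Pi.mul_apply, smul_eq_mul] at h
  have hs : ∀ x : ℂ, Complex.sqrt x ^ 12 = x ^ 6 := by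
    intro x
    rw [show 12 = 2 * 6 by norm_num, pow_mul, Complex.sqrt, ← Complex.cpow_nat_mul]; simp
  rw [h, mul_pow, mul_pow, inv_pow, hs, hs]
  have : (I ^ 6)⁻¹ = -1 := by rw [show 6 = 2 * 3 by norm_num, pow_mul, I_sq]; norm_num
  rw [this]; ring

lemma modM (k N : ℕ) (hN : Odd N) (β : ℕ → ℂ) (g : ℂ → ℂ)
    (hs : ∀ τ : ℂ, 0 < τ.im → HasSum (fun j : ℕ => β j * cexp (Real.pi * I * ((N + 2 * j) * τ))) (g τ))
    (hS : ∀ τ : ℂ, 0 < τ.im → g (-1 / τ) = - τ ^ k * g τ) (hne : ∃ τ, 0 < τ.im ∧ g τ ≠ 0) : 6 * N ≤ k ∧ k ≠ 8 := by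
  have hx : ∀ (τ : ℂ) (j : ℕ), cexp (Real.pi * I * ((N + 2 * j) * τ)) = cexp (Real.pi * I * (N * τ)) * Function.Periodic.qParam 1 τ ^ j := by
    intro τ j
    rw [Function.Periodic.qParam, ← Complex.exp_nat_mul, ← Complex.exp_add]
    simp only [ofReal_one, div_one]; ring_nf
  have hs2 : ∀ τ : ℂ, 0 < τ.im → HasSum (fun j : ℕ => β j * Function.Periodic.qParam 1 τ ^ j) (cexp (-(Real.pi * I * (N * τ))) * g τ) := by
    intro τ hτ
    refine ((hs τ hτ).mul_left (cexp (-(Real.pi * I * (N * τ))))).congr_fun fun j => ?_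
    rw [hx, Complex.exp_neg]
    have := Complex.exp_ne_zero (Real.pi * I * (N * τ))
    field_simp
  have hsq : ∀ q : ℂ, ‖q‖ < 1 → q ≠ 0 → Summable (fun j : ℕ => β j * q ^ j) := by
    intro q hq hq0
    have := (hs2 _ (Function.Periodic.im_invQParam_pos_of_norm_lt_one one_pos hq hq0)).summable
    simpa [Function.Periodic.qParam_right_inv one_ne_zero hq0] using this
  have hH : DifferentiableOn ℂ (fun q : ℂ => ∑' j : ℕ, β j * q ^ j) (Metric.ball 0 1) := by
    intro q hq
    obtain ⟨r, hr1, hr2⟩ := exists_between (mem_ball_zero_iff.1 hq)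
    have hr0 : 0 < r := (norm_nonneg _).trans_lt hr1
    have hr : DifferentiableOn ℂ (fun q : ℂ => ∑' j : ℕ, β j * q ^ j) (Metric.ball 0 r) := by
      refine differentiableOn_tsum_of_summable_norm (u := fun j => ‖β j * (r:ℂ) ^ j‖) ?_ (fun j => by fun_prop) Metric.isOpen_ball ?_
      · exact (hsq r (by simpa [abs_of_pos hr0] using hr2) (by exact_mod_cast hr0.ne')).norm
      · intro j w hw
        have hw : ‖w‖ < r := by simpa using hw
        simp only [norm_mul, norm_pow, Complex.norm_real, Real.norm_eq_abs, abs_of_pos hr0]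
        gcongr
    exact (hr.differentiableAt (Metric.isOpen_ball.mem_nhds (by simpa using hr1))).differentiableWithinAt
  obtain ⟨M, hM⟩ := hN
  have hqp : ∀ z : UpperHalfPlane, g z * ModularForm.eta z ^ 12 = Function.Periodic.qParam 1 (z:ℂ) ^ (M + 1) *
      ((∑' j : ℕ, β j * Function.Periodic.qParam 1 (z:ℂ) ^ j) * (∏' n : ℕ, (1 - Function.Periodic.qParam 1 (z:ℂ) ^ (n + 1))) ^ 12) := by
    intro z
    rw [(hs2 z z.im_pos).tsum_eq, ModularForm.eta, mul_pow]
    simp only [ModularForm.eta_q]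
    have : Function.Periodic.qParam 1 (z:ℂ) ^ (M + 1) * cexp (-(Real.pi * I * (N * z))) = Function.Periodic.qParam 24 (z:ℂ) ^ 12 := by
      simp only [Function.Periodic.qParam]
      rw [← Complex.exp_nat_mul, ← Complex.exp_nat_mul, ← Complex.exp_add, hM]
      congr 1
      push_cast
      ring
    rw [← this]; ring
  have key := exists_mf (k + 6) (M + 1) (fun z => g z * ModularForm.eta z ^ 12)
    (fun q => (∑' j : ℕ, β j * q ^ j) * (∏' n : ℕ, (1 - q ^ (n + 1))) ^ 12)
    (hH.mul (ModularForm.differentiableOn_tprod_one_sub_pow.pow 12)) hqp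
    (by
      intro z
      have e : (-(z:ℂ))⁻¹ = -1 / z := by rw [inv_neg, neg_div, one_div]
      simp only [e]
      rw [hS z z.im_pos, eta12 z.im_pos]; ring)
    (by
      obtain ⟨τ, h1, h2⟩ := hne
      exact ⟨⟨τ, h1⟩, mul_ne_zero h2 (pow_ne_zero _ (ModularForm.eta_ne_zero h1))⟩)
  constructor
  · omega
  · have := key.2 (by omega)
    omega

/-! ### Jacobi forms -/

lemma powP (C : ℕ → ℂ) (f : ℂ → ℂ) (h : ∀ z, HasSum (fun μ => C μ * z ^ μ) (f z)) (ν : ℕ) (h0 : ∀ μ < ν, C μ = 0) :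
    Tendsto (fun z => f z / z ^ ν) (𝓝[≠] 0) (𝓝 (C ν)) := by
  have h1 : ∀ z, z ≠ 0 → HasSum (fun μ => C (μ + ν) * z ^ μ) (f z / z ^ ν) := by
    intro z hz
    have h3 := hasSum_nat_add_iff (f := fun μ => C μ * z ^ μ) (g := f z) ν
    rw [Finset.sum_eq_zero, add_zero] at h3
    · refine ((h3.2 (h z)).div_const (z ^ ν)).congr_fun fun μ => ?_
      rw [pow_add]; field_simp
    · intro i hi
      rw [h0 i (by simpa using hi), zero_mul]
  have hs : Summable fun μ => ‖C (μ + ν)‖ := by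
    simpa using (h1 1 one_ne_zero).summable.norm
  have ht : Tendsto (fun z : ℂ => ∑' μ, C (μ + ν) * z ^ μ) (𝓝[≠] 0) (𝓝 (∑' μ, C (μ + ν) * (0:ℂ) ^ μ)) := by
    refine tendsto_tsum_of_dominated_convergence hs (fun μ => ?_) ?_
    · exact ((continuous_const.mul (continuous_pow μ)).tendsto 0).mono_left nhdsWithin_le_nhds
    · have : ∀ᶠ z : ℂ in 𝓝[≠] 0, z ∈ Metric.ball (0:ℂ) 1 := mem_nhdsWithin_of_mem_nhds (Metric.ball_mem_nhds 0 one_pos)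
      filter_upwards [this] with z hz μ
      rw [norm_mul, norm_pow]
      exact mul_le_of_le_one_right (norm_nonneg _) (pow_le_one₀ (norm_nonneg _) (by simpa using (mem_ball_zero_iff.1 hz).le))
  have e : ∑' μ, C (μ + ν) * (0:ℂ) ^ μ = C ν := by
    rw [tsum_eq_single 0]
    · simp
    · intro b hb; simp [hb]
  rw [e] at ht
  refine ht.congr' ?_
  filter_upwards [self_mem_nhdsWithin] with z hz
  exact (h1 z hz).tsum_eq

def jt (a : ℤ → ℤ → ℂ) (τ z : ℂ) (p : ℤ × ℤ) : ℂ := a p.1 p.2 * cexp (Real.pi * I * (p.1 * τ + p.2 * z))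

structure Jac (a : ℤ → ℤ → ℂ) (m w : ℕ) : Prop where
  odd : ∀ n r, a n r ≠ 0 → Odd n ∧ Odd r
  summ : ∀ τ z : ℂ, 0 < τ.im → Summable (jt a τ z)
  sh : ∀ n r, a n r = - a (n + r + m) (r + 2 * m)
  tr : ∀ τ z : ℂ, 0 < τ.im → ∑' p, jt a (-1 / τ) (z / τ) p = - τ ^ w * cexp (Real.pi * I * (m * z ^ 2 / τ)) * ∑' p, jt a τ z p

section
variable {a : ℤ → ℤ → ℂ} {m w : ℕ}

lemma Jac.abs (J : Jac a m w) (τ : ℂ) (hτ : 0 < τ.im) (x : ℝ) :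
    Summable fun p : ℤ × ℤ => ‖a p.1 p.2 * cexp (Real.pi * I * (p.1 * τ))‖ * Real.exp (Real.pi * |(p.2:ℝ)| * x) := by
  have h1 := (J.summ τ (x * I) hτ).norm
  have h2 := (J.summ τ (-x * I) hτ).norm
  refine Summable.of_nonneg_of_le (fun p => by positivity) (fun p => ?_) (h1.add h2)
  have e : ∀ y : ℝ, ‖jt a τ (y * I) p‖ = ‖a p.1 p.2 * cexp (Real.pi * I * (p.1 * τ))‖ * Real.exp (- (Real.pi * p.2 * y)) := by
    intro y
    rw [jt, mul_add, Complex.exp_add, ← mul_assoc, norm_mul, Complex.norm_exp (Real.pi * I * (p.2 * (y * I)))]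
    congr 2
    simp; ring
  have e2 := e (-x)
  rw [ofReal_neg] at e2
  rw [e, e2, ← mul_add]
  gcongr
  rcases abs_cases (p.2:ℝ) with ⟨h, -⟩ | ⟨h, -⟩ <;> rw [h]
  · have : -(Real.pi * p.2 * -x) = Real.pi * p.2 * x := by ring
    rw [this]
    exact le_add_of_nonneg_left (Real.exp_nonneg _)
  · have : -(Real.pi * p.2 * x) = Real.pi * -p.2 * x := by ring
    rw [this]
    exact le_add_of_nonneg_right (Real.exp_nonneg _)

lemma Jac.dbl (J : Jac a m w) (τ z : ℂ) (hτ : 0 < τ.im) :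
    Summable fun q : (ℤ × ℤ) × ℕ => a q.1.1 q.1.2 * cexp (Real.pi * I * (q.1.1 * τ)) * ((Real.pi * I * (q.1.2 * z)) ^ q.2 / q.2.factorial) := by
  rw [← summable_norm_iff]
  have hE : ∀ p : ℤ × ℤ, HasSum (fun n : ℕ => ‖a p.1 p.2 * cexp (Real.pi * I * (p.1 * τ)) * ((Real.pi * I * (p.2 * z)) ^ n / n.factorial)‖)
      (‖a p.1 p.2 * cexp (Real.pi * I * (p.1 * τ))‖ * Real.exp (Real.pi * |(p.2:ℝ)| * ‖z‖)) := by
    intro p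
    have h1 : HasSum (fun n : ℕ => (Real.pi * |(p.2:ℝ)| * ‖z‖) ^ n / n.factorial) (Real.exp (Real.pi * |(p.2:ℝ)| * ‖z‖)) := by
      rw [Real.exp_eq_exp_ℝ]
      exact NormedSpace.expSeries_div_hasSum_exp _
    refine (h1.mul_left _).congr_fun fun n => ?_
    rw [norm_mul, norm_div, norm_pow]
    congr 2
    · congr 1
      simp [abs_of_pos Real.pi_pos]; ring
    · simp
  rw [summable_prod_of_nonneg (fun _ => norm_nonneg _)]
  refine ⟨fun p => (hE p).summable, ?_⟩
  simp only [fun p => (hE p).tsum_eq]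
  exact J.abs τ hτ ‖z‖

/-- Taylor coefficients in `z` -/
def jc (a : ℤ → ℤ → ℂ) (ν : ℕ) (τ : ℂ) : ℂ := ∑' p : ℤ × ℤ, a p.1 p.2 * cexp (Real.pi * I * (p.1 * τ)) * p.2 ^ ν

def jb (a : ℤ → ℤ → ℂ) (n : ℤ) (ν : ℕ) : ℂ := ∑' r : ℤ, a n r * r ^ ν

lemma Jac.csum (J : Jac a m w) (ν : ℕ) (τ : ℂ) (hτ : 0 < τ.im) :
    Summable fun p : ℤ × ℤ => a p.1 p.2 * cexp (Real.pi * I * (p.1 * τ)) * p.2 ^ ν := by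
  have h := (J.dbl τ 1 hτ).prod_symm.prod_factor ν
  refine (h.mul_right ((ν.factorial : ℂ) / (Real.pi * I) ^ ν)).congr fun p => ?_
  have h1 : (Real.pi * I : ℂ) ≠ 0 := by simp [Real.pi_ne_zero]
  have h2 : (ν.factorial : ℂ) ≠ 0 := by exact_mod_cast ν.factorial_ne_zero
  simp only [Prod.swap, mul_one, mul_pow (Real.pi * I : ℂ)]
  field_simp

lemma swap_sum {α β : Type*} {f : α × β → ℂ} {g : α → ℂ} {h : β → ℂ} (hf : Summable f)
    (h1 : ∀ a, HasSum (fun b => f (a, b)) (g a)) (h2 : ∀ b, HasSum (fun a => f (a, b)) (h b)) : HasSum h (∑' a, g a) := by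
  rw [(hf.hasSum.prod_fiberwise h1).tsum_eq]
  have h3 : HasSum (fun q : β × α => f q.swap) (∑' q, f q) := ((Equiv.prodComm β α).hasSum_iff (f := f)).2 hf.hasSum
  exact h3.prod_fiberwise h2

lemma Jac.taylor (J : Jac a m w) (τ z : ℂ) (hτ : 0 < τ.im) :
    HasSum (fun ν : ℕ => jc a ν τ * ((Real.pi * I) ^ ν / ν.factorial) * z ^ ν) (∑' p, jt a τ z p) := by
  refine swap_sum (J.dbl τ z hτ) (fun p => ?_) (fun ν => ?_)
  · have : HasSum (fun n : ℕ => (Real.pi * I * (p.2 * z) : ℂ) ^ n / n.factorial) (cexp (Real.pi * I * (p.2 * z))) := by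
      rw [Complex.exp_eq_exp_ℂ]
      exact NormedSpace.expSeries_div_hasSum_exp _
    have e : jt a τ z p = a p.1 p.2 * cexp (Real.pi * I * (p.1 * τ)) * cexp (Real.pi * I * (p.2 * z)) := by
      rw [jt, mul_add, Complex.exp_add]; ring
    rw [e]
    have e2 := this.mul_left (a p.1 p.2 * cexp (Real.pi * I * (p.1 * τ)))
    dsimp only
    exact e2
  · have h0 : HasSum (fun p : ℤ × ℤ => a p.1 p.2 * cexp (Real.pi * I * (p.1 * τ)) * p.2 ^ ν) (jc a ν τ) := (J.csum ν τ hτ).hasSum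
    have := (h0.mul_right ((Real.pi * I : ℂ) ^ ν / ν.factorial)).mul_right (z ^ ν)
    refine this.congr_fun fun p => ?_
    simp only [mul_pow]
    ring

lemma Jac.cn (J : Jac a m w) (ν : ℕ) (τ : ℂ) (hτ : 0 < τ.im) :
    HasSum (fun n : ℤ => jb a n ν * cexp (Real.pi * I * (n * τ))) (jc a ν τ) := by
  have h := J.csum ν τ hτ
  refine h.hasSum.prod_fiberwise fun n => ?_
  have hf := h.prod_factor n
  have hs : Summable fun r : ℤ => a n r * r ^ ν := by
    refine (hf.mul_right (cexp (-(Real.pi * I * (n * τ))))).congr fun r => ?_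
    rw [Complex.exp_neg]
    have := Complex.exp_ne_zero (Real.pi * I * (n * τ))
    simp only []
    field_simp
  refine (hs.hasSum.mul_right (cexp (Real.pi * I * (n * τ)))).congr_fun fun r => ?_
  ring

lemma Jac.diff (J : Jac a m w) (τ : ℂ) (hτ : 0 < τ.im) : Differentiable ℂ fun z => ∑' p, jt a τ z p := by
  intro z
  have hd : DifferentiableOn ℂ (fun z => ∑' p, jt a τ z p) (Metric.ball 0 (‖z‖ + 1)) := by
    refine differentiableOn_tsum_of_summable_norm (J.abs τ hτ (‖z‖ + 1)) (fun p => ?_) Metric.isOpen_ball ?_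
    · unfold jt; fun_prop
    · intro p x hx
      have hx : ‖x‖ < ‖z‖ + 1 := by simpa using hx
      rw [jt, mul_add, Complex.exp_add, ← mul_assoc, norm_mul]
      gcongr
      rw [Complex.norm_exp]
      gcongr
      refine (Complex.re_le_norm _).trans ?_
      simp [abs_of_pos Real.pi_pos]
      rw [mul_assoc]
      gcongr
  exact (hd z (by simp)).differentiableAt (Metric.isOpen_ball.mem_nhds (by simp))

lemma Jac.per1 (J : Jac a m w) (τ z : ℂ) : ∑' p, jt a τ (z + 1) p = - ∑' p, jt a τ z p := by
  rw [← tsum_neg]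
  refine tsum_congr fun p => ?_
  by_cases h : a p.1 p.2 = 0
  · simp [jt, h]
  · obtain ⟨k, hk⟩ := (J.odd _ _ h).2
    have e : cexp (Real.pi * I * (p.1 * τ + p.2 * (z + 1))) = - cexp (Real.pi * I * (p.1 * τ + p.2 * z)) := by
      have : (Real.pi * I * (p.1 * τ + p.2 * (z + 1)) : ℂ) = Real.pi * I * (p.1 * τ + p.2 * z) + (k * (2 * Real.pi * I) + Real.pi * I) := by
        rw [hk]; push_cast; ring
      rw [this, Complex.exp_add, Complex.exp_add, Complex.exp_int_mul_two_pi_mul_I, Complex.exp_pi_mul_I]; ring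
    rw [jt, e, jt]; ring

lemma Jac.per2 (J : Jac a m w) (τ z : ℂ) :
    ∑' p, jt a τ (z + τ) p = - cexp (-(Real.pi * I * m * (τ + 2 * z))) * ∑' p, jt a τ z p := by
  let e : ℤ × ℤ ≃ ℤ × ℤ :=
    { toFun := fun p => (p.1 + p.2 + m, p.2 + 2 * m)
      invFun := fun p => (p.1 - p.2 + m, p.2 - 2 * m)
      left_inv := fun p => by ext <;> simp; ring
      right_inv := fun p => by ext <;> simp; ring }
  rw [← e.tsum_eq (jt a τ z), ← tsum_mul_left]
  refine tsum_congr fun p => ?_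
  simp only [jt, e, Equiv.coe_fn_mk]
  rw [J.sh p.1 p.2]
  have : cexp (Real.pi * I * (p.1 * τ + p.2 * (z + τ))) = cexp (-(Real.pi * I * m * (τ + 2 * z))) *
      cexp (Real.pi * I * (((p.1 + p.2 + m : ℤ) : ℂ) * τ + ((p.2 + 2 * m : ℤ) : ℂ) * z)) := by
    rw [← Complex.exp_add]; push_cast; ring_nf
  rw [this]; ring

theorem Jac.main (J : Jac a m w) (hm : Odd m) (hne : ∃ n r, a n r ≠ 0) :
    ∃ ν ≤ m, (∃ n, jb a n ν ≠ 0) ∧ (∀ μ < ν, ∀ n, jb a n μ = 0) ∧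
      ∀ N : ℕ, Odd N → (∀ n : ℤ, n < N → jb a n ν = 0) → 6 * N ≤ w + ν ∧ w + ν ≠ 8 := by
  have hc0 : ∀ μ, (∀ n, jb a n μ = 0) → ∀ τ : ℂ, 0 < τ.im → jc a μ τ = 0 := by
    intro μ h τ hτ
    have := J.cn μ τ hτ
    simp only [h, zero_mul] at this
    exact this.unique hasSum_zero
  have hex : ∃ ν ≤ m, ∃ n, jb a n ν ≠ 0 := by
    by_contra! hcon
    have hf0 : ∀ τ z : ℂ, 0 < τ.im → ∑' p, jt a τ z p = 0 := by
      intro τ z hτ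
      refine theta_vanish τ hτ m hm _ (J.diff τ hτ) (J.per1 τ) (J.per2 τ) ?_ z
      have := powP _ _ (fun z => J.taylor τ z hτ) m (fun μ hμ => by
        rw [hc0 μ (hcon μ hμ.le) τ hτ]; simp)
      rw [hc0 m (hcon m le_rfl) τ hτ] at this
      simpa using this
    obtain ⟨n, r, hnr⟩ := hne
    have hB := uniq3 (fun p => if p.2.2 = 0 then a p.1 p.2.1 else 0) (by
      intro x y z hx
      have h1 : HasSum (jt a x y) 0 := by
        rw [← hf0 x y ((tm_mem).1 hx).1]
        exact (J.summ x y ((tm_mem).1 hx).1).hasSum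
      let i : ℤ × ℤ → ℤ × ℤ × ℤ := fun p => (p.1, p.2, 0)
      have hi : Function.Injective i := by
        rintro ⟨p, q⟩ ⟨p', q'⟩ h
        simp only [i, Prod.mk.injEq, and_true] at h
        rw [h.1, h.2]
      rw [← hi.hasSum_iff]
      · refine h1.congr_fun fun p => ?_
        simp [i, jt, EE]
      · rintro ⟨p, q, r⟩ h
        have : r ≠ 0 := by rintro rfl; exact h ⟨(p, q), rfl⟩
        simp [this])
    have := congrFun hB (n, r, 0)
    simp at this
    exact hnr this
  classical
  have hex' : ∃ ν, ∃ n, jb a n ν ≠ 0 := by obtain ⟨ν, -, h⟩ := hex; exact ⟨ν, h⟩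
  refine ⟨Nat.find hex', ?_, Nat.find_spec hex', ?_, ?_⟩
  · obtain ⟨ν, h1, h⟩ := hex
    exact (Nat.find_min' hex' h).trans h1
  · intro μ hμ n
    by_contra h
    exact Nat.find_min hex' hμ ⟨n, h⟩
  have hmin : ∀ μ < Nat.find hex', ∀ n, jb a n μ = 0 := by
    intro μ hμ n
    by_contra h
    exact Nat.find_min hex' hμ ⟨n, h⟩
  have hsp := Nat.find_spec hex'
  generalize Nat.find hex' = ν at *
  intro N hN hbN
  have hbodd : ∀ n : ℤ, jb a n ν ≠ 0 → Odd n := by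
    intro n h
    by_contra ho
    apply h
    have : ∀ r, a n r = 0 := fun r => by
      by_contra h2
      exact ho (J.odd _ _ h2).1
    simp [jb, this]
  refine modM (w + ν) N hN (fun j => jb a (N + 2 * j) ν) (jc a ν) ?_ ?_ ?_
  · intro τ hτ
    have h := J.cn ν τ hτ
    let i : ℕ → ℤ := fun j => N + 2 * j
    have hi : Function.Injective i := by intro j j' h; simp only [i] at h; omega
    rw [← hi.hasSum_iff] at h
    · refine h.congr_fun fun j => ?_
      simp [i]
    · intro n hn
      by_contra h0
      have h1 : jb a n ν ≠ 0 := fun h => h0 (by simp [h])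
      have h2 : (N:ℤ) ≤ n := by
        by_contra h3; exact h1 (hbN n (by omega))
      obtain ⟨k, hk⟩ := hbodd n h1
      obtain ⟨l, hl⟩ := hN
      exact hn ⟨(k - l).toNat, by simp only [i]; omega⟩
  · intro τ hτ
    have hτ0 : τ ≠ 0 := by rintro rfl; simp at hτ
    have hτ' : 0 < (-1 / τ).im := by
      rw [neg_div, one_div, Complex.neg_im, Complex.inv_im, neg_div, neg_neg]
      exact div_pos hτ (Complex.normSq_pos.2 hτ0)
    have t1 := powP _ _ (fun z => J.taylor (-1 / τ) z hτ') ν (fun μ hμ => by rw [hc0 μ (hmin μ hμ) _ hτ']; simp)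
    have t2 := powP _ _ (fun z => J.taylor τ z hτ) ν (fun μ hμ => by rw [hc0 μ (hmin μ hμ) _ hτ]; simp)
    have t3 : Tendsto (fun z : ℂ => z / τ) (𝓝[≠] 0) (𝓝[≠] 0) := by
      refine tendsto_nhdsWithin_iff.2 ⟨?_, ?_⟩
      · have : Tendsto (fun z : ℂ => z / τ) (𝓝 0) (𝓝 (0 / τ)) := (continuous_id.div_const τ).tendsto 0
        rw [zero_div] at this
        exact this.mono_left nhdsWithin_le_nhds
      · filter_upwards [self_mem_nhdsWithin] with z hz
        exact div_ne_zero hz hτ0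
    have t4 := t1.comp t3
    have t5 : Tendsto (fun z : ℂ => cexp (Real.pi * I * (m * z ^ 2 / τ))) (𝓝[≠] 0) (𝓝 1) := by
      have : Continuous (fun z : ℂ => cexp (Real.pi * I * (m * z ^ 2 / τ))) := by fun_prop
      have := (this.tendsto 0).mono_left (nhdsWithin_le_nhds (s := {0}ᶜ))
      simpa using this
    have t6 := (t5.mul t2).const_mul (- τ ^ (w + ν))
    have t7 := tendsto_nhds_unique t4 (t6.congr' (by
      filter_upwards [self_mem_nhdsWithin] with z hz
      have hz : z ≠ 0 := hz
      simp only [Function.comp]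
      rw [J.tr τ z hτ, div_pow, pow_add]
      field_simp))
    have hne : ((Real.pi * I : ℂ) ^ ν / ν.factorial) ≠ 0 := by
      refine div_ne_zero (pow_ne_zero _ (by simp [Real.pi_ne_zero])) (by exact_mod_cast ν.factorial_ne_zero)
    refine mul_right_cancel₀ hne ?_
    rw [t7]; ring
  · by_contra! hz
    obtain ⟨n, hn⟩ := hsp
    refine hn ?_
    have := uniq1 (fun n => jb a n ν) 1 (fun x => by
      have him : 0 < ((x:ℂ) + (1:ℝ) * I).im := by simp
      have h := J.cn ν _ him
      rwa [hz _ him] at h)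
    exact congrFun this n
end

section P9
variable {F : (Fin 2 → Fin 2 → ℂ) → (Fin 19 → ℂ)} {A : ℤ → ℤ → ℤ → Fin 19 → ℂ}

lemma exists_y (τ z : ℂ) (hτ : 0 < τ.im) : ∃ y : ℝ, ∀ x : ℝ, tm τ z (x + y * I) ∈ H2 := by
  refine ⟨(z.im ^ 2 + 1) / τ.im, fun x => ?_⟩
  rw [tm_mem]
  refine ⟨hτ, ?_⟩
  have e : ∀ x y : ℝ, ((x:ℂ) + y * I).im = y := by simp
  rw [e]
  field_simp
  linarith

def sl (A : ℤ → ℤ → ℤ → Fin 19 → ℂ) (m : ℤ) (i : Fin 19) : ℤ → ℤ → ℂ := fun n r => A n r m i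

lemma jt_EE (n r m : ℤ) (i : Fin 19) (τ z c : ℂ) :
    A n r m i * EE (n, r, m) τ z c = jt (sl A m i) τ z (n, r) * cexp (Real.pi * I * (m * c)) := by
  simp only [EE, jt, sl, mul_assoc, ← Complex.exp_add]
  congr 2
  ring

lemma Cof.js (C : Cof F A) (m : ℤ) (i : Fin 19) (τ z : ℂ) (hτ : 0 < τ.im) : Summable (jt (sl A m i) τ z) := by
  obtain ⟨y, hy⟩ := exists_y τ z hτ
  have h := (C.sum _ _ _ (hy 0) i).summable
  have hi : Function.Injective (fun p : ℤ × ℤ => ((p.1, p.2, m) : ℤ × ℤ × ℤ)) := by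
    rintro ⟨a, b⟩ ⟨c, d⟩ h
    simpa using h
  have h2 := h.comp_injective hi
  refine (h2.mul_right (cexp (-(Real.pi * I * (m * ((0:ℝ) + y * I)))))).congr fun p => ?_
  have := jt_EE (A := A) p.1 p.2 m i τ z ((0:ℝ) + y * I)
  simp only [Function.comp]
  rw [this, mul_assoc, ← Complex.exp_add]
  simp

def p3e : ℤ × (ℤ × ℤ) ≃ ℤ × ℤ × ℤ where
  toFun q := (q.2.1, q.2.2, q.1)
  invFun p := (p.2.2, (p.1, p.2.1))
  left_inv _ := rfl
  right_inv _ := rfl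

lemma Cof.phs (C : Cof F A) (i : Fin 19) (τ z c : ℂ) (h : tm τ z c ∈ H2) :
    HasSum (fun m : ℤ => (∑' p, jt (sl A m i) τ z p) * cexp (Real.pi * I * (m * c))) (F (tm τ z c) i) := by
  have h1 := (p3e.hasSum_iff).2 (C.sum _ _ _ h i)
  refine h1.prod_fiberwise fun m => ?_
  have h2 := (C.js m i τ z (tm_mem.1 h).1).hasSum.mul_right (cexp (Real.pi * I * (m * c)))
  refine h2.congr_fun fun p => ?_
  exact jt_EE p.1 p.2 m i τ z c

lemma Cof.trp (C : Cof F A) (L : Laws F) (m : ℤ) (τ z : ℂ) (hτ : 0 < τ.im) (Y : ℂ) :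
    ∑ l : Fin 19, ((∑' p, jt (sl A m l) (-1 / τ) (z / τ) p) * cexp (-(Real.pi * I * (m * z ^ 2 / τ)))) * Y ^ (l:ℕ) =
    ∑ l : Fin 19, (-τ ^ 2 * τ ^ (18 - l : ℕ) * ∑' p, jt (sl A m l) τ z p) * (Y + z) ^ (l:ℕ) := by
  obtain ⟨y, hy⟩ := exists_y τ z hτ
  have key := uniq1 (fun m : ℤ => ∑ l : Fin 19, ((∑' p, jt (sl A m l) (-1 / τ) (z / τ) p) * cexp (-(Real.pi * I * (m * z ^ 2 / τ)))) * Y ^ (l:ℕ) -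
    ∑ l : Fin 19, (-τ ^ 2 * τ ^ (18 - l : ℕ) * ∑' p, jt (sl A m l) τ z p) * (Y + z) ^ (l:ℕ)) y ?_
  · exact sub_eq_zero.1 (congrFun key m)
  intro x
  set c : ℂ := x + y * I with hc
  have h0 : tm τ z c ∈ H2 := hy x
  have s1 := hasSum_sum (s := Finset.univ) fun (l : Fin 19) _ => (C.phs l _ _ _ (tm_J h0)).mul_right (Y ^ (l:ℕ))
  have s2 := hasSum_sum (s := Finset.univ) fun (l : Fin 19) _ => ((C.phs l _ _ _ h0).mul_left (-τ ^ 2 * τ ^ (18 - l : ℕ))).mul_right ((Y + z) ^ (l:ℕ))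
  have s3 := s1.sub s2
  have e : ∑ l : Fin 19, F (tm (-1/τ) (z/τ) (c - z^2/τ)) l * Y ^ (l:ℕ) - ∑ l : Fin 19, -τ ^ 2 * τ ^ (18 - l : ℕ) * F (tm τ z c) l * (Y + z) ^ (l:ℕ) = 0 := by
    have := L.jj _ _ _ h0 1 Y
    rw [pv_one] at this
    rw [this, pv, Finset.mul_sum, sub_eq_zero]
    refine Finset.sum_congr rfl fun l _ => ?_
    simp only [mul_one]
    rw [add_comm z Y]
    ring
  rw [e] at s3
  refine s3.congr_fun fun m => ?_
  rw [sub_mul, Finset.sum_mul, Finset.sum_mul]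
  congr 1
  · refine Finset.sum_congr rfl fun l _ => ?_
    rw [show (Real.pi * I * (m * (c - z ^ 2 / τ)) : ℂ) = -(Real.pi * I * (m * z ^ 2 / τ)) + Real.pi * I * (m * c) by ring, Complex.exp_add]
    ring
  · refine Finset.sum_congr rfl fun l _ => ?_
    ring

lemma Cof.jac (C : Cof F A) (L : Laws F) (m : ℕ) (i0 : Fin 19) (hw : ∀ i, i0 < i → ∀ n r, A n r m i = 0) :
    Jac (sl A m i0) m (20 - i0) where
  odd n r h := by
    have : A n r m ≠ 0 := by
      intro h2
      rw [sl, h2] at h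
      simp at h
    exact ⟨(C.odd n r m this).1, (C.odd n r m this).2.1⟩
  summ τ z hτ := C.js m i0 τ z hτ
  sh n r := C.shc n r m i0 hw
  tr τ z hτ := by
    have h := top_coef _ _ z i0 ?_ (C.trp L m τ z hτ)
    · have e : 20 - (i0:ℕ) = 2 + (18 - i0) := by omega
      rw [e, pow_add]
      rw [Complex.exp_neg] at h
      have := Complex.exp_ne_zero (Real.pi * I * ((m:ℤ) * z ^ 2 / τ))
      rw [← div_eq_mul_inv, div_eq_iff this] at h
      rw [h]
      push_cast
      ring
    · intro i hi
      have : ∀ p, jt (sl A m i) τ z p = 0 := fun p => by simp [jt, sl, hw i hi]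
      simp [this]

lemma Cof.zero (C : Cof F A) (h : ∀ n r m, A n r m = 0) {τ} (hτ : τ ∈ H2) : F τ = 0 := by
  have e := eq_tm hτ
  rw [e] at hτ
  rw [e]
  funext i
  have := C.sum _ _ _ hτ i
  simp only [h, Pi.zero_apply, zero_mul] at this
  exact this.unique hasSum_zero
end P9

section P10
variable {F : (Fin 2 → Fin 2 → ℂ) → (Fin 19 → ℂ)} {A : ℤ → ℤ → ℤ → Fin 19 → ℂ}

lemma Cof.top (m : ℤ) (h : ∃ n r, A n r m ≠ 0) :
    ∃ i0, (∀ i, i0 < i → ∀ n r, A n r m i = 0) ∧ ∃ n r, A n r m i0 ≠ 0 := by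
  classical
  let s : Finset (Fin 19) := Finset.univ.filter fun i => ∃ n r, A n r m i ≠ 0
  have hs : s.Nonempty := by
    obtain ⟨n, r, h⟩ := h
    obtain ⟨i, hi⟩ := Function.ne_iff.1 h
    exact ⟨i, by simp only [s, Finset.mem_filter, Finset.mem_univ, true_and]; exact ⟨n, r, hi⟩⟩
  refine ⟨s.max' hs, fun i hi n r => ?_, ?_⟩
  · by_contra hc
    have : i ∈ s := by simp only [s, Finset.mem_filter, Finset.mem_univ, true_and]; exact ⟨n, r, hc⟩
    exact absurd (s.le_max' i this) (not_le.2 hi)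
  · have := s.max'_mem hs
    simpa only [s, Finset.mem_filter, Finset.mem_univ, true_and] using this

lemma jb_zero {a : ℤ → ℤ → ℂ} {n : ℤ} (h : ∀ r, a n r = 0) (ν : ℕ) : jb a n ν = 0 := by simp [jb, h]

lemma Cof.np (C : Cof F A) {n : ℤ} (h : n < 1) (r m : ℤ) : A n r m = 0 := by
  by_contra hc
  have := (C.pos hc).1
  omega

lemma Cof.ev (C : Cof F A) {n : ℤ} (h : ¬ Odd n) (r m : ℤ) : A n r m = 0 := by
  by_contra hc
  exact h (C.odd _ _ _ hc).1

lemma Cof.swz (C : Cof F A) {n r m : ℤ} (h : A m r n = 0) : A n r m = 0 := by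
  funext i
  rw [C.swc, h]; simp

lemma Cof.red (C : Cof F A) {n : ℤ} (k : ℤ) (h : A (n + k - k ^ 2) 1 1 = 0) : A n (1 - 2 * k) 1 = 0 := by
  refine C.shz (k := k) ?_
  convert h using 2 <;> ring

lemma Cof.red1 (C : Cof F A) (h : A 1 1 1 = 0) (r : ℤ) : A 1 r 1 = 0 := by
  by_contra hc
  obtain ⟨k, hk⟩ := (C.odd _ _ _ hc).2.1
  refine hc ?_
  rw [show r = 1 - 2 * (-k) by omega]
  refine C.red _ ?_
  by_cases h1 : k = 0
  · subst h1; simpa using h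
  by_cases h2 : k = -1
  · subst h2; simpa using h
  refine C.np ?_ _ _
  have : 1 ≤ k ∨ k ≤ -2 := by omega
  rcases this with h | h <;> nlinarith

lemma Cof.red1' (C : Cof F A) {r : ℤ} (h1 : r ≠ 1) (h2 : r ≠ -1) : A 1 r 1 = 0 := by
  by_contra hc
  obtain ⟨k, hk⟩ := (C.odd _ _ _ hc).2.1
  refine hc ?_
  rw [show r = 1 - 2 * (-k) by omega]
  refine C.red _ ?_
  refine C.np ?_ _ _
  have : 1 ≤ k ∨ k ≤ -2 := by omega
  rcases this with h | h <;> nlinarith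

lemma Cof.red3' (C : Cof F A) (h : A 1 1 1 = 0) {r : ℤ} (h1 : r ≠ 1) (h2 : r ≠ -1) : A 3 r 1 = 0 := by
  by_contra hc
  obtain ⟨k, hk⟩ := (C.odd _ _ _ hc).2.1
  refine hc ?_
  rw [show r = 1 - 2 * (-k) by omega]
  refine C.red _ ?_
  by_cases h3 : k = 1
  · subst h3; simpa using h
  by_cases h4 : k = -2
  · subst h4; simpa using h
  refine C.np ?_ _ _
  have : 2 ≤ k ∨ k ≤ -3 := by omega
  rcases this with h | h <;> nlinarith

lemma Cof.neg1 (C : Cof F A) {n m : ℤ} (h : A n 1 m = 0) : A n (-1) m = 0 := by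
  funext i
  rw [C.negc]; simp [h]

lemma Cof.fe (C : Cof F A) (n : ℤ) (y : ℂ) : ∑ l : Fin 19, A n 1 1 l * y ^ (l:ℕ) = - ∑ l : Fin 19, A n 1 1 l * (-1 - y) ^ (l:ℕ) := by
  have h1 := C.neg n 1 1 1 y
  have h2 := C.sh n (-1) 1 (-1) y
  rw [show n + -1 + 1 = n by ring, show (-1 : ℤ) + 2 * 1 = 1 by ring] at h2
  rw [h2, pv_one] at h1
  rw [h1, pv]
  congr 1
  refine Finset.sum_congr rfl fun l _ => ?_
  rw [show (-1 - y : ℂ) = (-1) * (y - -1) by ring, mul_pow]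
  congr 2
  have e : (18 - (l:ℕ)) + l = 18 := by omega
  have : ((-1 : ℂ)) ^ (18 - (l:ℕ)) * (-1) ^ (l:ℕ) = 1 := by rw [← pow_add, e]; norm_num
  rcases neg_one_pow_eq_or ℂ (l:ℕ) with h | h <;> rw [h] at this ⊢ 
  · linear_combination this
  · linear_combination -this

lemma Cof.m1 (C : Cof F A) (L : Laws F) (i0 : Fin 19) (hw : ∀ i, i0 < i → ∀ n r, A n r 1 i = 0)
    (hne : ∃ n r, A n r 1 i0 ≠ 0) : Odd (i0 : ℕ) ∧ ∀ N : ℕ, Odd N → (∀ n : ℤ, n < N → ∀ r, A n r 1 i0 = 0) → 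
      6 * N ≤ 21 - i0 ∧ 21 - (i0:ℕ) ≠ 8 := by
  have J := C.jac L 1 i0 (by simpa using hw)
  have hodd : Odd (i0 : ℕ) := by
    by_contra ho
    rw [Nat.not_odd_iff_even] at ho
    have h1 : ∀ n, A n 1 1 i0 = 0 := by
      intro n
      have e1 := C.negc n 1 1 i0
      have e2 := C.shc n (-1) 1 i0 hw
      rw [ho.neg_one_pow] at e1
      rw [show n + -1 + 1 = n by ring, show (-1 : ℤ) + 2 * 1 = 1 by ring] at e2
      linear_combination (1/2) * e1 + (1/2) * e2
    have h2 : ∀ k : ℕ, ∀ n, A n (1 + 2 * k) 1 i0 = 0 := by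
      intro k
      induction k with
      | zero => simpa using h1
      | succ k ih =>
        intro n
        have := C.shc (n - (1 + 2 * k) - 1) (1 + 2 * k) 1 i0 hw
        rw [ih] at this
        rw [← neg_eq_zero, ← this.symm.trans rfl]
        congr 2; push_cast; ring
    obtain ⟨n, r, h⟩ := hne
    have hne : A n r 1 ≠ 0 := fun h0 => h (by rw [h0]; rfl)
    obtain ⟨k, hk⟩ := (C.odd _ _ _ hne).2.1
    rcases le_or_gt 0 k with h0 | h0
    · lift k to ℕ using h0
      exact h (by rw [hk, add_comm]; exact h2 k n)
    · have e := C.negc n r 1 i0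
      obtain ⟨j, hj⟩ : ∃ j : ℕ, -r = 1 + 2 * j := ⟨(-k - 1).toNat, by omega⟩
      rw [hj, h2] at e
      exact h (by simpa using e)
  refine ⟨hodd, ?_⟩
  obtain ⟨ν, hν, ⟨n, hn⟩, -, hN⟩ := J.main odd_one (by simpa [sl] using hne)
  have h0 : ∀ n, jb (sl A (1:ℕ) i0) n 0 = 0 := by
    intro n
    have e : jb (sl A (1:ℕ) i0) n 0 = - jb (sl A (1:ℕ) i0) n 0 := by
      conv_lhs => rw [jb, ← (Equiv.neg ℤ).tsum_eq]
      rw [jb, ← tsum_neg]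
      refine tsum_congr fun r => ?_
      have := C.negc n r 1 i0
      rw [hodd.neg_one_pow] at this
      simp [sl, this]
    exact self_eq_neg.1 e
  have hν1 : ν = 1 := by
    interval_cases ν
    · exact absurd (h0 n) hn
    · rfl
  subst hν1
  intro N hNo hNz
  have := hN N hNo fun n hn => jb_zero (fun r => by simpa [sl] using hNz n hn r) _
  have := i0.2
  omega

lemma Cof.m111 (C : Cof F A) (h : ∀ i : Fin 19, 11 < (i:ℕ) → A 1 1 1 i = 0) : A 1 1 1 = 0 := by
  have e1 := C.fe 1 1
  have e2 := C.fe 1 2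
  have hs : ∀ i, A 1 1 1 i = - A 1 1 1 i.rev := C.swc 1 1 1
  have h9 : A 1 1 1 9 = 0 := self_eq_neg.1 (hs 9)
  have h10 : A 1 1 1 10 = - A 1 1 1 8 := hs 10
  have h11 : A 1 1 1 11 = - A 1 1 1 7 := hs 11
  have hl : ∀ i : Fin 19, (i:ℕ) < 7 → A 1 1 1 i = 0 := by
    intro i hi
    rw [hs, h i.rev (by simp [Fin.rev]; omega), neg_zero]
  have hl' : ∀ i : Fin 19, (i:ℕ) < 7 ∨ 11 < (i:ℕ) → A 1 1 1 i = 0 := fun i hi => hi.elim (hl i) (h i)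
  have z : ∀ y : ℂ, ∑ l : Fin 19, A 1 1 1 l * y ^ (l:ℕ) = A 1 1 1 7 * (y ^ 7 - y ^ 11) + A 1 1 1 8 * (y ^ 8 - y ^ 10) := by
    intro y
    have : ∑ l : Fin 19, A 1 1 1 l * y ^ (l:ℕ) = ∑ l ∈ ({7, 8, 9, 10, 11} : Finset (Fin 19)), A 1 1 1 l * y ^ (l:ℕ) := by
      symm
      refine Finset.sum_subset (Finset.subset_univ _) fun l _ hl => ?_
      rw [hl' l ?_, zero_mul]
      revert hl; revert l; decide
    rw [this]
    rw [Finset.sum_insert (by decide), Finset.sum_insert (by decide), Finset.sum_insert (by decide), Finset.sum_insert (by decide), Finset.sum_singleton, h9, h10, h11]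
    change A 1 1 1 7 * y ^ 7 + (A 1 1 1 8 * y ^ 8 + (0 * y ^ 9 + (- A 1 1 1 8 * y ^ 10 + - A 1 1 1 7 * y ^ 11))) = _
    ring
  rw [z, z] at e1 e2
  norm_num at e1 e2
  have h8 : A 1 1 1 8 = 5 / 2 * A 1 1 1 7 := by linear_combination (-1/768) * e1
  rw [h8] at e2
  have h7 : A 1 1 1 7 = 0 := by linear_combination (1/39900) * e2
  rw [h7, mul_zero] at h8
  rw [h7] at h11
  rw [h8] at h10
  funext i
  by_cases hi : (i:ℕ) < 7 ∨ 11 < (i:ℕ)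
  · exact hl' i hi
  have : i = 7 ∨ i = 8 ∨ i = 9 ∨ i = 10 ∨ i = 11 := by revert hi; revert i; decide
  rcases this with rfl | rfl | rfl | rfl | rfl <;> simp [h7, h8, h9, h10, h11]

lemma Cof.m311 (C : Cof F A) (L : Laws F) (h1 : A 1 1 1 = 0) (h : ∀ i : Fin 19, 3 < (i:ℕ) → A 3 1 1 i = 0) : A 3 1 1 = 0 := by
  by_contra hP
  have h3 : A 1 1 3 ≠ 0 := fun h0 => hP (C.swz h0)
  obtain ⟨i0, hw, hne⟩ := Cof.top 3 ⟨1, 1, h3⟩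
  have J := C.jac L 3 i0 (by simpa using hw)
  obtain ⟨ν, hν, -, hmin, hN⟩ := J.main (by decide) (by simpa [sl] using hne)
  have hi0 : 15 ≤ (i0:ℕ) := by
    by_contra hc
    refine h3 (funext fun i => ?_)
    by_cases hi : i0 < i
    · exact hw i hi _ _
    · rw [C.swc, h i.rev, neg_zero]; · rfl
      rw [Fin.lt_def] at hi
      simp [Fin.rev]; omega
  have hr : ∀ r, r ≠ 1 → r ≠ -1 → A 1 r 3 = 0 := fun r ha hb => C.swz (C.red3' h1 ha hb)
  have hn1 : jb (sl A (3:ℕ) i0) 1 ν ≠ 0 := by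
    intro h0
    have := hN 3 (by decide) ?_
    · omega
    intro n hn
    by_cases hn1 : n = 1
    · rw [hn1, h0]
    refine jb_zero (fun r => ?_) _
    have : A n r (3:ℕ) = 0 := by
      by_cases hn0 : n < 1
      · exact C.np hn0 _ _
      · have : n = 2 := by push_cast at hn; omega
        subst this
        exact C.ev (by decide) _ _
    rw [sl, this]; rfl
  have hν1 : ν < 2 := by
    by_contra hc
    refine hn1 ?_
    rw [← hmin (ν - 2) (by omega) 1]
    refine tsum_congr fun r => ?_
    by_cases ha : r = 1
    · simp [ha]
    by_cases hb : r = -1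
    · have : ν = (ν - 2) + 2 := by omega
      subst hb
      rw [this, pow_add]
      simp
    have : sl A (3:ℕ) i0 1 r = 0 := by
      rw [sl, Nat.cast_ofNat, hr r ha hb]; rfl
    rw [this, zero_mul, zero_mul]
  have h6 := hN 1 odd_one fun n hn => jb_zero (fun r => by
    rw [sl, C.np (by simpa using hn)]; rfl) _
  have hi15 : (i0:ℕ) = 15 := by omega
  have hl : ∀ i : Fin 19, (i:ℕ) < 3 → A 3 1 1 i = 0 := by
    intro i hi
    rw [C.swc, hw i.rev (by rw [Fin.lt_def]; simp [Fin.rev]; omega), neg_zero]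
  have z : ∀ y : ℂ, ∑ l : Fin 19, A 3 1 1 l * y ^ (l:ℕ) = A 3 1 1 3 * y ^ 3 := by
    intro y
    refine Finset.sum_eq_single 3 (fun l _ hl3 => ?_) (by simp)
    have : (l:ℕ) < 3 ∨ 3 < (l:ℕ) := by revert hl3; revert l; decide
    rw [this.elim (hl l) (h l), zero_mul]
  have e := C.fe 3 0
  rw [z, z] at e
  norm_num at e
  refine hP (funext fun i => ?_)
  by_cases hi : i = 3
  · rw [hi]; exact e.symm
  have : (i:ℕ) < 3 ∨ 3 < (i:ℕ) := by revert hi; revert i; decide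
  exact this.elim (hl i) (h i)

lemma Cof.m1z (C : Cof F A) (L : Laws F) (h15 : A 1 1 1 15 = 0) (n r : ℤ) : A n r 1 = 0 := by
  by_contra hc
  obtain ⟨i0, hw, hne⟩ := Cof.top 1 ⟨n, r, hc⟩
  obtain ⟨ho, hN⟩ := C.m1 L i0 hw hne
  have hlow : ∀ n : ℤ, n < 3 → n ≠ 1 → ∀ r, A n r 1 = 0 := by
    intro n hn hn1 r
    by_cases hn0 : n < 1
    · exact C.np hn0 _ _
    · have : n = 2 := by omega
      subst this
      exact C.ev (by decide) _ _
  have h1 := hN 1 odd_one fun n hn r => by rw [C.np (by simpa using hn)]; rfl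
  have hn15 : (i0:ℕ) ≠ 15 := by
    intro h0
    have hi : i0 = 15 := Fin.ext h0
    subst hi
    have := hN 3 (by decide) fun n hn r => ?_
    · omega
    by_cases hn1 : n = 1
    · subst hn1
      by_cases ha : r = 1
      · rw [ha, h15]
      by_cases hb : r = -1
      · rw [hb, C.negc]; simp [h15]
      rw [C.red1' ha hb]; rfl
    · rw [hlow n (by simpa using hn) hn1]; rfl
  have hi11 : (i0:ℕ) ≤ 11 := by
    obtain ⟨k, hk⟩ := ho
    omega
  have h111 : A 1 1 1 = 0 := C.m111 fun i hi => hw i (by rw [Fin.lt_def]; omega) _ _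
  have hz3 : ∀ n : ℤ, n < 3 → ∀ r, A n r 1 = 0 := by
    intro n hn r
    by_cases hn1 : n = 1
    · rw [hn1, C.red1 h111]
    · exact hlow n hn hn1 r
  have h3 := hN 3 (by decide) fun n hn r => by rw [hz3 n (by simpa using hn)]; rfl
  have h311 : A 3 1 1 = 0 := C.m311 L h111 fun i hi => hw i (by rw [Fin.lt_def]; omega) _ _
  have h5 := hN 5 (by decide) fun n hn r => by
    have : A n r 1 = 0 := by
      by_cases h : n < 3
      · exact hz3 n h r
      have : n = 3 ∨ n = 4 := by push_cast at hn; omega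
      rcases this with rfl | rfl
      · by_cases ha : r = 1
        · rw [ha, h311]
        by_cases hb : r = -1
        · rw [hb, C.neg1 h311]
        exact C.red3' h111 ha hb
      · exact C.ev (by decide) _ _
    rw [this]; rfl
  omega

theorem Cof.all (C : Cof F A) (L : Laws F) (h15 : A 1 1 1 15 = 0) (n r m : ℤ) : A n r m = 0 := by
  rcases le_or_gt m 0 with hm | hm
  · exact C.swz (C.np (by omega) _ _)
  lift m to ℕ using hm.le
  induction m using Nat.strong_induction_on generalizing n r with
  | _ m ih =>
  by_contra hc
  obtain ⟨-, -, hmo⟩ := C.odd _ _ _ hc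
  have hmo : Odd m := by exact_mod_cast hmo
  by_cases hm1 : m = 1
  · subst hm1
    exact hc (by simpa using C.m1z L h15 n r)
  have hm3 : 3 ≤ m := by
    obtain ⟨k, hk⟩ := hmo
    omega
  obtain ⟨i0, hw, hne⟩ := Cof.top m ⟨n, r, hc⟩
  have J := C.jac L m i0 hw
  obtain ⟨ν, hν, -, -, hN⟩ := J.main hmo hne
  have hlow : ∀ n : ℤ, n < m → ∀ r, A n r m = 0 := by
    intro n hn r
    rcases le_or_gt n 0 with h0 | h0
    · exact C.np (by omega) _ _
    lift n to ℕ using h0.le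
    exact C.swz (ih n (by exact_mod_cast hn) _ _ h0)
  have h1 := hN m hmo fun n hn => jb_zero (fun r => by rw [sl, hlow n hn]; rfl) _
  have hmm : ∀ r, A m r m = 0 := by
    intro r
    funext i
    by_cases hi : i0 < i
    · exact hw i hi _ _
    · rw [C.swc, hw i.rev, neg_zero]; · rfl
      rw [Fin.lt_def] at hi ⊢
      simp [Fin.rev]; omega
  have h2 := hN (m + 2) (by obtain ⟨k, hk⟩ := hmo; exact ⟨k + 1, by omega⟩) fun n hn => jb_zero (fun r => by
    have : A n r m = 0 := by
      by_cases h : n < m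
      · exact hlow n h r
      have : n = m ∨ n = m + 1 := by push_cast at hn; omega
      rcases this with rfl | rfl
      · exact hmm r
      · refine C.ev ?_ _ _
        rw [Int.not_odd_iff_even]
        obtain ⟨k, hk⟩ := hmo
        exact ⟨k + 1, by omega⟩
    rw [sl, this]; rfl) _
  omega

end P10

theorem finrank_of {ε : M4 → ℂ} (hε : IsEps ε) (F0 : (Fin 2 → Fin 2 → ℂ) → (Fin 19 → ℂ))
    (h0 : IsSiegelCuspForm 18 2 Sp4Z ε F0) (hne : F0 ≠ 0) : Module.finrank ℂ ↥(SiegelCusp 18 2 Sp4Z ε) = 1 := by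
  have key : ∀ F A, IsSiegelCuspForm 18 2 Sp4Z ε F → Cof F A → A 1 1 1 15 = 0 → F = 0 := by
    intro F A hF C h
    funext τ
    by_cases hτ : τ ∈ H2
    · exact C.zero (C.all (laws_of hε hF) h) hτ
    · exact hF.2.2.2 τ hτ
  obtain ⟨A0, C0⟩ := exists_cof (laws_of hε h0) (laws2_of hε h0) h0.1
  have hA0 : A0 1 1 1 15 ≠ 0 := fun h => hne (key F0 A0 h0 C0 h)
  refine finrank_eq_one (⟨F0, h0⟩ : ↥(SiegelCusp 18 2 Sp4Z ε)) (fun h => hne (congrArg Subtype.val h)) ?_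
  rintro ⟨F, hF⟩
  have hF' : IsSiegelCuspForm 18 2 Sp4Z ε F := hF
  obtain ⟨A, C⟩ := exists_cof (laws_of hε hF') (laws2_of hε hF') hF'.1
  set c : ℂ := A 1 1 1 15 / A0 1 1 1 15 with hc
  refine ⟨c, Subtype.ext ?_⟩
  show c • F0 = F
  have hG : IsSiegelCuspForm 18 2 Sp4Z ε (F - c • F0) :=
    (SiegelCusp 18 2 Sp4Z ε).sub_mem hF ((SiegelCusp 18 2 Sp4Z ε).smul_mem c h0)
  obtain ⟨B, CB⟩ := exists_cof (laws_of hε hG) (laws2_of hε hG) hG.1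
  have hu := uniq3 (fun p => A p.1 p.2.1 p.2.2 15 - c * A0 p.1 p.2.1 p.2.2 15 - B p.1 p.2.1 p.2.2 15) (by
    intro x y z h
    have s := ((C.sum x y z h 15).sub ((C0.sum x y z h 15).mul_left c)).sub (CB.sum x y z h 15)
    have e : F (tm x y z) 15 - c * F0 (tm x y z) 15 - (F - c • F0) (tm x y z) 15 = 0 := by simp
    rw [e] at s
    refine s.congr_fun fun p => ?_
    ring)
  have h1 := congrFun hu (1, 1, 1)
  have h2 : B 1 1 1 15 = 0 := by
    simp only [Pi.zero_apply] at h1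
    rw [hc, div_mul_cancel₀ _ hA0, sub_self, zero_sub, neg_eq_zero] at h1
    exact h1
  have h3 := key _ B hG CB h2
  exact (sub_eq_zero.1 h3).symm

section P12

def g00 (n : ℤ) : ℤ := if n % 2 = 0 then 1 else 0
def g01 (n : ℤ) : ℤ := if n % 4 = 0 then 1 else if n % 4 = 2 then -1 else 0
def g10 (n : ℤ) : ℤ := if n % 2 = 1 then 1 else 0
def g11 (n : ℤ) : ℤ := if n % 4 = 1 then 1 else if n % 4 = 3 then -1 else 0

def et (τ z : ℂ) (n : ℤ) : ℂ := cexp (Real.pi * I / 4 * (n ^ 2 * τ) + Real.pi * I * (n * z))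

def tg (g : ℤ → ℤ) (τ z : ℂ) : ℂ := ∑' n : ℤ, g n * et τ z n

lemma sgn_exp (m : ℤ) : cexp (Real.pi * I * m) = if m % 2 = 0 then 1 else -1 := by
  obtain ⟨k, rfl | rfl⟩ := Int.even_or_odd' m
  · rw [if_pos (by omega)]
    have := Complex.exp_int_mul_two_pi_mul_I k
    rw [← this]; congr 1; push_cast; ring
  · rw [if_neg (by omega)]
    have := Complex.exp_int_mul_two_pi_mul_I k
    rw [show (Real.pi * I * ((2 * k + 1 : ℤ) : ℂ)) = k * (2 * Real.pi * I) + Real.pi * I by push_cast; ring, Complex.exp_add, this, Complex.exp_pi_mul_I, one_mul]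

lemma hs_aff {h : ℤ → ℂ} {S : ℂ} (e : ℤ) (h0 : ∀ n, (¬ ∃ m, n = 2 * m + e) → h n = 0) (hs : HasSum (fun m => h (2 * m + e)) S) : HasSum h S := by
  have hi : Function.Injective (fun m : ℤ => 2 * m + e) := by
    intro a b h; simp only at h; omega
  rw [← hi.hasSum_iff]
  · exact hs
  · intro n hn
    exact h0 n fun ⟨m, hm⟩ => hn ⟨m, hm.symm⟩

lemma hs00 {τ : ℂ} (z : ℂ) (hτ : 0 < τ.im) : tg g00 τ z = jacobiTheta₂ z τ := by
  refine (hs_aff 0 (fun n hn => ?_) ?_).tsum_eq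
  · rw [g00, if_neg fun h => hn ⟨n / 2, by omega⟩]; simp
  · refine (hasSum_jacobiTheta₂_term z hτ).congr_fun fun m => ?_
    rw [g00, if_pos (by omega), et, jacobiTheta₂_term]
    push_cast
    rw [one_mul]; congr 1; ring

lemma hs01 {τ : ℂ} (z : ℂ) (hτ : 0 < τ.im) : tg g01 τ z = jacobiTheta₂ (z + 1/2) τ := by
  refine (hs_aff 0 (fun n hn => ?_) ?_).tsum_eq
  · rw [g01, if_neg fun h => hn ⟨n / 2, by omega⟩, if_neg fun h => hn ⟨n / 2, by omega⟩]; simp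
  · refine (hasSum_jacobiTheta₂_term (z + 1/2) hτ).congr_fun fun m => ?_
    have : ((g01 (2 * m + 0) : ℤ) : ℂ) = cexp (Real.pi * I * m) := by
      rw [sgn_exp, g01]
      rcases Int.emod_two_eq_zero_or_one m with h | h
      · rw [if_pos (by omega), if_pos h]; simp
      · rw [if_neg (by omega), if_pos (by omega), if_neg (by omega)]; simp
    rw [this, et, jacobiTheta₂_term, ← Complex.exp_add]
    push_cast
    congr 1; ring

lemma hs10 {τ : ℂ} (z : ℂ) (hτ : 0 < τ.im) : tg g10 τ z = cexp (Real.pi * I / 4 * τ + Real.pi * I * z) * jacobiTheta₂ (z + τ/2) τ := by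
  refine (hs_aff 1 (fun n hn => ?_) ?_).tsum_eq
  · rw [g10, if_neg fun h => hn ⟨n / 2, by omega⟩]; simp
  · refine ((hasSum_jacobiTheta₂_term (z + τ/2) hτ).mul_left _).congr_fun fun m => ?_
    rw [g10, if_pos (by omega), et, jacobiTheta₂_term, ← Complex.exp_add]
    push_cast
    rw [one_mul]; congr 1; ring

lemma hs11 {τ : ℂ} (z : ℂ) (hτ : 0 < τ.im) : tg g11 τ z = cexp (Real.pi * I / 4 * τ + Real.pi * I * z) * jacobiTheta₂ (z + τ/2 + 1/2) τ := by
  refine (hs_aff 1 (fun n hn => ?_) ?_).tsum_eq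
  · rw [g11, if_neg fun h => hn ⟨n / 2, by omega⟩, if_neg fun h => hn ⟨n / 2, by omega⟩]; simp
  · refine ((hasSum_jacobiTheta₂_term (z + τ/2 + 1/2) hτ).mul_left _).congr_fun fun m => ?_
    have : ((g11 (2 * m + 1) : ℤ) : ℂ) = cexp (Real.pi * I * m) := by
      rw [sgn_exp, g11]
      rcases Int.emod_two_eq_zero_or_one m with h | h
      · rw [if_pos (by omega), if_pos h]; simp
      · rw [if_neg (by omega), if_pos (by omega), if_neg (by omega)]; simp
    rw [this, et, jacobiTheta₂_term, ← Complex.exp_add, ← Complex.exp_add]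
    push_cast
    congr 1; ring

lemma im_S {τ : ℂ} (hτ : 0 < τ.im) : 0 < (-1/τ).im := by
  have h0 : τ ≠ 0 := by rintro rfl; simp at hτ
  have hn : 0 < normSq τ := normSq_pos.2 h0
  rw [neg_div, neg_im, one_div, inv_im, neg_div, neg_neg]
  positivity

def kap (τ : ℂ) : ℂ := (-I * τ) ^ (1 / 2 : ℂ)

lemma kap4 (τ : ℂ) : kap τ ^ 4 = - τ ^ 2 := by
  have : kap τ ^ 2 = -I * τ := by
    have h := Complex.cpow_nat_inv_pow (-I * τ) (n := 2) two_ne_zero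
    rw [kap, one_div]
    exact_mod_cast h
  rw [show 4 = 2 * 2 by norm_num, pow_mul, this, mul_pow, neg_sq, I_sq]; ring

lemma jfe {τ : ℂ} (hτ : 0 < τ.im) (z : ℂ) : jacobiTheta₂ (z / τ) (-1 / τ) = kap τ * cexp (Real.pi * I * z ^ 2 / τ) * jacobiTheta₂ z τ := by
  have h0 : τ ≠ 0 := by rintro rfl; simp at hτ
  have hk : kap τ ≠ 0 := by
    intro h
    have := kap4 τ
    rw [h] at this
    simp [h0] at this
  have h := jacobiTheta₂_functional_equation z τ
  change _ = 1 / kap τ * _ * _ at h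
  rw [h, show (-Real.pi * I * z ^ 2 / τ : ℂ) = -(Real.pi * I * z ^ 2 / τ) by ring, Complex.exp_neg]
  have := Complex.exp_ne_zero (Real.pi * I * z ^ 2 / τ)
  field_simp

lemma fe00 {τ : ℂ} (hτ : 0 < τ.im) (z : ℂ) : tg g00 (-1/τ) (z/τ) = kap τ * cexp (Real.pi * I * z ^ 2 / τ) * tg g00 τ z := by
  rw [hs00 _ hτ, hs00 _ (im_S hτ), jfe hτ]

lemma fe01 {τ : ℂ} (hτ : 0 < τ.im) (z : ℂ) : tg g01 (-1/τ) (z/τ) = kap τ * cexp (Real.pi * I * z ^ 2 / τ) * tg g10 τ z := by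
  have h0 : τ ≠ 0 := by rintro rfl; simp at hτ
  rw [hs10 _ hτ, hs01 _ (im_S hτ), show z / τ + 1 / 2 = (z + τ / 2) / τ by field_simp, jfe hτ]
  have e3 : cexp (Real.pi * I * (z + τ / 2) ^ 2 / τ) = cexp (Real.pi * I * z ^ 2 / τ) * cexp (Real.pi * I / 4 * τ + Real.pi * I * z) := by
    rw [← Complex.exp_add]
    congr 1
    field_simp; ring
  rw [e3]; ring

lemma fe10 {τ : ℂ} (hτ : 0 < τ.im) (z : ℂ) : tg g10 (-1/τ) (z/τ) = kap τ * cexp (Real.pi * I * z ^ 2 / τ) * tg g01 τ z := by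
  have h0 : τ ≠ 0 := by rintro rfl; simp at hτ
  have e : jacobiTheta₂ (z + 1/2) τ = jacobiTheta₂ (z - 1/2) τ := by
    rw [← jacobiTheta₂_add_left (z - 1/2)]; congr 1; ring
  rw [hs01 _ hτ, hs10 _ (im_S hτ), show z / τ + -1 / τ / 2 = (z - 1 / 2) / τ by field_simp; ring, jfe hτ, e, ← mul_assoc, ← mul_assoc, mul_comm _ (kap τ), mul_assoc (kap τ), ← Complex.exp_add]
  congr 3
  field_simp; ring

lemma fe11 {τ : ℂ} (hτ : 0 < τ.im) (z : ℂ) : tg g11 (-1/τ) (z/τ) = (-I * kap τ) * cexp (Real.pi * I * z ^ 2 / τ) * tg g11 τ z := by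
  have h0 : τ ≠ 0 := by rintro rfl; simp at hτ
  have e : jacobiTheta₂ (z + τ/2 + 1/2) τ = jacobiTheta₂ (z + τ / 2 - 1/2) τ := by
    rw [← jacobiTheta₂_add_left (z + τ / 2 - 1/2)]; congr 1; ring
  have e2 : -I = cexp (-(Real.pi * I / 2)) := by
    rw [Complex.exp_neg, show (Real.pi * I / 2 : ℂ) = Real.pi / 2 * I by ring, Complex.exp_pi_div_two_mul_I, Complex.inv_I]
  rw [hs11 _ hτ, hs11 _ (im_S hτ), show z / τ + -1 / τ / 2 + 1 / 2 = (z + τ / 2 - 1 / 2) / τ by field_simp; ring, jfe hτ, e, e2]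
  have e3 : cexp (Real.pi * I / 4 * (-1 / τ) + Real.pi * I * (z / τ)) * cexp (Real.pi * I * (z + τ / 2 - 1 / 2) ^ 2 / τ) =
      cexp (-(Real.pi * I / 2)) * cexp (Real.pi * I * z ^ 2 / τ) * cexp (Real.pi * I / 4 * τ + Real.pi * I * z) := by
    rw [← Complex.exp_add, ← Complex.exp_add, ← Complex.exp_add]
    congr 1
    field_simp; ring
  linear_combination (kap τ * jacobiTheta₂ (z + τ / 2 - 1 / 2) τ) * e3

lemma sum_q (R : ℝ) {T : ℝ} (hT : 0 < T) : Summable fun n : ℤ => Real.exp (-Real.pi * (T * n ^ 2 - 2 * R * |(n:ℝ)|)) := by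
  simpa using summable_pow_mul_jacobiTheta₂_term_bound R hT 0

lemma powU (C : ℕ → ℂ) (h : ∀ z : ℂ, HasSum (fun μ => C μ * z ^ μ) 0) (ν : ℕ) : C ν = 0 := by
  induction ν using Nat.strong_induction_on with
  | _ ν ih =>
  have := powP C (fun _ => 0) h ν ih
  simp only [zero_div] at this
  exact tendsto_nhds_unique this tendsto_const_nhds

end P12

section P13

abbrev Z4 := ℤ × ℤ × ℤ × ℤ

lemma hs4 {R : Type*} [NormedCommRing R] [CompleteSpace R] {f1 f2 f3 f4 : ℤ → R} (h1 : Summable fun n => ‖f1 n‖)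
    (h2 : Summable fun n => ‖f2 n‖) (h3 : Summable fun n => ‖f3 n‖) (h4 : Summable fun n => ‖f4 n‖) :
    HasSum (fun X : Z4 => f1 X.1 * (f2 X.2.1 * (f3 X.2.2.1 * f4 X.2.2.2))) ((∑' n, f1 n) * ((∑' n, f2 n) * ((∑' n, f3 n) * ∑' n, f4 n)))
    ∧ Summable (fun X : Z4 => ‖f1 X.1 * (f2 X.2.1 * (f3 X.2.2.1 * f4 X.2.2.2))‖) := by
  have n3 := h3.mul_norm h4
  have n2 := h2.mul_norm n3
  have n1 := h1.mul_norm n2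
  have s3 := h3.of_norm.hasSum.mul h4.of_norm.hasSum n3.of_norm
  have s2 := h2.of_norm.hasSum.mul s3 n2.of_norm
  have s1 := h1.of_norm.hasSum.mul s2 n1.of_norm
  exact ⟨s1, n1⟩

def P4 (g : ℤ → ℤ) (X : Z4) : ℤ := g X.1 * (g X.2.1 * (g X.2.2.1 * g X.2.2.2))
def eE (X : Z4) : ℤ := P4 g00 X - P4 g01 X - P4 g10 X
def e1 (X : Z4) : ℤ := P4 g11 X
def sm (X : Z4) : ℤ := X.1 + X.2.1 + X.2.2.1 + X.2.2.2

lemma g_b : (∀ n, |g00 n| ≤ 1) ∧ (∀ n, |g01 n| ≤ 1) ∧ (∀ n, |g10 n| ≤ 1) ∧ (∀ n, |g11 n| ≤ 1) := by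
  refine ⟨fun n => ?_, fun n => ?_, fun n => ?_, fun n => ?_⟩
  · unfold g00; split_ifs <;> simp
  · unfold g01; split_ifs <;> simp
  · unfold g10; split_ifs <;> simp
  · unfold g11; split_ifs <;> simp

lemma et_sum (g : ℤ → ℤ) (hg : ∀ n, |g n| ≤ 1) {τ : ℂ} (hτ : 0 < τ.im) (z : ℂ) : Summable fun n : ℤ => ‖(g n : ℂ) * et τ z n‖ := by
  refine Summable.of_nonneg_of_le (fun _ => norm_nonneg _) (fun n => ?_) (sum_q (|z.im| / 2) (T := τ.im / 4) (by linarith))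
  rw [norm_mul, et, Complex.norm_exp]
  have h1 : ‖(g n : ℂ)‖ ≤ 1 := by
    rw [Complex.norm_intCast]; exact_mod_cast hg n
  refine (mul_le_of_le_one_left (Real.exp_nonneg _) h1).trans (Real.exp_le_exp.2 ?_)
  have e : (Real.pi * I / 4 * (n ^ 2 * τ) + Real.pi * I * (n * z) : ℂ) = ((Real.pi * n ^ 2 / 4 : ℝ) : ℂ) * (τ * I) + ((Real.pi * n : ℝ) : ℂ) * (z * I) := by
    push_cast; ring
  rw [e, add_re, re_ofReal_mul, re_ofReal_mul, mul_I_re, mul_I_re]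
  have h2 : -(n * z.im) ≤ |(n:ℝ)| * |z.im| := by rw [← abs_mul]; exact neg_le_abs _
  have := mul_le_mul_of_nonneg_left h2 Real.pi_pos.le
  nlinarith

def E4 (τ : ℂ) (Z : ℂ × ℂ × ℂ × ℂ) (X : Z4) : ℂ := et τ Z.1 X.1 * (et τ Z.2.1 X.2.1 * (et τ Z.2.2.1 X.2.2.1 * et τ Z.2.2.2 X.2.2.2))

lemma P4_sum (g : ℤ → ℤ) (hg : ∀ n, |g n| ≤ 1) {τ : ℂ} (hτ : 0 < τ.im) (Z : ℂ × ℂ × ℂ × ℂ) :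
    HasSum (fun X : Z4 => (P4 g X : ℂ) * E4 τ Z X) (tg g τ Z.1 * (tg g τ Z.2.1 * (tg g τ Z.2.2.1 * tg g τ Z.2.2.2))) := by
  have := (hs4 (et_sum g hg hτ Z.1) (et_sum g hg hτ Z.2.1) (et_sum g hg hτ Z.2.2.1) (et_sum g hg hτ Z.2.2.2)).1
  refine this.congr_fun fun X => ?_
  simp only [P4, E4]
  push_cast
  ring

def TE (τ : ℂ) (Z : ℂ × ℂ × ℂ × ℂ) : ℂ := ∑' X : Z4, (eE X : ℂ) * E4 τ Z X
def T1 (τ : ℂ) (Z : ℂ × ℂ × ℂ × ℂ) : ℂ := ∑' X : Z4, (e1 X : ℂ) * E4 τ Z X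

lemma TE_sum {τ : ℂ} (hτ : 0 < τ.im) (Z : ℂ × ℂ × ℂ × ℂ) :
    HasSum (fun X : Z4 => (eE X : ℂ) * E4 τ Z X) (tg g00 τ Z.1 * (tg g00 τ Z.2.1 * (tg g00 τ Z.2.2.1 * tg g00 τ Z.2.2.2)) -
      tg g01 τ Z.1 * (tg g01 τ Z.2.1 * (tg g01 τ Z.2.2.1 * tg g01 τ Z.2.2.2)) - tg g10 τ Z.1 * (tg g10 τ Z.2.1 * (tg g10 τ Z.2.2.1 * tg g10 τ Z.2.2.2))) := by
  refine (((P4_sum g00 g_b.1 hτ Z).sub (P4_sum g01 g_b.2.1 hτ Z)).sub (P4_sum g10 g_b.2.2.1 hτ Z)).congr_fun fun X => ?_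
  simp only [eE]; push_cast; ring

lemma T1_sum {τ : ℂ} (hτ : 0 < τ.im) (Z : ℂ × ℂ × ℂ × ℂ) :
    HasSum (fun X : Z4 => (e1 X : ℂ) * E4 τ Z X) (tg g11 τ Z.1 * (tg g11 τ Z.2.1 * (tg g11 τ Z.2.2.1 * tg g11 τ Z.2.2.2))) :=
  P4_sum g11 g_b.2.2.2 hτ Z

lemma exp4 (τ p q r s : ℂ) : cexp (Real.pi * I * (p ^ 2 + q ^ 2 + r ^ 2 + s ^ 2) / τ) = cexp (Real.pi * I * p ^ 2 / τ) * cexp (Real.pi * I * q ^ 2 / τ) *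
    cexp (Real.pi * I * r ^ 2 / τ) * cexp (Real.pi * I * s ^ 2 / τ) := by
  rw [← Complex.exp_add, ← Complex.exp_add, ← Complex.exp_add]; congr 1; ring

lemma TE_fe {τ : ℂ} (hτ : 0 < τ.im) (p q r s : ℂ) : TE (-1/τ) (p/τ, q/τ, r/τ, s/τ) =
    -τ ^ 2 * cexp (Real.pi * I * (p ^ 2 + q ^ 2 + r ^ 2 + s ^ 2) / τ) * TE τ (p, q, r, s) := by
  rw [TE, TE, (TE_sum hτ _).tsum_eq, (TE_sum (im_S hτ) _).tsum_eq, exp4, ← kap4]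
  simp only [fe00 hτ, fe01 hτ, fe10 hτ]
  ring

lemma T1_fe {τ : ℂ} (hτ : 0 < τ.im) (p q r s : ℂ) : T1 (-1/τ) (p/τ, q/τ, r/τ, s/τ) =
    -τ ^ 2 * cexp (Real.pi * I * (p ^ 2 + q ^ 2 + r ^ 2 + s ^ 2) / τ) * T1 τ (p, q, r, s) := by
  rw [T1, T1, (T1_sum hτ _).tsum_eq, (T1_sum (im_S hτ) _).tsum_eq, exp4, ← kap4]
  simp only [fe11 hτ]
  have : I ^ 4 = 1 := I_pow_four
  linear_combination (kap τ ^ 4 * cexp (Real.pi * I * p ^ 2 / τ) * cexp (Real.pi * I * q ^ 2 / τ) *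
    cexp (Real.pi * I * r ^ 2 / τ) * cexp (Real.pi * I * s ^ 2 / τ) * (tg g11 τ p * (tg g11 τ q * (tg g11 τ r * tg g11 τ s)))) * this

/-! classes -/

abbrev Ev (X : Z4) : Prop := X.1 % 2 = 0 ∧ X.2.1 % 2 = 0 ∧ X.2.2.1 % 2 = 0 ∧ X.2.2.2 % 2 = 0
abbrev Od (X : Z4) : Prop := X.1 % 2 = 1 ∧ X.2.1 % 2 = 1 ∧ X.2.2.1 % 2 = 1 ∧ X.2.2.2 % 2 = 1

abbrev Cls (X : Z4) : Prop := (¬ Ev X ∧ ¬ Od X ∧ eE X = 0 ∧ e1 X = 0) ∨ (Ev X ∧ sm X % 4 = 0 ∧ eE X = 0 ∧ e1 X = 0) ∨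
  (Ev X ∧ sm X % 4 = 2 ∧ eE X = 2 ∧ e1 X = 0) ∨ (Od X ∧ sm X % 4 = 0 ∧ eE X = -1 ∧ e1 X = 1) ∨ (Od X ∧ sm X % 4 = 2 ∧ eE X = -1 ∧ e1 X = -1)

abbrev q4 : List ℤ := [0, 1, 2, 3]

lemma cls_fin : ∀ a ∈ q4, ∀ b ∈ q4, ∀ c ∈ q4, ∀ d ∈ q4, Cls (a, b, c, d) := by decide +kernel

lemma cls (X : Z4) : Cls X := by
  obtain ⟨p, q, r, s⟩ := X
  have key : ∀ n : ℤ, n % 4 ∈ q4 := fun n => by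
    simp only [List.mem_cons, List.not_mem_nil, or_false]; omega
  have kg : ∀ n a : ℤ, n % 4 = a → g00 n = g00 a ∧ g01 n = g01 a ∧ g10 n = g10 a ∧ g11 n = g11 a := by
    intro n a h
    have h2 : n % 2 = a % 2 := by omega
    have h4 : n % 4 = a % 4 := by omega
    simp only [g00, g01, g10, g11, h2, h4, and_self]
  have h := cls_fin _ (key p) _ (key q) _ (key r) _ (key s)
  generalize ha : p % 4 = a at h
  generalize hb : q % 4 = b at h
  generalize hc : r % 4 = c at h
  generalize hd : s % 4 = d at h
  obtain ⟨a0, a1, a2, a3⟩ := kg p a ha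
  obtain ⟨b0, b1, b2, b3⟩ := kg q b hb
  obtain ⟨c0, c1, c2, c3⟩ := kg r c hc
  obtain ⟨d0, d1, d2, d3⟩ := kg s d hd
  have eh : eE (p, q, r, s) = eE (a, b, c, d) := by
    simp only [eE, P4, a0, a1, a2, b0, b1, b2, c0, c1, c2, d0, d1, d2]
  have eo : e1 (p, q, r, s) = e1 (a, b, c, d) := by
    simp only [e1, P4, a3, b3, c3, d3]
  have es : sm (p, q, r, s) % 4 = sm (a, b, c, d) % 4 := by
    simp only [sm]; omega
  have ee : Ev (p, q, r, s) ↔ Ev (a, b, c, d) := by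
    simp only [Ev]; omega
  have eod : Od (p, q, r, s) ↔ Od (a, b, c, d) := by
    simp only [Od]; omega
  unfold Cls
  rw [eh, eo, es, ee, eod]
  exact h

def Ph (X Y : Z4) : ℤ := eE X * e1 Y - e1 X * eE Y

lemma Ph_sw (X Y : Z4) : Ph Y X = - Ph X Y := by unfold Ph; ring

lemma Ph_sh (X Y : Z4) : Ph X (Y - X) = - Ph X Y := by
  obtain ⟨p, q, r, s⟩ := X
  obtain ⟨p', q', r', s'⟩ := Y
  have h1 := cls (p, q, r, s)
  have h2 := cls (p', q', r', s')
  have h3 := cls ((p', q', r', s') - (p, q, r, s))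
  simp only [Prod.mk_sub_mk] at h3 ⊢
  unfold Ph
  unfold Cls at h1 h2 h3
  rcases h1 with ⟨u1, w1, a1, b1⟩ | ⟨u1, w1, a1, b1⟩ | ⟨u1, w1, a1, b1⟩ | ⟨u1, w1, a1, b1⟩ | ⟨u1, w1, a1, b1⟩ <;> rw [a1, b1] <;> try (simp; done)
  all_goals
    rcases h2 with ⟨u2, w2, a2, b2⟩ | ⟨u2, w2, a2, b2⟩ | ⟨u2, w2, a2, b2⟩ | ⟨u2, w2, a2, b2⟩ | ⟨u2, w2, a2, b2⟩ <;>
    rcases h3 with ⟨u3, w3, a3, b3⟩ | ⟨u3, w3, a3, b3⟩ | ⟨u3, w3, a3, b3⟩ | ⟨u3, w3, a3, b3⟩ | ⟨u3, w3, a3, b3⟩ <;>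
    rw [a2, b2, a3, b3] <;> first | (norm_num; done) | (exfalso; simp only [Ev, Od, sm] at *; omega)

def dt (X Y : Z4) : ℤ := X.1 * Y.1 + X.2.1 * Y.2.1 + X.2.2.1 * Y.2.2.1 + X.2.2.2 * Y.2.2.2

lemma sq_od {n : ℤ} (h : n % 2 = 1) : ∃ k, n * n = 8 * k + 1 := by
  have := Int.sq_mod_four_eq_one_of_odd (Int.odd_iff.2 h)
  obtain ⟨k, rfl⟩ := Int.odd_iff.2 h
  obtain ⟨j, hj⟩ := Int.even_mul_succ_self k
  exact ⟨j, by linear_combination 4 * hj⟩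

lemma sq_ev {n : ℤ} (h : n % 2 = 0) : ∃ k, n * n = 8 * k + 2 * n := by
  obtain ⟨k, rfl⟩ := Int.even_iff.2 h
  obtain ⟨j, hj⟩ := Int.even_mul_succ_self (k - 1)
  exact ⟨j, by linear_combination 4 * hj⟩

lemma nrm {X : Z4} (h : eE X ≠ 0 ∨ e1 X ≠ 0) : dt X X % 8 = 4 := by
  have h1 := cls X
  obtain ⟨p, q, r, s⟩ := X
  unfold Cls at h1
  simp only [dt]
  rcases h1 with ⟨u1, w1, a1, b1⟩ | ⟨u1, w1, a1, b1⟩ | ⟨u1, w1, a1, b1⟩ | ⟨u1, w1, a1, b1⟩ | ⟨u1, w1, a1, b1⟩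
  · simp [a1, b1] at h
  · simp [a1, b1] at h
  · simp only [Ev, sm] at u1 w1
    obtain ⟨k1, e1⟩ := sq_ev u1.1
    obtain ⟨k2, e2⟩ := sq_ev u1.2.1
    obtain ⟨k3, e3⟩ := sq_ev u1.2.2.1
    obtain ⟨k4, e4⟩ := sq_ev u1.2.2.2
    omega
  all_goals
    simp only [Od] at u1
    obtain ⟨k1, e1⟩ := sq_od u1.1
    obtain ⟨k2, e2⟩ := sq_od u1.2.1
    obtain ⟨k3, e3⟩ := sq_od u1.2.2.1
    obtain ⟨k4, e4⟩ := sq_od u1.2.2.2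
    omega

lemma Ph_nrm {X Y : Z4} (h : Ph X Y ≠ 0) : dt X X % 8 = 4 ∧ dt Y Y % 8 = 4 := by
  constructor
  · refine nrm ?_
    by_contra! hc
    exact h (by rw [Ph, hc.1, hc.2]; ring)
  · refine nrm ?_
    by_contra! hc
    exact h (by rw [Ph, hc.1, hc.2]; ring)

lemma Ph_b (X Y : Z4) : |Ph X Y| ≤ 4 := by
  have h1 := cls X
  have h2 := cls Y
  unfold Cls at h1 h2
  have b1 : |eE X| ≤ 2 ∧ |e1 X| ≤ 1 := by
    rcases h1 with ⟨u1, w1, a1, b1⟩ | ⟨u1, w1, a1, b1⟩ | ⟨u1, w1, a1, b1⟩ | ⟨u1, w1, a1, b1⟩ | ⟨u1, w1, a1, b1⟩ <;> rw [a1, b1] <;> norm_num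
  have b2 : |eE Y| ≤ 2 ∧ |e1 Y| ≤ 1 := by
    rcases h2 with ⟨u1, w1, a1, b1⟩ | ⟨u1, w1, a1, b1⟩ | ⟨u1, w1, a1, b1⟩ | ⟨u1, w1, a1, b1⟩ | ⟨u1, w1, a1, b1⟩ <;> rw [a1, b1] <;> norm_num
  unfold Ph
  calc _ ≤ |eE X * e1 Y| + |e1 X * eE Y| := abs_sub _ _
    _ = |eE X| * |e1 Y| + |e1 X| * |eE Y| := by rw [abs_mul, abs_mul]
    _ ≤ 2 * 1 + 1 * 2 := by
      gcongr
      · exact b1.1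
      · exact b2.2
      · exact b1.2
      · exact b2.1
    _ = 4 := by norm_num

end P13

section P14

abbrev K8 := Z4 × Z4

def l1 (X : Z4) : ℝ := |(X.1:ℝ)| + |(X.2.1:ℝ)| + |(X.2.2.1:ℝ)| + |(X.2.2.2:ℝ)|

lemma l1_nonneg (X : Z4) : 0 ≤ l1 X := by unfold l1; positivity

def ud (X : Z4) : ℂ := X.1 + 2 * X.2.1 + 2 * X.2.2.1 + 3 * I * X.2.2.2

lemma ud_b (X : Z4) : ‖ud X‖ ≤ 3 * l1 X := by
  unfold ud l1
  refine (norm_add_le _ _).trans ?_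
  refine (add_le_add_left ((norm_add_le _ _).trans (add_le_add_left (norm_add_le _ _) _)) _).trans ?_
  simp only [norm_mul, Complex.norm_intCast, Complex.norm_I, Complex.norm_ofNat]
  have h1 := abs_nonneg (X.1:ℝ)
  have h2 := abs_nonneg (X.2.1:ℝ)
  have h3 := abs_nonneg (X.2.2.1:ℝ)
  linarith

def ex (a b c : ℂ) (k : K8) : ℂ := cexp (Real.pi * I / 4 * (dt k.1 k.1 * a + 2 * dt k.1 k.2 * b + dt k.2 k.2 * c))

def wq (δ R : ℝ) (X : Z4) : ℝ := Real.exp (-(Real.pi * δ / 4 * (dt X X : ℝ)) + R * l1 X)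

lemma wq_sum {δ : ℝ} (hδ : 0 < δ) (R : ℝ) : Summable (wq δ R) := by
  have h := sum_q (R / (2 * Real.pi)) (T := δ / 4) (by linarith)
  have h' : Summable fun n : ℤ => ‖Real.exp (-Real.pi * (δ / 4 * n ^ 2 - 2 * (R / (2 * Real.pi)) * |(n:ℝ)|))‖ := h.norm
  refine ((hs4 h' h' h' h').2.of_norm).congr fun X => ?_
  rw [← Real.exp_add, ← Real.exp_add, ← Real.exp_add, wq]
  congr 1
  unfold dt l1
  have := Real.pi_ne_zero
  push_cast
  field_simp
  ring

def bq (δ R : ℝ) (k : K8) : ℝ := wq δ R k.1 * wq δ R k.2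

lemma bq_sum {δ : ℝ} (hδ : 0 < δ) (R : ℝ) : Summable (bq δ R) :=
  (wq_sum hδ R).mul_of_nonneg (wq_sum hδ R) (fun _ => (Real.exp_pos _).le) (fun _ => (Real.exp_pos _).le)

def Gr (f : K8 → ℂ) : Prop := ∃ M R : ℝ, ∀ k, ‖f k‖ ≤ M * Real.exp (R * (l1 k.1 + l1 k.2))

lemma Gr.mul {f g : K8 → ℂ} (hf : Gr f) (hg : Gr g) : Gr fun k => f k * g k := by
  obtain ⟨M, R, h⟩ := hf
  obtain ⟨N, S, h'⟩ := hg
  refine ⟨M * N, R + S, fun k => ?_⟩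
  rw [norm_mul, add_mul, Real.exp_add, mul_mul_mul_comm]
  exact mul_le_mul (h k) (h' k) (norm_nonneg _) ((norm_nonneg _).trans (h k))

lemma Gr.pow {f : K8 → ℂ} (hf : Gr f) (n : ℕ) : Gr fun k => f k ^ n := by
  induction n with
  | zero => exact ⟨1, 0, fun k => by simp⟩
  | succ n ih => simpa only [pow_succ] using ih.mul hf

lemma Gr_Ph : Gr fun k => (Ph k.1 k.2 : ℂ) := ⟨4, 0, fun k => by
  rw [Complex.norm_intCast]; simpa using (by exact_mod_cast Ph_b k.1 k.2 : |(Ph k.1 k.2 : ℝ)| ≤ 4)⟩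

lemma Gr_u : (Gr fun k => ud k.1) ∧ Gr fun k => ud k.2 := by
  constructor <;> refine ⟨3, 1, fun k => (ud_b _).trans ?_⟩ <;> rw [one_mul] <;> gcongr <;>
    refine le_trans ?_ ((Real.add_one_le_exp _).trans' (le_add_of_nonneg_right one_pos.le))
  · have := l1_nonneg k.2; linarith
  · have := l1_nonneg k.1; linarith

def VV (δ : ℝ) : Set (Fin 2 → Fin 2 → ℂ) := {τ | δ < (τ 0 0).im ∧ (τ 0 1).im ^ 2 < ((τ 0 0).im - δ) * ((τ 1 1).im - δ)}

lemma VV_open (δ : ℝ) : IsOpen (VV δ) := by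
  have h1 : IsOpen {τ : Fin 2 → Fin 2 → ℂ | δ < (τ 0 0).im} := isOpen_lt (by fun_prop) (Complex.continuous_im.comp (by fun_prop))
  have h2 : IsOpen {τ : Fin 2 → Fin 2 → ℂ | (τ 0 1).im ^ 2 < ((τ 0 0).im - δ) * ((τ 1 1).im - δ)} := by
    have c (i j : Fin 2) : Continuous fun τ : Fin 2 → Fin 2 → ℂ => (τ i j).im := Complex.continuous_im.comp (by fun_prop)
    exact isOpen_lt ((c 0 1).pow 2) (((c 0 0).sub continuous_const).mul ((c 1 1).sub continuous_const))
  exact h1.inter h2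

lemma H2_VV {τ : Fin 2 → Fin 2 → ℂ} (h : τ ∈ H2) : ∃ δ > 0, τ ∈ VV δ := by
  rw [eq_tm h, tm_mem] at h
  have hc : Tendsto (fun δ : ℝ => ((τ 0 0).im - δ) * ((τ 1 1).im - δ)) (𝓝[>] 0) (𝓝 (((τ 0 0).im - 0) * ((τ 1 1).im - 0))) :=
    (Continuous.tendsto (by fun_prop) 0).mono_left nhdsWithin_le_nhds
  have h1 := hc.eventually (lt_mem_nhds (by simpa using h.2))
  have h2 : ∀ᶠ δ : ℝ in 𝓝[>] 0, δ < (τ 0 0).im := (eventually_lt_nhds h.1).filter_mono nhdsWithin_le_nhds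
  obtain ⟨δ, ⟨h1, h2⟩, h3⟩ := ((h1.and h2).and self_mem_nhdsWithin).exists
  exact ⟨δ, h3, h2, h1⟩

lemma ex_norm (a b c : ℂ) (k : K8) : ‖ex a b c k‖ = Real.exp (-(Real.pi / 4 * (dt k.1 k.1 * a.im + 2 * dt k.1 k.2 * b.im + dt k.2 k.2 * c.im))) := by
  rw [ex, Complex.norm_exp]
  congr 1
  have e : (Real.pi * I / 4 * (dt k.1 k.1 * a + 2 * dt k.1 k.2 * b + dt k.2 k.2 * c) : ℂ) =
    ((Real.pi / 4 : ℝ) : ℂ) * (((dt k.1 k.1 : ℝ) * a + (2 * dt k.1 k.2 : ℝ) * b + (dt k.2 k.2 : ℝ) * c) * I) := by push_cast; ring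
  rw [e, re_ofReal_mul, mul_I_re, add_im, add_im, im_ofReal_mul, im_ofReal_mul, im_ofReal_mul]
  ring

lemma qf {A B C : ℝ} (hA : 0 < A) (h : B ^ 2 ≤ A * C) (p q : ℝ) : 0 ≤ p * p * A + 2 * (p * q) * B + q * q * C := by
  have : 0 ≤ A * (p * p * A + 2 * (p * q) * B + q * q * C) := by
    have e : A * (p * p * A + 2 * (p * q) * B + q * q * C) = (A * p + B * q) ^ 2 + q ^ 2 * (A * C - B ^ 2) := by ring
    rw [e]
    have := sub_nonneg.2 h
    positivity
  exact nonneg_of_mul_nonneg_right this hA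

lemma ex_b {δ : ℝ} {τ : Fin 2 → Fin 2 → ℂ} (h : τ ∈ VV δ) (k : K8) (R : ℝ) :
    ‖ex (τ 0 0) (τ 0 1) (τ 1 1) k‖ * Real.exp (R * (l1 k.1 + l1 k.2)) ≤ bq δ R k := by
  rw [ex_norm, bq, wq, wq, ← Real.exp_add, ← Real.exp_add]
  refine Real.exp_le_exp.2 ?_
  have hA := sub_pos.2 h.1
  obtain ⟨⟨p, q, r, s⟩, p', q', r', s'⟩ := k
  have h1 := qf hA h.2.le p p'
  have h2 := qf hA h.2.le q q'
  have h3 := qf hA h.2.le r r'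
  have h4 := qf hA h.2.le s s'
  have h5 := mul_nonneg (Real.pi_pos.le) (add_nonneg (add_nonneg h1 h2) (add_nonneg h3 h4))
  simp only [dt]
  push_cast
  linarith

lemma Gr.bd {f : K8 → ℂ} (hf : Gr f) : ∃ M R : ℝ, ∀ δ, ∀ τ ∈ VV δ, ∀ k, ‖f k * ex (τ 0 0) (τ 0 1) (τ 1 1) k‖ ≤ M * bq δ R k := by
  obtain ⟨M, R, h⟩ := hf
  refine ⟨M, R, fun δ τ hτ k => ?_⟩
  have hM : 0 ≤ M := by
    have := (norm_nonneg _).trans (h k)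
    exact nonneg_of_mul_nonneg_left this (Real.exp_pos _)
  rw [norm_mul]
  refine (mul_le_mul_of_nonneg_right (h k) (norm_nonneg _)).trans ?_
  rw [mul_assoc, mul_comm (Real.exp _)]
  exact mul_le_mul_of_nonneg_left (ex_b hτ k R) hM

lemma Gr.sum' {f : K8 → ℂ} (hf : Gr f) {τ : Fin 2 → Fin 2 → ℂ} (h : τ ∈ H2) : Summable fun k => ‖f k * ex (τ 0 0) (τ 0 1) (τ 1 1) k‖ := by
  obtain ⟨M, R, hb⟩ := hf.bd
  obtain ⟨δ, hδ, hV⟩ := H2_VV h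
  exact Summable.of_nonneg_of_le (fun _ => norm_nonneg _) (hb δ τ hV) ((bq_sum hδ R).mul_left M)

lemma Gr.sum {f : K8 → ℂ} (hf : Gr f) {a b c : ℂ} (h : tm a b c ∈ H2) : Summable fun k => ‖f k * ex a b c k‖ := by
  have := hf.sum' h
  exact this

lemma dt_b (k : K8) : |(dt k.1 k.1 : ℝ)| ≤ (l1 k.1 + l1 k.2) ^ 2 ∧ |(dt k.1 k.2 : ℝ)| ≤ (l1 k.1 + l1 k.2) ^ 2 ∧ |(dt k.2 k.2 : ℝ)| ≤ (l1 k.1 + l1 k.2) ^ 2 := by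
  have h : ∀ X Y : Z4, |(dt X Y : ℝ)| ≤ l1 X * l1 Y := by
    intro X Y
    unfold dt l1
    push_cast
    refine (abs_add_le _ _).trans ((add_le_add_left ((abs_add_le _ _).trans (add_le_add_left (abs_add_le _ _) _)) _).trans ?_)
    simp only [abs_mul, add_mul, mul_add]
    have : ∀ p q : ℤ, 0 ≤ |(p:ℝ)| * |(q:ℝ)| := fun p q => by positivity
    linarith [this X.1 Y.2.1, this X.1 Y.2.2.1, this X.1 Y.2.2.2, this X.2.1 Y.1, this X.2.1 Y.2.2.1, this X.2.1 Y.2.2.2,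
      this X.2.2.1 Y.1, this X.2.2.1 Y.2.1, this X.2.2.1 Y.2.2.2, this X.2.2.2 Y.1, this X.2.2.2 Y.2.1, this X.2.2.2 Y.2.2.1]
  have h1 := l1_nonneg k.1
  have h2 := l1_nonneg k.2
  have h3 := mul_nonneg h1 h2
  have h4 := mul_nonneg h1 h1
  have h5 := mul_nonneg h2 h2
  refine ⟨(h _ _).trans ?_, (h _ _).trans ?_, (h _ _).trans ?_⟩ <;> linarith

def prj (i j : Fin 2) : (Fin 2 → Fin 2 → ℂ) →L[ℂ] ℂ :=
  (ContinuousLinearMap.proj (R := ℂ) (φ := fun _ : Fin 2 => ℂ) j).comp (ContinuousLinearMap.proj (R := ℂ) (φ := fun _ : Fin 2 => Fin 2 → ℂ) i)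

def Lk (k : K8) : (Fin 2 → Fin 2 → ℂ) →L[ℂ] ℂ :=
  (Real.pi * I / 4 : ℂ) • (((dt k.1 k.1 : ℂ) • prj 0 0 + (2 * dt k.1 k.2 : ℂ) • prj 0 1) + (dt k.2 k.2 : ℂ) • prj 1 1)

lemma Lk_gr : Gr fun k => (‖Lk k‖ : ℂ) := by
  refine ⟨Real.pi / 4 * (2 * ‖prj 0 0‖ + 4 * ‖prj 0 1‖ + 2 * ‖prj 1 1‖), 1, fun k => ?_⟩
  obtain ⟨h1, h2, h3⟩ := dt_b k
  have h4 : (l1 k.1 + l1 k.2) ^ 2 ≤ 2 * Real.exp (l1 k.1 + l1 k.2) := by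
    have := Real.pow_div_factorial_le_exp (l1 k.1 + l1 k.2) (add_nonneg (l1_nonneg _) (l1_nonneg _)) 2
    norm_num at this
    linarith
  rw [Complex.norm_real, norm_norm, Lk, norm_smul, one_mul, mul_assoc]
  have e : ‖(Real.pi * I / 4 : ℂ)‖ = Real.pi / 4 := by simp [abs_of_pos Real.pi_pos]
  rw [e]
  have := Real.pi_pos
  gcongr
  refine (norm_add_le _ _).trans ((add_le_add_left (norm_add_le _ _) _).trans ?_)
  simp only [norm_smul, norm_mul, Complex.norm_intCast, Complex.norm_ofNat]
  have g1 := mul_le_mul_of_nonneg_right (h1.trans h4) (norm_nonneg (prj 0 0))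
  have g2 := mul_le_mul_of_nonneg_right (h2.trans h4) (norm_nonneg (prj 0 1))
  have g3 := mul_le_mul_of_nonneg_right (h3.trans h4) (norm_nonneg (prj 1 1))
  linarith

lemma Gr.diff {f : K8 → ℂ} (hf : Gr f) : DifferentiableOn ℂ (fun τ : Fin 2 → Fin 2 → ℂ => ∑' k, f k * ex (τ 0 0) (τ 0 1) (τ 1 1) k) H2 := by
  intro τ hτ
  obtain ⟨M, R, hb⟩ := (hf.mul Lk_gr).bd
  obtain ⟨δ, hδ, hV⟩ := H2_VV hτ
  obtain ⟨r, hr, hB⟩ := Metric.isOpen_iff.1 (VV_open δ) τ hV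
  have key := fun h1 h2 => hasFDerivAt_tsum_of_isPreconnected (f := fun k (σ : Fin 2 → Fin 2 → ℂ) => f k * ex (σ 0 0) (σ 0 1) (σ 1 1) k)
    (f' := fun k σ => (f k * ex (σ 0 0) (σ 0 1) (σ 1 1) k) • Lk k) ((bq_sum hδ R).mul_left M) Metric.isOpen_ball
    (convex_ball τ r).isPreconnected h1 h2 (Metric.mem_ball_self hr) (hf.sum' hτ).of_norm (Metric.mem_ball_self hr)
  refine (key (fun k σ hσ => ?_) (fun k σ hσ => ?_)).differentiableAt.differentiableWithinAt
  · have h1 : HasFDerivAt (fun σ => Lk k σ) (Lk k) σ := (Lk k).hasFDerivAt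
    have h2 := (h1.cexp).const_mul (f k)
    have e : ∀ σ, cexp (Lk k σ) = ex (σ 0 0) (σ 0 1) (σ 1 1) k := fun σ => by
      rw [ex]; rfl
    simp only [e, smul_smul] at h2
    exact h2
  · have := hb δ σ (hB hσ) k
    rw [norm_smul]
    rw [mul_right_comm, norm_mul, Complex.norm_real, norm_norm] at this
    exact this

def mon (i : ℕ) (k : K8) : ℂ := Ph k.1 k.2 * (ud k.1 ^ (18 - i) * ud k.2 ^ i)

lemma Gr_mon (i : ℕ) : Gr (mon i) := Gr_Ph.mul ((Gr_u.1.pow _).mul (Gr_u.2.pow _))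

open Classical in
def F0 (τ : Fin 2 → Fin 2 → ℂ) (i : Fin (18 + 1)) : ℂ :=
  if τ ∈ H2 then (Nat.choose 18 i : ℂ) * ∑' k, mon i k * ex (τ 0 0) (τ 0 1) (τ 1 1) k else 0

lemma F0_off (τ) (h : τ ∉ H2) : F0 τ = 0 := by
  funext i; rw [F0, if_neg h]; rfl

lemma F0_on {a b c : ℂ} (h : tm a b c ∈ H2) (i) : F0 (tm a b c) i = (Nat.choose 18 i : ℂ) * ∑' k, mon i k * ex a b c k := by
  rw [F0, if_pos h]; rfl

lemma F0_diff : DifferentiableOn ℂ F0 H2 := by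
  rw [differentiableOn_pi]
  intro i
  refine ((Gr_mon i).diff.const_mul (Nat.choose 18 i : ℂ)).congr fun τ hτ => ?_
  rw [F0, if_pos hτ]

def lx (x y : ℂ) (k : K8) : ℂ := ud k.1 * x + ud k.2 * y

lemma F0_pv {a b c : ℂ} (h : tm a b c ∈ H2) (x y : ℂ) :
    pv (j := 18) (F0 (tm a b c)) x y = ∑' k, Ph k.1 k.2 * ex a b c k * lx x y k ^ 18 := by
  have h1 : ∀ k, (Ph k.1 k.2 : ℂ) * ex a b c k * lx x y k ^ 18 = ∑ i : Fin 19, (Nat.choose 18 i : ℂ) * (mon i k * ex a b c k) * (x ^ (18 - (i:ℕ)) * y ^ (i:ℕ)) := by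
    intro k
    rw [lx, add_comm (ud k.1 * x), add_pow, Finset.mul_sum, Finset.sum_range]
    refine Finset.sum_congr rfl fun i _ => ?_
    rw [mon, mul_pow, mul_pow]; ring
  simp only [h1]
  rw [Summable.tsum_finsetSum]
  · rw [pv]
    refine Finset.sum_congr rfl fun i _ => ?_
    rw [F0_on h, tsum_mul_right, tsum_mul_left]
  · intro i _
    exact (((Gr_mon i).sum h).of_norm.mul_left _).mul_right _

end P14

section P15

lemma F0_t1 (a b c : ℂ) (h : tm a b c ∈ H2) : F0 (tm (a+1) b c) = - F0 (tm a b c) := by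
  have h' : tm (a+1) b c ∈ H2 := by rw [tm_mem] at h ⊢; simpa using h
  funext i
  rw [Pi.neg_apply, F0_on h, F0_on h', ← mul_neg, ← tsum_neg]
  congr 1
  refine tsum_congr fun k => ?_
  by_cases hp : Ph k.1 k.2 = 0
  · simp [mon, hp]
  · have hn := (Ph_nrm hp).1
    have e : ex (a+1) b c k = ex a b c k * cexp (Real.pi * I * ((dt k.1 k.1 / 4 : ℤ) : ℂ)) := by
      rw [ex, ex, ← Complex.exp_add]
      congr 1
      have : dt k.1 k.1 = 4 * (dt k.1 k.1 / 4) := by omega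
      have : (dt k.1 k.1 : ℂ) = 4 * (dt k.1 k.1 / 4 : ℤ) := by exact_mod_cast this
      linear_combination (Real.pi * I / 4) * this
    rw [e, sgn_exp, if_neg (by omega)]; ring

lemma dt_comm (X Y : Z4) : dt X Y = dt Y X := by unfold dt; ring

lemma F0_s (a b c : ℂ) (h : tm a b c ∈ H2) (x y : ℂ) : pv (j := 18) (F0 (tm c b a)) x y = - pv (j := 18) (F0 (tm a b c)) y x := by
  have h' : tm c b a ∈ H2 := by
    rw [tm_mem] at h ⊢
    refine ⟨?_, by linarith [mul_comm a.im c.im]⟩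
    exact pos_of_mul_pos_right ((sq_nonneg _).trans_lt h.2) h.1.le
  rw [F0_pv h, F0_pv h', ← (Equiv.prodComm Z4 Z4).tsum_eq, ← tsum_neg]
  refine tsum_congr fun k => ?_
  simp only [Equiv.prodComm_apply, Prod.fst_swap, Prod.snd_swap, ex, lx, Ph_sw k.1 k.2, dt_comm k.2 k.1]
  push_cast
  rw [add_right_comm, add_comm (_ * c), add_right_comm, add_comm (_ * x)]
  rw [neg_mul, neg_mul]

def shE : K8 ≃ K8 where
  toFun k := (k.1, k.2 - k.1)
  invFun k := (k.1, k.2 + k.1)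
  left_inv k := by simp
  right_inv k := by simp

lemma F0_u (a b c : ℂ) (h : tm a b c ∈ H2) (x y : ℂ) : pv (j := 18) (F0 (tm (a+2*b+c) (b+c) c)) x y = - pv (j := 18) (F0 (tm a b c)) (x - y) y := by
  have h' : tm (a+2*b+c) (b+c) c ∈ H2 := by
    rw [tm_mem] at h ⊢
    have hc : 0 < c.im := pos_of_mul_pos_right ((sq_nonneg _).trans_lt h.2) h.1.le
    have e2 : (2 * b : ℂ).im = 2 * b.im := by simp
    simp only [add_im, e2]
    refine ⟨?_, by linarith [h.2, show (b.im + c.im)^2 = b.im^2 + 2*b.im*c.im + c.im*c.im by ring,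
      show (a.im + 2*b.im + c.im) * c.im = a.im * c.im + 2 * b.im*c.im + c.im*c.im by ring]⟩
    have := h.2
    have : 0 < (a.im + 2 * b.im + c.im) * c.im := by
      have e : (a.im + 2 * b.im + c.im) * c.im = (a.im * c.im - b.im ^ 2) + (b.im + c.im) ^ 2 := by ring
      rw [e]; have := sq_nonneg (b.im + c.im); linarith
    exact pos_of_mul_pos_left this hc.le
  rw [F0_pv h, F0_pv h', ← shE.tsum_eq, ← tsum_neg]
  refine tsum_congr fun k => ?_
  have e1 : ex (a+2*b+c) (b+c) c (shE k) = ex a b c k := by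
    unfold ex shE; congr 2
    simp only [Equiv.coe_fn_mk, dt, Prod.fst_sub, Prod.snd_sub]
    push_cast; ring
  have e2 : lx x y (shE k) = lx (x - y) y k := by
    unfold lx shE ud
    simp only [Equiv.coe_fn_mk, Prod.fst_sub, Prod.snd_sub]
    push_cast; ring
  rw [e1, e2]
  simp only [shE, Equiv.coe_fn_mk, Ph_sh]
  push_cast; ring

def cn (a b c x y : ℂ) (n : ℕ) : ℂ := ∑' k, Ph k.1 k.2 * ex a b c k * lx x y k ^ n
def GG (a b c x y : ℂ) : ℂ := ∑' k, Ph k.1 k.2 * ex a b c k * cexp (lx x y k)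

lemma lx_b (x y : ℂ) (k : K8) : ‖lx x y k‖ ≤ 3 * (‖x‖ + ‖y‖) * (l1 k.1 + l1 k.2) := by
  unfold lx
  refine (norm_add_le _ _).trans ?_
  rw [norm_mul, norm_mul]
  have h1 := mul_le_mul_of_nonneg_right (ud_b k.1) (norm_nonneg x)
  have h2 := mul_le_mul_of_nonneg_right (ud_b k.2) (norm_nonneg y)
  have h3 := mul_nonneg (l1_nonneg k.1) (norm_nonneg y)
  have h4 := mul_nonneg (l1_nonneg k.2) (norm_nonneg x)
  linarith

lemma Gr_e (x y : ℂ) : Gr fun k => (Real.exp ‖lx x y k‖ : ℂ) :=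
  ⟨1, 3 * (‖x‖ + ‖y‖), fun k => by
    rw [Complex.norm_real, Real.norm_eq_abs, Real.abs_exp, one_mul]
    exact Real.exp_le_exp.2 (lx_b x y k)⟩

lemma dbl8 {a b c : ℂ} (h : tm a b c ∈ H2) (x y : ℂ) :
    Summable fun q : K8 × ℕ => Ph q.1.1 q.1.2 * ex a b c q.1 * (lx x y q.1 ^ q.2 / q.2.factorial) := by
  rw [← summable_norm_iff]
  have hE : ∀ k : K8, HasSum (fun n : ℕ => ‖Ph k.1 k.2 * ex a b c k * (lx x y k ^ n / n.factorial)‖)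
      (‖Ph k.1 k.2 * ex a b c k‖ * Real.exp ‖lx x y k‖) := by
    intro k
    have h1 : HasSum (fun n : ℕ => ‖lx x y k‖ ^ n / n.factorial) (Real.exp ‖lx x y k‖) := by
      rw [Real.exp_eq_exp_ℝ]
      exact NormedSpace.expSeries_div_hasSum_exp _
    refine (h1.mul_left _).congr_fun fun n => ?_
    rw [norm_mul _ (_ / _), norm_div, norm_pow, Complex.norm_natCast]
  rw [summable_prod_of_nonneg (fun _ => norm_nonneg _)]
  refine ⟨fun p => (hE p).summable, ?_⟩
  simp only [fun p => (hE p).tsum_eq]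
  refine ((Gr_Ph.mul (Gr_e x y)).sum h).congr fun k => ?_
  rw [norm_mul, norm_mul, norm_mul, Complex.norm_real, Real.norm_eq_abs, Real.abs_exp]; ring

lemma taylor8 {a b c : ℂ} (h : tm a b c ∈ H2) (x y s : ℂ) :
    HasSum (fun n : ℕ => cn a b c x y n / n.factorial * s ^ n) (GG a b c (s * x) (s * y)) := by
  have hl : ∀ k, lx (s * x) (s * y) k = s * lx x y k := fun k => by unfold lx; ring
  refine swap_sum (dbl8 h (s * x) (s * y)) (fun k => ?_) (fun n => ?_)
  · have : HasSum (fun n : ℕ => (lx (s * x) (s * y) k) ^ n / n.factorial) (cexp (lx (s * x) (s * y) k)) := by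
      rw [Complex.exp_eq_exp_ℂ]
      exact NormedSpace.expSeries_div_hasSum_exp _
    have e2 := this.mul_left (Ph k.1 k.2 * ex a b c k)
    dsimp only
    exact e2
  · have h0 := (dbl8 h x y).prod_symm.prod_factor n
    have h2 : (n.factorial : ℂ) ≠ 0 := by exact_mod_cast n.factorial_ne_zero
    have h1 : Summable fun k : K8 => Ph k.1 k.2 * ex a b c k * lx x y k ^ n := by
      refine (h0.mul_right (n.factorial : ℂ)).congr fun p => ?_
      simp only [Prod.swap]
      field_simp
    refine ((h1.hasSum.div_const (n.factorial : ℂ)).mul_right (s ^ n)).congr_fun fun k => ?_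
    simp only [hl, mul_pow]
    ring

def Zv (a b x : ℂ) (Y : Z4) : ℂ × ℂ × ℂ × ℂ :=
  (Y.1 * b / 2 + a * x / (Real.pi * I), Y.2.1 * b / 2 + a * x * 2 / (Real.pi * I), Y.2.2.1 * b / 2 + a * x * 2 / (Real.pi * I),
    Y.2.2.2 * b / 2 + a * x * (3 * I) / (Real.pi * I))

lemma piI : (Real.pi * I : ℂ) ≠ 0 := by simp [Real.pi_ne_zero]

lemma GG_fib {a b c : ℂ} (h : tm a b c ∈ H2) (x y : ℂ) : GG a b c x y = ∑' Y : Z4, ∑' X : Z4, Ph X Y * ex a b c (X, Y) * cexp (lx x y (X, Y)) := by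
  have hs : Summable fun k : K8 => Ph k.1 k.2 * ex a b c k * cexp (lx x y k) := by
    refine Summable.of_norm_bounded ((Gr_Ph.mul (Gr_e x y)).sum h) fun k => ?_
    rw [norm_mul, norm_mul, norm_mul, norm_mul, Complex.norm_real, Real.norm_eq_abs, Real.abs_exp, mul_right_comm]
    gcongr
    exact Complex.norm_exp_le_exp_norm _
  rw [GG, ← (Equiv.prodComm Z4 Z4).tsum_eq, Summable.tsum_prod]
  · rfl
  · exact (Equiv.prodComm Z4 Z4).summable_iff.2 hs

lemma inner8 {τ : ℂ} (hτ : 0 < τ.im) (Y : Z4) (Z : ℂ × ℂ × ℂ × ℂ) (f : Z4 → ℂ) (C : ℂ) (hf : ∀ X, f X = C * E4 τ Z X) :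
    ∑' X : Z4, Ph X Y * f X = C * (e1 Y * TE τ Z - eE Y * T1 τ Z) := by
  rw [TE, T1, ← tsum_mul_left, ← tsum_mul_left, ← Summable.tsum_sub, ← tsum_mul_left]
  · refine tsum_congr fun X => ?_
    rw [hf, Ph]; push_cast; ring
  · exact (TE_sum hτ Z).summable.mul_left _
  · exact (T1_sum hτ Z).summable.mul_left _

lemma GG_fe {a b c : ℂ} (h : tm a b c ∈ H2) (x y : ℂ) : GG (-1/a) (b/a) (c-b^2/a) x y = -a^2 * GG a b c (a * x) (b * x + y) := by
  have ha : 0 < a.im := (tm_mem.1 h).1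
  have ha0 : a ≠ 0 := by rintro rfl; simp at ha
  rw [GG_fib (tm_J h), GG_fib h, ← tsum_mul_left]
  refine tsum_congr fun Y => ?_
  simp only [mul_assoc (Ph _ _ : ℂ)]
  have hpi := piI
  rw [inner8 (im_S ha) Y ((Zv a b x Y).1 / a, (Zv a b x Y).2.1 / a, (Zv a b x Y).2.2.1 / a, (Zv a b x Y).2.2.2 / a) _
      (cexp (Real.pi * I / 4 * (dt Y Y * (c-b^2/a)) + ud Y * y)), TE_fe ha, T1_fe ha,
    inner8 ha Y (Zv a b x Y) _ (cexp (Real.pi * I / 4 * (dt Y Y * c) + ud Y * (b * x + y)))]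
  · have e : cexp (Real.pi * I / 4 * (dt Y Y * c) + ud Y * (b * x + y)) = cexp (Real.pi * I / 4 * (dt Y Y * (c-b^2/a)) + ud Y * y) *
      cexp (Real.pi * I * ((Zv a b x Y).1 ^ 2 + (Zv a b x Y).2.1 ^ 2 + (Zv a b x Y).2.2.1 ^ 2 + (Zv a b x Y).2.2.2 ^ 2) / a) := by
      rw [← Complex.exp_add]
      congr 1
      simp only [Zv, dt, ud]
      push_cast
      have hI : I ^ 2 = -1 := I_sq
      generalize (Real.pi * I : ℂ) = P at hpi ⊢
      linear_combination (norm := (field_simp; ring)) (-9 * a * x ^ 2 / P) * hI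
    rw [e]
    ring
  · intro X
    simp only [ex, E4, et, ← Complex.exp_add, Zv, lx, ud, dt]
    congr 1
    push_cast
    field_simp
    ring
  · intro X
    simp only [ex, E4, et, ← Complex.exp_add, Zv, lx, ud, dt]
    congr 1
    push_cast
    field_simp
    ring

lemma F0_jj (a b c : ℂ) (h : tm a b c ∈ H2) (x y : ℂ) :
    pv (j := 18) (F0 (tm (-1/a) (b/a) (c-b^2/a))) x y = - a^2 * pv (j := 18) (F0 (tm a b c)) (a*x) (b*x+y) := by
  rw [F0_pv h, F0_pv (tm_J h)]
  have := powU (fun n => cn (-1/a) (b/a) (c-b^2/a) x y n / n.factorial - (-a^2) * (cn a b c (a*x) (b*x+y) n / n.factorial)) (fun s => ?_) 18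
  · have h2 : ((Nat.factorial 18 : ℕ) : ℂ) ≠ 0 := by exact_mod_cast Nat.factorial_ne_zero 18
    change cn (-1/a) (b/a) (c-b^2/a) x y 18 = -a^2 * cn a b c (a*x) (b*x+y) 18
    rw [← mul_div_assoc, ← sub_div, div_eq_zero_iff, sub_eq_zero] at this
    exact this.resolve_right h2
  · have h1 := (taylor8 (tm_J h) x y s).sub ((taylor8 h (a*x) (b*x+y) s).mul_left (-a^2))
    rw [GG_fe h, show a * (s * x) = s * (a * x) by ring, show b * (s * x) + s * y = s * (b * x + y) by ring, sub_self] at h1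
    refine h1.congr_fun fun n => ?_
    ring

lemma F0_laws : Laws F0 := ⟨F0_t1, F0_s, F0_u, F0_jj⟩

end P15

section P16

lemma lim8 (c : K8 → ℂ) (q : K8 → ℝ) (hq : ∀ k, c k ≠ 0 → 0 ≤ q k) (hs : Summable fun k => ‖c k * Real.exp (-q k)‖) :
    Tendsto (fun t : ℝ => ∑' k, c k * Real.exp (-(t * q k))) atTop (𝓝 (∑' k, if q k = 0 then c k else 0)) := by
  refine tendsto_tsum_of_dominated_convergence hs (fun k => ?_) ?_
  · by_cases hc : c k = 0
    · simp [hc]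
    · by_cases h0 : q k = 0
      · simp [h0]
      · rw [if_neg h0]
        have hp : 0 < q k := lt_of_le_of_ne (hq k hc) (Ne.symm h0)
        have h1 : Tendsto (fun t : ℝ => Real.exp (-(t * q k))) atTop (𝓝 0) :=
          Real.tendsto_exp_neg_atTop_nhds_zero.comp (tendsto_id.atTop_mul_const hp)
        have h2 := ((Complex.continuous_ofReal.tendsto 0).comp h1).const_mul (c k)
        simpa using h2
  · filter_upwards [eventually_ge_atTop 1] with t ht k
    by_cases hc : c k = 0
    · simp [hc]
    · rw [norm_mul, norm_mul]
      refine mul_le_mul_of_nonneg_left ?_ (norm_nonneg _)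
      rw [Complex.norm_real, Complex.norm_real, Real.norm_eq_abs, Real.norm_eq_abs, Real.abs_exp, Real.abs_exp]
      refine Real.exp_le_exp.2 (neg_le_neg ?_)
      exact le_mul_of_one_le_left (hq k hc) ht

lemma dt_nn (X : Z4) : 0 ≤ dt X X := by
  unfold dt
  have := mul_self_nonneg X.1
  have := mul_self_nonneg X.2.1
  have := mul_self_nonneg X.2.2.1
  have := mul_self_nonneg X.2.2.2
  linarith

lemma mon_ph {i : ℕ} {k : K8} (h : mon i k ≠ 0) : Ph k.1 k.2 ≠ 0 := by
  intro h'; apply h; simp [mon, h']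

lemma F0_cusp (τ₁ : ℂ) (hτ : 0 < τ₁.im) : Tendsto (fun t : ℝ => F0 (tm τ₁ 0 (t * I))) atTop (𝓝 0) := by
  rw [tendsto_pi_nhds]
  intro i
  have hm : ∀ t : ℝ, 0 < t → tm τ₁ 0 (t * I) ∈ H2 := fun t ht => by
    rw [tm_mem]; refine ⟨hτ, ?_⟩
    have := mul_pos hτ ht
    simpa using this
  have he : ∀ (t : ℝ) (k : K8), ex τ₁ 0 (t * I) k = ex τ₁ 0 0 k * Real.exp (-(t * (Real.pi / 4 * dt k.2 k.2))) := by
    intro t k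
    rw [ex, ex, Complex.ofReal_exp, ← Complex.exp_add]
    congr 1
    push_cast
    linear_combination (Real.pi / 4 * dt k.2 k.2 * t : ℂ) * I_sq
  have h := lim8 (fun k => mon i k * ex τ₁ 0 0 k) (fun k => Real.pi / 4 * dt k.2 k.2) (fun k _ => by
    have : (0:ℝ) ≤ dt k.2 k.2 := by exact_mod_cast dt_nn k.2
    have := Real.pi_pos
    positivity) (by
    refine ((Gr_mon i).sum (hm 1 one_pos)).congr fun k => ?_
    rw [he, one_mul, mul_assoc])
  have e0 : ∀ k : K8, (if Real.pi / 4 * (dt k.2 k.2 : ℝ) = 0 then mon i k * ex τ₁ 0 0 k else 0) = 0 := by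
    intro k
    split_ifs with h0
    · by_contra hc
      have h1 := (Ph_nrm (mon_ph (left_ne_zero_of_mul hc))).2
      have h2 : (dt k.2 k.2 : ℝ) = 0 := by
        rcases mul_eq_zero.1 h0 with h | h
        · have := Real.pi_pos; linarith
        · exact h
      have h3 : dt k.2 k.2 = 0 := by exact_mod_cast h2
      omega
    · rfl
  simp only [e0, tsum_zero] at h
  have h2 := h.const_mul (Nat.choose 18 i : ℂ)
  rw [mul_zero] at h2
  refine h2.congr' ?_
  filter_upwards [eventually_gt_atTop 0] with t ht
  rw [F0_on (hm t ht)]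
  congr 1
  refine tsum_congr fun k => ?_
  rw [he, mul_assoc]

def udZ (X : Z4) : GaussianInt := ⟨X.1 + 2 * X.2.1 + 2 * X.2.2.1, 3 * X.2.2.2⟩
def monZ (k : K8) : GaussianInt := (Ph k.1 k.2 : GaussianInt) * (udZ k.1 ^ 3 * udZ k.2 ^ 15)

lemma monZ_c (k : K8) : GaussianInt.toComplex (monZ k) = mon 15 k := by
  have : ∀ X, GaussianInt.toComplex (udZ X) = ud X := fun X => by
    rw [GaussianInt.toComplex_def, udZ, ud]; push_cast; ring
  rw [monZ, map_mul, map_mul, map_pow, map_pow, this, this, map_intCast, mon]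

def bx : Finset ℤ := Finset.Icc (-2) 2
def S4 : Finset Z4 := (bx ×ˢ bx ×ˢ bx ×ˢ bx).filter fun X => dt X X = 4

lemma S4_mem {X : Z4} (h : dt X X = 4) : X ∈ S4 := by
  have h' := h
  obtain ⟨p, q, r, s⟩ := X
  simp only [dt] at h
  have b : ∀ n : ℤ, n * n ≤ 4 → n ∈ bx := fun n hn => by
    rw [bx, Finset.mem_Icc]; constructor <;> nlinarith
  have := mul_self_nonneg p
  have := mul_self_nonneg q
  have := mul_self_nonneg r
  have := mul_self_nonneg s
  simp only [S4, Finset.mem_filter, Finset.mem_product]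
  exact ⟨⟨b _ (by linarith), b _ (by linarith), b _ (by linarith), b _ (by linarith)⟩, h'⟩

lemma fin_ne : (∑ k ∈ S4 ×ˢ S4, if dt k.1 k.2 = 2 then monZ k else 0) ≠ 0 := by decide +kernel

lemma F0_ne : F0 ≠ 0 := by
  intro hF
  have hm : ∀ t : ℝ, 0 < t → tm (2 * t * I) (-t * I) (2 * t * I) ∈ H2 := fun t ht => by
    rw [tm_mem]
    have e : (2 * t * I : ℂ).im = 2 * t := by simp
    have e' : (-t * I : ℂ).im = -t := by simp
    rw [e, e']
    refine ⟨by linarith, ?_⟩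
    have := mul_pos ht ht
    nlinarith
  have he : ∀ (t : ℝ) (k : K8), ex (2 * t * I) (-t * I) (2 * t * I) k =
      Real.exp (-(t * (Real.pi / 4 * (2 * dt k.1 k.1 - 2 * dt k.1 k.2 + 2 * dt k.2 k.2 - 12)))) * Real.exp (-(t * (3 * Real.pi))) := by
    intro t k
    rw [ex, Complex.ofReal_exp, Complex.ofReal_exp, ← Complex.exp_add]
    congr 1
    push_cast
    linear_combination (Real.pi / 4 * t * (2 * dt k.1 k.1 - 2 * dt k.1 k.2 + 2 * dt k.2 k.2) : ℂ) * I_sq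
  have hd : ∀ k : K8, dt (k.2 - k.1) (k.2 - k.1) = dt k.1 k.1 - 2 * dt k.1 k.2 + dt k.2 k.2 := fun k => by
    simp only [dt, Prod.fst_sub, Prod.snd_sub]; ring
  have hph : ∀ k : K8, Ph k.1 k.2 ≠ 0 → 4 ≤ dt k.1 k.1 ∧ 4 ≤ dt k.2 k.2 ∧ 4 ≤ dt k.1 k.1 - 2 * dt k.1 k.2 + dt k.2 k.2 := by
    intro k hk
    have h1 := Ph_nrm hk
    have h2 := Ph_nrm (X := k.1) (Y := k.2 - k.1) (by rw [Ph_sh]; exact neg_ne_zero.2 hk)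
    rw [hd] at h2
    have h3 := dt_nn k.1
    have h4 := dt_nn k.2
    have h5 := dt_nn (k.2 - k.1)
    rw [hd] at h5
    omega
  have h := lim8 (mon 15) (fun k => Real.pi / 4 * (2 * dt k.1 k.1 - 2 * dt k.1 k.2 + 2 * dt k.2 k.2 - 12)) (fun k hk => by
    obtain ⟨h1, h2, h3⟩ := hph k (mon_ph hk)
    have h4 : (0:ℤ) ≤ 2 * dt k.1 k.1 - 2 * dt k.1 k.2 + 2 * dt k.2 k.2 - 12 := by linarith
    have h4 : (0:ℝ) ≤ 2 * dt k.1 k.1 - 2 * dt k.1 k.2 + 2 * dt k.2 k.2 - 12 := by exact_mod_cast h4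
    have := Real.pi_pos
    positivity) (by
    refine (((Gr_mon 15).sum (hm 1 one_pos)).mul_right (Real.exp (3 * Real.pi))).congr fun k => ?_
    rw [he, one_mul, one_mul, ← mul_assoc, norm_mul _ (Complex.ofReal (Real.exp (-(3 * Real.pi)))), mul_assoc, Complex.norm_real, Real.norm_eq_abs, Real.abs_exp,
      ← Real.exp_add, neg_add_cancel, Real.exp_zero, mul_one])
  have hz : ∀ᶠ t : ℝ in atTop, ∑' k, mon 15 k * Real.exp (-(t * (Real.pi / 4 * (2 * dt k.1 k.1 - 2 * dt k.1 k.2 + 2 * dt k.2 k.2 - 12)))) = 0 := by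
    filter_upwards [eventually_gt_atTop 0] with t ht
    have h1 := F0_on (hm t ht) (15 : Fin 19)
    rw [hF, Pi.zero_apply, Pi.zero_apply, eq_comm, mul_eq_zero] at h1
    have h2 := h1.resolve_left (by
      have : Nat.choose 18 15 ≠ 0 := by decide
      exact_mod_cast this)
    simp only [he, ← mul_assoc (mon _ _)] at h2
    rw [tsum_mul_right, mul_eq_zero] at h2
    exact h2.resolve_right (by exact_mod_cast (Real.exp_pos _).ne')
  have hlim := tendsto_nhds_unique h ((tendsto_congr' hz).2 tendsto_const_nhds)
  rw [tsum_eq_sum (s := S4 ×ˢ S4)] at hlim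
  · apply fin_ne
    rw [← GaussianInt.toComplex_eq_zero, map_sum, ← hlim]
    refine Finset.sum_congr rfl fun k hk => ?_
    obtain ⟨h1, h2⟩ := Finset.mem_product.1 hk
    have h1 := (Finset.mem_filter.1 h1).2
    have h2 := (Finset.mem_filter.1 h2).2
    rw [h1, h2]
    by_cases h3 : dt k.1 k.2 = 2
    · rw [if_pos h3, if_pos (by rw [h3]; norm_num), monZ_c]
    · rw [if_neg h3, if_neg, map_zero]
      intro h4
      apply h3
      have h5 := (mul_eq_zero.1 h4).resolve_left (by have := Real.pi_pos; positivity)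
      have h6 : (dt k.1 k.2 : ℝ) = 2 := by push_cast at h5; linarith
      exact_mod_cast h6
  · intro k hk
    split_ifs with h4
    · by_contra hc
      obtain ⟨h1, h2, h3⟩ := hph k (mon_ph hc)
      have h5 := (mul_eq_zero.1 h4).resolve_left (by have := Real.pi_pos; positivity)
      have h6 : 2 * dt k.1 k.1 - 2 * dt k.1 k.2 + 2 * dt k.2 k.2 - 12 = 0 := by exact_mod_cast h5
      exact hk (Finset.mem_product.2 ⟨S4_mem (by linarith), S4_mem (by linarith)⟩)
    · rfl

end P16

/-- The space `S_{18,2}(Γ₂,ε)` has dimension 1 over `ℂ`. -/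
theorem dim_S18_2_eps (ε : Matrix (Fin 4) (Fin 4) ℤ → ℂ) (hε : IsEps ε) :
    Module.finrank ℂ ↥(SiegelCusp 18 2 Sp4Z ε) = 1 :=
  finrank_of hε F0 (cusp_of_laws hε F0_laws F0_diff F0_off F0_cusp) F0_ne
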